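/- arXiv:2306.11997 — 2 statements merged into one kernel-verified Lean document; each statement's English description precedes it below -/
import Mathlib

section
/- For every positive integer n with n ≡ 1, 2, 3 or 6 (mod 12) or n ≡ 0 (mod 24), there exists a cyclic (n,6,4)_3 code with exactly C(n) codewords, where C(n) = n·⌊(n−1)/6⌋ if n is odd or n ≡ 2 (mod 6), and C(n) = n·⌊(n−1)/6⌋ + n/2 if n ≡ 0 or 4 (mod 6); in particular such a code is optimal. -/
/-- A cyclic ternary constant-weight code of length `n`, weight `4` and minimum
distance `6`: a set of vectors in `{0,1,2}^n` (coordinates indexed by `Z_n`),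
each of Hamming weight exactly `4`, pairwise at Hamming distance at least `6`,
and closed under the cyclic shift. -/
def IsCyclicCode643 (n : ℕ) [NeZero n] (𝓒 : Set (ZMod n → Fin 3)) : Prop :=
  (∀ u ∈ 𝓒, (Finset.univ.filter fun i => u i ≠ 0).card = 4) ∧
  (∀ u ∈ 𝓒, ∀ v ∈ 𝓒, u ≠ v → 6 ≤ hammingDist u v) ∧
  (∀ u ∈ 𝓒, (fun i => u (i + 1)) ∈ 𝓒)

/-- The upper bound `C(n)` on the size of a cyclic `(n,6,4)_3` code. -/
def codeBound (n : ℕ) : ℕ :=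
  if Odd n ∨ n % 6 = 2 then n * ((n - 1) / 6) else n * ((n - 1) / 6) + n / 2

namespace CC
variable {n : ℕ} [NeZero n]

abbrev Wd (n : ℕ) := ZMod n → Fin 3

def sh (t : ZMod n) (u : Wd n) : Wd n := fun i => u (i + t)

def supp (u : Wd n) : Finset (ZMod n) := Finset.univ.filter fun i => u i ≠ 0

theorem mem_supp {u : Wd n} {i : ZMod n} : i ∈ supp u ↔ u i ≠ 0 := by simp [supp]

theorem sh_zero (u : Wd n) : sh 0 u = u := by funext i; simp [sh]

theorem sh_sh (s t : ZMod n) (u : Wd n) : sh s (sh t u) = sh (s + t) u := by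
  funext i; simp [sh, add_assoc]

/-- symmetric conditions for distance six -/
def Good (u v : Wd n) : Prop :=
  (∀ p p', p ≠ p' → u p ≠ 0 → v p ≠ 0 → u p' ≠ 0 → v p' ≠ 0 → u p ≠ v p) ∧
  (∀ p q r, p ≠ q → p ≠ r → q ≠ r → u p ≠ 0 → v p ≠ 0 → u q ≠ 0 → v q ≠ 0 →
    u r ≠ 0 → v r ≠ 0 → False)

theorem dist_formula (u v : Wd n) (hu : (supp u).card = 4) (hv : (supp v).card = 4) :
    hammingDist u v + (supp u ∩ supp v).card +
      ((supp u ∩ supp v).filter fun i => u i = v i).card = 8 := by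
  have h1 : (supp u ∪ supp v).card + (supp u ∩ supp v).card = 8 := by
    rw [Finset.card_union_add_card_inter, hu, hv]
  have h2 : hammingDist u v = ((supp u ∪ supp v).filter fun i => ¬ (u i = v i)).card := by
    unfold hammingDist
    congr 1
    ext i
    simp only [Finset.mem_filter, Finset.mem_univ, true_and, Finset.mem_union, mem_supp]
    constructor
    · intro h
      refine ⟨?_, h⟩
      by_contra hc
      push Not at hc
      exact h (hc.1.trans hc.2.symm)
    · exact fun h => h.2
  have h3 : ((supp u ∩ supp v).filter fun i => u i = v i) =
      ((supp u ∪ supp v).filter fun i => u i = v i) := by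
    ext i
    simp only [Finset.mem_filter, Finset.mem_inter, Finset.mem_union, mem_supp]
    constructor
    · rintro ⟨⟨a, b⟩, c⟩; exact ⟨Or.inl a, c⟩
    · rintro ⟨a, c⟩
      rw [c] at a ⊢
      simp only [or_self] at a
      exact ⟨⟨a, a⟩, rfl⟩
  have h4 := Finset.card_filter_add_card_filter_not (s := supp u ∪ supp v) (fun i => u i = v i)
  rw [h3, h2]
  omega

theorem good_dist (u v : Wd n) (hu : (supp u).card = 4) (hv : (supp v).card = 4)
    (h : Good u v) : 6 ≤ hammingDist u v := by
  have hf := dist_formula u v hu hv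
  have h3 : (supp u ∩ supp v).card ≤ 2 := by
    by_contra hc
    push Not at hc
    obtain ⟨a, b, c, ha, hb, hc, hab, hac, hbc⟩ := Finset.two_lt_card_iff.1 hc
    simp only [Finset.mem_inter, mem_supp] at ha hb hc
    exact h.2 a b c hab hac hbc ha.1 ha.2 hb.1 hb.2 hc.1 hc.2
  have h4 : 1 < (supp u ∩ supp v).card → ((supp u ∩ supp v).filter fun i => u i = v i).card = 0 := by
    intro h1
    rw [Finset.card_eq_zero, Finset.filter_eq_empty_iff]
    intro p hp he
    obtain ⟨q, hq, hqp⟩ := Finset.exists_mem_ne h1 p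
    simp only [Finset.mem_inter, mem_supp] at hp hq
    exact h.1 p q hqp.symm hp.1 hp.2 hq.1 hq.2 he
  have h5 : ((supp u ∩ supp v).filter fun i => u i = v i).card ≤ (supp u ∩ supp v).card :=
    Finset.card_filter_le _ _
  by_cases h1 : 1 < (supp u ∩ supp v).card
  · have := h4 h1; omega
  · omega

theorem dist_two (u v : Wd n) (hu : (supp u).card = 4) (hv : (supp v).card = 4)
    (h : 6 ≤ hammingDist u v) (p q : ZMod n) (hpq : p ≠ q) (hup : u p ≠ 0) (hvp : v p ≠ 0)
    (huq : u q ≠ 0) (hvq : v q ≠ 0) : u p ≠ v p := by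
  intro he
  have hf := dist_formula u v hu hv
  have h2 : 1 < (supp u ∩ supp v).card := by
    rw [Finset.one_lt_card]
    exact ⟨p, by simp [mem_supp, hup, hvp], q, by simp [mem_supp, huq, hvq], hpq⟩
  have h1 : 0 < ((supp u ∩ supp v).filter fun i => u i = v i).card := by
    rw [Finset.card_pos]
    exact ⟨p, by simp [mem_supp, hup, hvp, he]⟩
  omega

/-! upper bound -/
section upper
variable {X : Finset (Wd n)}

structure Cyc (X : Finset (Wd n)) : Prop where
  w : ∀ u ∈ X, (supp u).card = 4
  d : ∀ u ∈ X, ∀ v ∈ X, u ≠ v → 6 ≤ hammingDist u v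
  s : ∀ u ∈ X, ∀ t, sh t u ∈ X

theorem fin3 : ∀ x : Fin 3, x ≠ 0 → x ∈ ({1, 2} : Finset (Fin 3)) := by decide

theorem pair_le (hX : Cyc X) (p q : ZMod n) (hpq : p ≠ q) :
    (X.filter fun u => u p ≠ 0 ∧ u q ≠ 0).card ≤ 2 := by
  have : (X.filter fun u => u p ≠ 0 ∧ u q ≠ 0).card ≤ ({1, 2} : Finset (Fin 3)).card := by
    apply Finset.card_le_card_of_injOn (fun u => u p)
    · intro u hu
      have hu := (Finset.mem_filter.1 (Finset.mem_coe.1 hu)).2.1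
      exact Finset.mem_coe.2 (fin3 _ hu)
    · intro u hu v hv he
      have hu := Finset.mem_filter.1 (Finset.mem_coe.1 hu)
      have hv := Finset.mem_filter.1 (Finset.mem_coe.1 hv)
      by_contra hne
      exact dist_two u v (hX.w u hu.1) (hX.w v hv.1) (hX.d u hu.1 v hv.1 hne) p q hpq
        hu.2.1 hv.2.1 hu.2.2 hv.2.2 he
  simpa using this

theorem count_pairs (hX : Cyc X) : 6 * X.card ≤ n * (n - 1) := by
  have h := Finset.sum_card_bipartiteAbove_eq_sum_card_bipartiteBelow
    (s := X) (t := (Finset.univ : Finset (ZMod n)).offDiag)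
    (fun u pq => u pq.1 ≠ 0 ∧ u pq.2 ≠ 0)
  have h1 : ∑ u ∈ X, ((Finset.univ : Finset (ZMod n)).offDiag.bipartiteAbove
      (fun u pq => u pq.1 ≠ 0 ∧ u pq.2 ≠ 0) u).card = ∑ u ∈ X, 12 := by
    apply Finset.sum_congr rfl
    intro u hu
    have : (Finset.univ : Finset (ZMod n)).offDiag.bipartiteAbove
      (fun (u : Wd n) pq => u pq.1 ≠ 0 ∧ u pq.2 ≠ 0) u = (supp u).offDiag := by
      ext ⟨a, b⟩
      simp only [Finset.bipartiteAbove, Finset.mem_filter, Finset.mem_offDiag, Finset.mem_univ,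
        mem_supp]
      tauto
    rw [this, Finset.offDiag_card, hX.w u hu]
  have h2 : ∑ pq ∈ (Finset.univ : Finset (ZMod n)).offDiag, (X.bipartiteBelow
      (fun u pq => u pq.1 ≠ 0 ∧ u pq.2 ≠ 0) pq).card ≤
      ∑ pq ∈ (Finset.univ : Finset (ZMod n)).offDiag, 2 := by
    apply Finset.sum_le_sum
    rintro ⟨a, b⟩ hab
    exact pair_le hX a b (Finset.mem_offDiag.1 hab).2.2
  rw [← h, h1] at h2
  simp only [Finset.sum_const, smul_eq_mul, Finset.offDiag_card, Finset.card_univ,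
    ZMod.card] at h2
  have : n * n - n = n * (n - 1) := by rw [Nat.mul_sub, mul_one]
  rw [this] at h2
  omega

theorem four_t (u : Wd n) (hu : (supp u).card = 4) (t : ZMod n) (h : sh t u = u) : 4 * t = 0 := by
  have h1 : ∑ p ∈ supp u, (p + t) = ∑ p ∈ supp u, p := by
    apply Finset.sum_bij (fun p _ => p + t)
    · intro a ha
      rw [mem_supp] at ha ⊢
      rwa [← h] at ha
    · intro a _ b _ hab
      exact add_right_cancel hab
    · intro b hb
      refine ⟨b - t, ?_, by ring⟩
      rw [mem_supp] at hb ⊢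
      rw [← h]
      simpa [sh] using hb
    · intros; rfl
  rw [Finset.sum_add_distrib, Finset.sum_const, hu] at h1
  simpa using h1

theorem half_inv (u : Wd n) (hu : (supp u).card = 4) (t : ZMod n) (h : sh t u = u) (ht : t ≠ 0) :
    ∃ w : ZMod n, w ≠ 0 ∧ 2 * w = 0 ∧ sh w u = u := by
  have h4 := four_t u hu t h
  by_cases h2 : 2 * t = 0
  · exact ⟨t, ht, h2, h⟩
  · refine ⟨2 * t, h2, ?_, ?_⟩
    · rw [← mul_assoc]; norm_num; exact h4
    · rw [two_mul, ← sh_sh, h, h]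

instance : AddAction (ZMod n) (Wd n) where
  vadd t u := sh t u
  zero_vadd u := sh_zero u
  add_vadd s t u := (sh_sh s t u).symm

theorem dvd_free (Y : Finset (Wd n)) (hs : ∀ u ∈ Y, ∀ t, sh t u ∈ Y)
    (hf : ∀ u ∈ Y, ∀ t, sh t u = u → t = 0) : n ∣ Y.card := by
  let act : AddAction (ZMod n) Y :=
    { vadd := fun t u => ⟨sh t u.1, hs _ u.2 t⟩
      zero_vadd := fun u => Subtype.ext (sh_zero u.1)
      add_vadd := fun s t u => Subtype.ext (sh_sh s t u.1).symm }
  have hst : ∀ b : Y, AddAction.stabilizer (ZMod n) b = ⊥ := by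
    intro b
    rw [eq_bot_iff]
    intro t ht
    have : sh t b.1 = b.1 := congrArg Subtype.val (AddAction.mem_stabilizer_iff.1 ht)
    exact hf _ b.2 t this
  have e := AddAction.selfEquivOrbitsQuotientProd hst
  have := Nat.card_congr e
  rw [Nat.card_prod, Nat.card_zmod] at this
  simp only [Nat.card_eq_fintype_card, Fintype.card_coe] at this
  exact ⟨_, by rw [this, mul_comm]⟩

theorem upper_odd (hX : Cyc X) (hn : n % 2 = 1) : X.card ≤ n * ((n - 1) / 6) := by
  have hc := count_pairs hX
  have hd : n ∣ X.card := by
    apply dvd_free X hX.s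
    intro u hu t ht
    by_contra h0
    have h4 := four_t u (hX.w u hu) t ht
    have hunit : IsUnit ((4 : ℕ) : ZMod n) := by
      rw [ZMod.isUnit_iff_coprime]
      have : Nat.Coprime 2 n := (Nat.coprime_two_left).2 (Nat.odd_iff.2 hn)
      exact Nat.Coprime.mul_left this this
    exact h0 ((hunit.mul_right_eq_zero).1 (by exact_mod_cast h4))
  obtain ⟨f, hf⟩ := hd
  rw [hf] at hc ⊢
  have hn0 : 0 < n := Nat.pos_of_ne_zero (NeZero.ne n)
  apply Nat.mul_le_mul_left
  have : 6 * f ≤ n - 1 := by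
    apply Nat.le_of_mul_le_mul_left _ hn0
    calc n * (6 * f) = 6 * (n * f) := by ring
      _ ≤ _ := hc
  omega

theorem two_mul_zero (h : ℕ) (hn : n = 2 * h) (w : ZMod n) (hw : w ≠ 0) (h2 : 2 * w = 0) :
    w = (h : ZMod n) := by
  have hv : ((2 * w.val : ℕ) : ZMod n) = 0 := by
    push_cast; rw [ZMod.natCast_zmod_val]; exact h2
  rw [ZMod.natCast_eq_zero_iff] at hv
  have hlt := ZMod.val_lt w
  have hpos : 0 < w.val := Nat.pos_of_ne_zero (by rwa [Ne, ZMod.val_eq_zero])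
  obtain ⟨c, hc⟩ := hv
  have : c = 1 := by
    have : c < 2 := by
      by_contra h; push Not at h
      have : n * 2 ≤ n * c := Nat.mul_le_mul_left _ h
      omega
    rcases Nat.eq_zero_or_pos c with h | h
    · subst h; omega
    · omega
  subst this
  rw [← ZMod.natCast_zmod_val w]
  congr 1
  omega

theorem upper_even (hX : Cyc X) (h : ℕ) (hn : n = 2 * h) :
    ∃ f a : ℕ, X.card = n * f + a ∧ a ≤ h ∧ (a = 0 ∨ h % 2 = 0 ∨ h ≤ a) := by
  classical
  set A := X.filter fun u => sh (h : ZMod n) u = u with hA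
  set Y := X.filter fun u => ¬ sh (h : ZMod n) u = u with hY
  have hn0 : 0 < n := Nat.pos_of_ne_zero (NeZero.ne n)
  have hh0 : (h : ZMod n) ≠ 0 := by
    rw [Ne, ZMod.natCast_eq_zero_iff]
    intro hd
    have := Nat.le_of_dvd (by omega) hd
    omega
  have hcomm : ∀ (s t : ZMod n) (u : Wd n), sh s (sh t u) = sh t (sh s u) := by
    intro s t u; rw [sh_sh, sh_sh, add_comm]
  have hYd : n ∣ Y.card := by
    apply dvd_free
    · intro u hu t
      rw [hY, Finset.mem_filter] at hu ⊢
      refine ⟨hX.s u hu.1 t, fun hc => hu.2 ?_⟩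
      rw [hcomm] at hc
      have := congrArg (sh (-t)) hc
      simpa [sh_sh, sh_zero] using this
    · intro u hu t ht
      rw [hY, Finset.mem_filter] at hu
      by_contra h0
      obtain ⟨w, hw0, hw2, hw⟩ := half_inv u (hX.w u hu.1) t ht h0
      rw [two_mul_zero h hn w hw0 hw2] at hw
      exact hu.2 hw
  obtain ⟨f, hf⟩ := hYd
  have hsum : A.card + Y.card = X.card := Finset.card_filter_add_card_filter_not _
  refine ⟨f, A.card, by omega, ?_, ?_⟩
  · have hb := Finset.sum_card_bipartiteAbove_eq_sum_card_bipartiteBelow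
      (s := A) (t := (Finset.univ : Finset (ZMod n))) (fun u p => u p ≠ 0)
    have h1 : ∑ u ∈ A, ((Finset.univ : Finset (ZMod n)).bipartiteAbove
        (fun u p => u p ≠ 0) u).card = ∑ u ∈ A, 4 := by
      apply Finset.sum_congr rfl
      intro u hu
      exact hX.w u (Finset.mem_filter.1 hu).1
    have h2 : ∑ p ∈ (Finset.univ : Finset (ZMod n)), (A.bipartiteBelow
        (fun u p => u p ≠ 0) p).card ≤ ∑ p ∈ (Finset.univ : Finset (ZMod n)), 2 := by
      apply Finset.sum_le_sum
      intro p _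
      refine le_trans (Finset.card_le_card ?_) (pair_le hX p (p + h) ?_)
      · intro u hu
        simp only [Finset.bipartiteBelow, Finset.mem_filter, hA] at hu ⊢
        refine ⟨hu.1.1, hu.2, ?_⟩
        have := congrFun hu.1.2 p
        simp only [sh] at this
        rw [this]; exact hu.2
      · intro he
        apply hh0
        simpa using he
    rw [← hb, h1] at h2
    simp only [Finset.sum_const, smul_eq_mul, Finset.card_univ, ZMod.card] at h2
    omega
  · by_cases hA0 : A.card = 0
    · exact Or.inl hA0
    right
    by_cases hh : h % 2 = 0
    · exact Or.inl hh
    right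
    obtain ⟨u, hu⟩ := Finset.card_pos.1 (Nat.pos_of_ne_zero hA0)
    rw [hA, Finset.mem_filter] at hu
    have : (Finset.range h).card ≤ A.card := by
      apply Finset.card_le_card_of_injOn (fun t : ℕ => sh (t : ZMod n) u)
      · intro t _
        simp only [hA, Finset.coe_filter, Set.mem_ofPred_eq]
        refine ⟨hX.s u hu.1 _, ?_⟩
        rw [hcomm, hu.2]
      · have key : ∀ s t : ℕ, s < h → t < h → s ≤ t → sh (s : ZMod n) u = sh (t : ZMod n) u → s = t := by
          intro s t hs ht hst he
          have h1 := congrArg (sh (-(s : ZMod n))) he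
          rw [sh_sh, sh_sh, neg_add_cancel, sh_zero] at h1
          have h2 := four_t u (hX.w u hu.1) _ h1.symm
          have h3 : ((4 * (t - s) : ℕ) : ZMod n) = 0 := by
            rw [← h2]; push_cast [Nat.cast_sub hst]; ring
          rw [ZMod.natCast_eq_zero_iff, hn] at h3
          have h4 : h ∣ 2 * (t - s) := by
            have : 2 * h ∣ 2 * (2 * (t - s)) := by rw [← mul_assoc]; exact h3
            exact Nat.dvd_of_mul_dvd_mul_left (by norm_num) this
          have hcop : Nat.Coprime h 2 := (Nat.coprime_two_right).2 (Nat.odd_iff.2 (by omega))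
          have h5 := hcop.dvd_of_dvd_mul_left h4
          rcases Nat.eq_zero_or_pos (t - s) with h6 | h6
          · omega
          · have := Nat.le_of_dvd h6 h5; omega
        intro s hs t ht he
        simp only [Finset.coe_range, Set.mem_Iio] at hs ht
        rcases le_total s t with hst | hst
        · exact key s t hs ht hst he
        · exact (key t s ht hs hst he.symm).symm
    simpa using this

theorem upper (hX : Cyc X)
    (hn : n % 12 = 1 ∨ n % 12 = 2 ∨ n % 12 = 3 ∨ n % 12 = 6 ∨ n % 24 = 0) :
    X.card ≤ codeBound n := by
  have hc := count_pairs hX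
  have hn0 : 0 < n := Nat.pos_of_ne_zero (NeZero.ne n)
  unfold codeBound
  by_cases ho : n % 2 = 1
  · rw [if_pos (Or.inl (Nat.odd_iff.2 ho))]
    exact upper_odd hX ho
  · obtain ⟨f, a, h1, h2, h3⟩ := upper_even hX (n / 2) (by omega)
    have hfle : 6 * f ≤ n - 1 := by
      apply Nat.le_of_mul_le_mul_left _ hn0
      calc n * (6 * f) = 6 * (n * f) := by ring
        _ ≤ _ := by omega
    by_cases h6 : n % 6 = 2
    · rw [if_pos (Or.inr h6), h1]
      have h2' : n % 12 = 2 := by omega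
      obtain ⟨k, hk⟩ : ∃ k, n = 12 * k + 2 := ⟨n / 12, by omega⟩
      have e : (n - 1) / 6 = 2 * k := by omega
      rw [e]
      rcases h3 with h3 | h3 | h3
      · subst h3
        have : f ≤ 2 * k := by omega
        have := Nat.mul_le_mul_left n this
        omega
      · omega
      · have hf : f < 2 * k := by
          by_contra hcon
          push Not at hcon
          have h7 := Nat.mul_le_mul_left n hcon
          have h8 : n * (n - 1) = 6 * (n * (2 * k)) + n := by
            have : n - 1 = 12 * k + 1 := by omega
            rw [this]; ring
          omega
        have := Nat.mul_le_mul_left n (Nat.succ_le_of_lt hf)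
        rw [Nat.mul_succ] at this
        omega
    · have hno : ¬ Odd n := by rw [Nat.odd_iff]; exact ho
      rw [if_neg (by tauto), h1]
      have : f ≤ (n - 1) / 6 := by omega
      have := Nat.mul_le_mul_left n this
      omega

end upper
end CC

namespace CC
variable {n : ℕ} [NeZero n]

structure IsComp (S : Set (Wd n)) (Δ : Set (ZMod n)) (m : ℕ) : Prop where
  w : ∀ u ∈ S, (supp u).card = 4
  g : ∀ u ∈ S, ∀ v ∈ S, u ≠ v → Good u v
  s : ∀ u ∈ S, ∀ t, sh t u ∈ S
  c : S.ncard = m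
  d : ∀ u ∈ S, ∀ p q, p ≠ q → u p ≠ 0 → u q ≠ 0 → q - p ∈ Δ

theorem Good.symm {u v : Wd n} (h : Good u v) : Good v u := by
  refine ⟨fun p p' hp a b c d e => h.1 p p' hp b a d c e.symm, ?_⟩
  intro p q r a b c d e f g i j
  exact h.2 p q r a b c e d g f j i

theorem good_irrefl {u : Wd n} (hu : (supp u).card = 4) : ¬ Good u u := by
  intro h
  obtain ⟨p, q, hp, hq, hpq⟩ := Finset.one_lt_card_iff.1 (by omega : 1 < (supp u).card)
  rw [mem_supp] at hp hq
  exact h.1 p q hpq hp hp hq hq rfl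

theorem comp_union' {S T : Set (Wd n)} {Δ Δ' : Set (ZMod n)} {m m' : ℕ} (hS : IsComp S Δ m)
    (hT : IsComp T Δ' m') (hg : ∀ u ∈ S, ∀ v ∈ T, Good u v) :
    IsComp (S ∪ T) (Δ ∪ Δ') (m + m') := by
  refine ⟨?_, ?_, ?_, ?_, ?_⟩
  · rintro u (hu | hu)
    · exact hS.w u hu
    · exact hT.w u hu
  · rintro u (hu | hu) v (hv | hv) h
    · exact hS.g u hu v hv h
    · exact hg u hu v hv
    · exact (hg v hv u hu).symm
    · exact hT.g u hu v hv h
  · rintro u (hu | hu) t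
    · exact Or.inl (hS.s u hu t)
    · exact Or.inr (hT.s u hu t)
  · rw [Set.ncard_union_eq, hS.c, hT.c]
    rw [Set.disjoint_left]
    intro u hu hv
    exact good_irrefl (hS.w u hu) (hg u hu u hv)
  · rintro u (hu | hu) p q a b c
    · exact Or.inl (hS.d u hu p q a b c)
    · exact Or.inr (hT.d u hu p q a b c)

theorem comp_union {S T : Set (Wd n)} {Δ Δ' : Set (ZMod n)} {m m' : ℕ} (hS : IsComp S Δ m)
    (hT : IsComp T Δ' m') (hd : Disjoint Δ Δ') : IsComp (S ∪ T) (Δ ∪ Δ') (m + m') := by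
  apply comp_union' hS hT
  intro u hu v hv
  rw [Set.disjoint_left] at hd
  constructor
  · intro p p' h a b c d
    exact absurd (hT.d v hv p p' h b d) (hd (hS.d u hu p p' h a c))
  · intro p q r h _ _ a b c d _ _
    exact absurd (hT.d v hv p q h b d) (hd (hS.d u hu p q h a c))

theorem comp_empty : IsComp (∅ : Set (Wd n)) ∅ 0 := by
  refine ⟨?_, ?_, ?_, ?_, ?_⟩ <;> simp

/-- word with support P and colours c -/
def mk (P : Fin 4 → ZMod n) (c : Fin 4 → Fin 3) : Wd n := fun i =>
  if i = P 0 then c 0 else if i = P 1 then c 1 else if i = P 2 then c 2 else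
    if i = P 3 then c 3 else 0

theorem mk_ne {P : Fin 4 → ZMod n} {c : Fin 4 → Fin 3} {i : ZMod n} (h : mk P c i ≠ 0) :
    ∃ a, i = P a := by
  by_contra hc
  push Not at hc
  simp [mk, hc] at h

theorem mk_at {P : Fin 4 → ZMod n} (hP : Function.Injective P) (c : Fin 4 → Fin 3) (a : Fin 4) :
    mk P c (P a) = c a := by
  unfold mk
  simp only [hP.eq_iff]
  fin_cases a <;> simp

theorem mk_supp {P : Fin 4 → ZMod n} (hP : Function.Injective P) {c : Fin 4 → Fin 3}
    (hc : ∀ a, c a ≠ 0) : (supp (mk P c)).card = 4 := by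
  have : supp (mk P c) = Finset.univ.image P := by
    ext i
    simp only [mem_supp, Finset.mem_image, Finset.mem_univ, true_and]
    constructor
    · intro h
      obtain ⟨a, ha⟩ := mk_ne h
      exact ⟨a, ha.symm⟩
    · rintro ⟨a, rfl⟩
      rw [mk_at hP]
      exact hc a
  rw [this, Finset.card_image_of_injective _ hP]
  simp

theorem sh_supp (t : ZMod n) (u : Wd n) : (supp (sh t u)).card = (supp u).card := by
  apply Finset.card_bij (fun i _ => i + t)
  · intro a ha
    rw [mem_supp] at ha ⊢
    exact ha
  · intro a _ b _ h
    exact add_right_cancel h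
  · intro b hb
    refine ⟨b - t, ?_, by ring⟩
    rw [mem_supp] at hb ⊢
    simpa [sh] using hb

/-- shared points criterion -/
theorem sh_mk_common {P P' : Fin 4 → ZMod n} (hP : Function.Injective P)
    (hP' : Function.Injective P') {c c' : Fin 4 → Fin 3} {t t' : ZMod n} 
    (h2 : ∀ a b a' b', a ≠ b → a' ≠ b' → P b - P a = P' b' - P' a' → 
      P a - t = P' a' - t' → c a ≠ c' a')
    (h3 : ∀ a b d a' b' d', a ≠ b → a ≠ d → b ≠ d → a' ≠ b' → a' ≠ d' → b' ≠ d' →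
      P b - P a = P' b' - P' a' → P d - P a = P' d' - P' a' → P a - t ≠ P' a' - t') :
    Good (sh t (mk P c)) (sh t' (mk P' c')) := by
  constructor
  · intro p q hpq h1 h2' h3 h4
    obtain ⟨a, ha⟩ := mk_ne h1
    obtain ⟨a', ha'⟩ := mk_ne h2'
    obtain ⟨b, hb⟩ := mk_ne h3
    obtain ⟨b', hb'⟩ := mk_ne h4
    simp only [sh]
    rw [ha, ha', mk_at hP, mk_at hP']
    apply h2 a b a' b'
    · rintro rfl
      rw [← ha] at hb
      exact hpq (add_right_cancel hb).symm
    · rintro rfl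
      rw [← ha'] at hb'
      exact hpq (add_right_cancel hb').symm
    · rw [← ha, ← ha', ← hb, ← hb']; ring
    · rw [← ha, ← ha']; ring
  · intro p q r hpq hpr hqr h1 h2' h3' h4 h5 h6
    obtain ⟨a, ha⟩ := mk_ne h1
    obtain ⟨a', ha'⟩ := mk_ne h2'
    obtain ⟨b, hb⟩ := mk_ne h3'
    obtain ⟨b', hb'⟩ := mk_ne h4
    obtain ⟨d, hd⟩ := mk_ne h5
    obtain ⟨d', hd'⟩ := mk_ne h6
    have key : ∀ (x y : ZMod n) (s : ZMod n), x ≠ y → ∀ (Q : Fin 4 → ZMod n) (i j : Fin 4),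
        x + s = Q i → y + s = Q j → i ≠ j := by
      rintro x y s hxy Q i j hi hj rfl
      rw [← hj] at hi
      exact hxy (add_right_cancel hi)
    refine h3 a b d a' b' d' (key _ _ _ hpq _ _ _ ha hb) (key _ _ _ hpr _ _ _ ha hd)
      (key _ _ _ hqr _ _ _ hb hd) (key _ _ _ hpq _ _ _ ha' hb') (key _ _ _ hpr _ _ _ ha' hd')
      (key _ _ _ hqr _ _ _ hb' hd') ?_ ?_ ?_
    · rw [← ha, ← ha', ← hb, ← hb']; ring
    · rw [← ha, ← ha', ← hd, ← hd']; ring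
    · rw [← ha, ← ha']; ring

theorem comp_list {m : ℕ} {α : Type*} (P : Fin m → Fin 4 → ZMod n) (c : Fin m → Fin 4 → Fin 3)
    (lab : Fin m → Fin 4 → Fin 4 → α) (Δ : Set (ZMod n))
    (hP : ∀ w, Function.Injective (P w)) (hc : ∀ w a, c w a ≠ 0)
    (hl : ∀ w w' a b a' b', a ≠ b → a' ≠ b' → P w b - P w a = P w' b' - P w' a' →
      lab w a b = lab w' a' b')
    (h2 : ∀ w w' a b a' b', a ≠ b → a' ≠ b' → lab w a b = lab w' a' b' →
      (w = w' ∧ a = a') ∨ c w a ≠ c w' a')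
    (h3 : ∀ w w' a b a' b', a ≠ b → a' ≠ b' → lab w a b = lab w' a' b' → 
      ∀ d d', a ≠ d → b ≠ d → a' ≠ d' → b' ≠ d' → lab w a d = lab w' a' d' → w = w' ∧ a = a')
    (hD : ∀ w a b, a ≠ b → P w b - P w a ∈ Δ) :
    IsComp (Set.range fun x : Fin m × ZMod n => sh x.2 (mk (P x.1) (c x.1))) Δ (m * n) := by
  have hinj : Function.Injective (fun x : Fin m × ZMod n => sh x.2 (mk (P x.1) (c x.1))) := by
    rintro ⟨w, t⟩ ⟨w', t'⟩ h
    simp only at h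
    have e : ∀ a, ∃ a', P w a - t + t' = P w' a' ∧ c w a = c w' a' := by
      intro a
      have h1 := congrFun h (P w a - t)
      simp only [sh, sub_add_cancel, mk_at (hP w)] at h1
      have h2 := hc w a
      rw [h1] at h2
      obtain ⟨a', ha'⟩ := mk_ne h2
      refine ⟨a', ha', ?_⟩
      rw [h1, ha', mk_at (hP w')]
    obtain ⟨a', ha, hca⟩ := e 0
    obtain ⟨b', hb, -⟩ := e 1
    have hab : a' ≠ b' := by
      rintro rfl
      rw [← hb] at ha
      have : P w 0 = P w 1 := by linear_combination ha
      exact absurd (hP w this) (by decide)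
    have := h2 w w' 0 1 a' b' (by decide) hab (hl w w' 0 1 a' b' (by decide) hab (by
      rw [← ha, ← hb]; ring))
    obtain ⟨rfl, rfl⟩ := this.resolve_right (fun h => h hca)
    simp only [Prod.mk.injEq, true_and]
    linear_combination -ha
  refine ⟨?_, ?_, ?_, ?_, ?_⟩
  · rintro _ ⟨⟨w, t⟩, rfl⟩
    simp only
    rw [sh_supp, mk_supp (hP w) (hc w)]
  · rintro _ ⟨⟨w, t⟩, rfl⟩ _ ⟨⟨w', t'⟩, rfl⟩ hne
    simp only at hne ⊢
    apply sh_mk_common (hP w) (hP w')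
    · intro a b a' b' hab hab' e et
      rcases h2 w w' a b a' b' hab hab' (hl w w' a b a' b' hab hab' e) with ⟨rfl, rfl⟩ | h
      · have : t = t' := by linear_combination -et
        exact absurd (by rw [this]) hne
      · exact h
    · intro a b d a' b' d' hab had hbd hab' had' hbd' e1 e2 et
      obtain ⟨rfl, rfl⟩ := h3 w w' a b a' b' hab hab' (hl w w' a b a' b' hab hab' e1) d d' had hbd
        had' hbd' (hl w w' a d a' d' had had' e2)
      have : t = t' := by linear_combination -et
      exact absurd (by rw [this]) hne
  · rintro _ ⟨⟨w, t⟩, rfl⟩ s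
    exact ⟨⟨w, s + t⟩, by simp only [sh_sh]⟩
  · rw [← Set.image_univ, Set.ncard_image_of_injective _ hinj, Set.ncard_univ]
    simp
  · rintro _ ⟨⟨w, t⟩, rfl⟩ p q hpq h1 h2
    obtain ⟨a, ha⟩ := mk_ne h1
    obtain ⟨b, hb⟩ := mk_ne h2
    have : q - p = P w b - P w a := by rw [← ha, ← hb]; ring
    rw [this]
    apply hD
    rintro rfl
    rw [← ha] at hb
    exact hpq (add_right_cancel hb).symm

end CC

namespace CC
variable {n : ℕ} [NeZero n]

def ΔL (l : List ℤ) : Set (ZMod n) := {z | ∃ d ∈ l, z = (d : ZMod n) ∨ z = -(d : ZMod n)}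

theorem cast_eq_small {d : ℤ} (h : (d : ZMod n) = 0) (h1 : -(n : ℤ) < d) (h2 : d < n) : d = 0 := by
  rw [ZMod.intCast_zmod_eq_zero_iff_dvd] at h
  exact Int.eq_zero_of_abs_lt_dvd h (abs_lt.2 ⟨h1, h2⟩)

theorem pm_eq {d e : ℤ} (hd : 0 < d) (hd2 : 2 * d ≤ n) (he : 0 < e) (he2 : 2 * e ≤ n)
    (h : (d : ZMod n) = e ∨ (d : ZMod n) = -(e : ZMod n)) : d = e := by
  rcases h with h | h
  · have := cast_eq_small (n := n) (d := d - e) (by push_cast; rw [h]; ring) (by omega) (by omega)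
    omega
  · have h' : ((d + e : ℤ) : ZMod n) = 0 := by push_cast; rw [h]; ring
    rw [ZMod.intCast_zmod_eq_zero_iff_dvd] at h'
    have := Int.le_of_dvd (by omega) h'
    omega

theorem ΔL_disj {l l' : List ℤ} (h : ∀ d ∈ l, 0 < d ∧ 2 * d ≤ n) (h' : ∀ d ∈ l', 0 < d ∧ 2 * d ≤ n)
    (hd : l.Disjoint l') : Disjoint (ΔL (n := n) l) (ΔL l') := by
  rw [Set.disjoint_left]
  rintro z ⟨d, hdl, hz⟩ ⟨e, hel, hz'⟩
  have : d = e := by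
    apply pm_eq (n := n) (h d hdl).1 (h d hdl).2 (h' e hel).1 (h' e hel).2
    rcases hz with hz | hz <;> rcases hz' with hz' | hz'
    · left; rw [← hz, hz']
    · right; rw [← hz, hz']
    · right; rw [← hz', hz]; ring
    · left; rw [hz] at hz'; exact neg_injective hz'
  subst this
  exact hd hdl hel

theorem ΔL_append (l l' : List ℤ) : ΔL (n := n) (l ++ l') = ΔL l ∪ ΔL l' := by
  ext z
  simp only [ΔL, Set.mem_ofPred_eq, Set.mem_union, List.mem_append]
  constructor
  · rintro ⟨d, h | h, hz⟩
    · exact Or.inl ⟨d, h, hz⟩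
    · exact Or.inr ⟨d, h, hz⟩
  · rintro (⟨d, h, hz⟩ | ⟨d, h, hz⟩)
    · exact ⟨d, Or.inl h, hz⟩
    · exact ⟨d, Or.inr h, hz⟩

/-- signed labels -/
def sval {m : ℕ} (v : Fin m → ℤ) (l : Fin m × Bool) : ZMod n :=
  if l.2 then (v l.1 : ZMod n) else -(v l.1 : ZMod n)

theorem sval_inj {m : ℕ} {v : Fin m → ℤ} (hv : Function.Injective v)
    (h : ∀ i, 0 < v i ∧ 2 * v i < n) : Function.Injective (sval (n := n) v) := by
  rintro ⟨i, s⟩ ⟨j, t⟩ e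
  have hi := h i
  have hj := h j
  have key : i = j := by
    apply hv
    apply pm_eq (n := n) hi.1 hi.2.le hj.1 hj.2.le
    cases s <;> cases t <;> simp only [sval, if_true, Bool.false_eq_true, if_false] at e
    · left; exact neg_injective e
    · right; rw [← e]; ring
    · right; exact e
    · left; exact e
  subst key
  have key2 : (v i : ZMod n) ≠ -(v i : ZMod n) := by
    intro h
    have := cast_eq_small (n := n) (d := 2 * v i) (by push_cast; linear_combination h)
      (by omega) (by omega)
    omega
  cases s <;> cases t <;> simp only [sval, if_true, Bool.false_eq_true, if_false] at e
  · rfl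
  · exact absurd e.symm key2
  · exact absurd e key2
  · rfl

theorem sval_mem {m : ℕ} (v : Fin m → ℤ) (l : Fin m × Bool) :
    sval (n := n) v l ∈ ΔL (n := n) (List.ofFn v) := by
  refine ⟨v l.1, by simp, ?_⟩
  unfold sval
  split
  · left; rfl
  · right; rfl

theorem sval_ne {m : ℕ} {v : Fin m → ℤ} (h : ∀ i, 0 < v i ∧ 2 * v i < n) (l : Fin m × Bool) :
    sval (n := n) v l ≠ 0 := by
  intro e
  have : (v l.1 : ZMod n) = 0 := by
    unfold sval at e
    split at e
    · exact e
    · exact neg_eq_zero.1 e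
  have := cast_eq_small this (by have := h l.1; omega) (by have := h l.1; omega)
  have := h l.1
  omega

theorem comp_lab {m q : ℕ} (P : Fin m → Fin 4 → ZMod n) (c : Fin m → Fin 4 → Fin 3)
    (v : Fin q → ℤ) (hv : Function.Injective v) (h : ∀ i, 0 < v i ∧ 2 * v i < n)
    (lab : Fin m → Fin 4 → Fin 4 → Fin q × Bool) (hc : ∀ w a, c w a ≠ 0)
    (hl : ∀ w a b, a ≠ b → P w b - P w a = sval v (lab w a b))
    (h2 : ∀ w w' a b a' b', a ≠ b → a' ≠ b' → lab w a b = lab w' a' b' →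
      (w = w' ∧ a = a') ∨ c w a ≠ c w' a')
    (h3 : ∀ w w' a b a' b', a ≠ b → a' ≠ b' → lab w a b = lab w' a' b' → 
      ∀ d d', a ≠ d → b ≠ d → a' ≠ d' → b' ≠ d' → lab w a d = lab w' a' d' → w = w' ∧ a = a') :
    ∃ S : Set (Wd n), IsComp S (ΔL (List.ofFn v)) (m * n) := by
  refine ⟨_, comp_list P c lab _ ?_ hc ?_ h2 h3 ?_⟩
  · intro w a b e
    by_contra hab
    apply sval_ne (n := n) h (lab w a b)
    rw [← hl w a b hab, e, sub_self]
  · intro w w' a b a' b' hab hab' e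
    rw [hl w a b hab, hl w' a' b' hab'] at e
    exact sval_inj hv h e
  · intro w a b hab
    rw [hl w a b hab]
    exact sval_mem _ _

/-- pure pair -/
def plab : Fin 2 → Fin 4 → Fin 4 → Fin 6 × Bool := fun w a b =>
  let k : Fin 6 := (![![0, 0, 1, 2], ![0, 0, 3, 4], ![1, 3, 0, 5], ![2, 4, 5, 0]] : Fin 4 → Fin 4 → Fin 6) a b
  (k, (decide (a < b)) == (decide (w = 0)))

abbrev Blk := ℤ × ℤ × ℤ
def bd (B : Blk) : List ℤ :=
  [B.1, B.2.1, B.2.2, B.2.1 - B.1, B.2.2 - B.1, B.2.2 - B.2.1]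

set_option synthInstance.maxSize 1000 in
set_option synthInstance.maxHeartbeats 200000 in
theorem pure_comp (B : Blk) (hn : (bd B).Nodup) (h : ∀ d ∈ bd B, 0 < d ∧ 2 * d < n) :
    ∃ S : Set (Wd n), IsComp S (ΔL (bd B)) (2 * n) := by
  obtain ⟨x, y, z⟩ := B
  have e : bd (x, y, z) = List.ofFn ![x, y, z, y - x, z - x, z - y] := by
    simp [bd, List.ofFn_succ, Fin.succ]
  rw [e] at hn h ⊢
  rw [List.nodup_ofFn] at hn
  refine comp_lab (m := 2) ![![0, x, y, z], ![-0, -x, -y, -z]] (fun w _ => if w = 0 then 1 else 2)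
    _ hn (fun i => h _ (by rw [List.mem_ofFn]; exact ⟨i, rfl⟩)) plab (by decide) ?_
    (by decide +kernel) (by decide +kernel)
  intro w a b hab
  fin_cases w <;> fin_cases a <;> fin_cases b <;> first | (exact absurd rfl hab) | (simp [sval, plab]; try ring)

/-- three coloured blocks -/
def tlab : Fin 3 → Fin 4 → Fin 4 → Fin 9 × Bool := fun w a b =>
  let k : Fin 9 := (![![![0, 0, 1, 3], ![0, 0, 2, 1], ![1, 2, 0, 0], ![3, 1, 0, 0]],
    ![![0, 4, 5, 6], ![4, 0, 3, 5], ![5, 3, 0, 4], ![6, 5, 4, 0]],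
    ![![0, 7, 8, 6], ![7, 0, 2, 8], ![8, 2, 0, 7], ![6, 8, 7, 0]]] : Fin 3 → Fin 4 → Fin 4 → Fin 9) w a b
  (k, decide (a < b))

def tri (x y z : ℤ) : List ℤ :=
  [x, y, y - x, x + y, z, x + y + z, x + y + 2 * z, x + z, y + z]

set_option synthInstance.maxSize 1000 in
set_option synthInstance.maxHeartbeats 200000 in
theorem tri_comp (x y z : ℤ) (hn : (tri x y z).Nodup) (h : ∀ d ∈ tri x y z, 0 < d ∧ 2 * d < n) :
    ∃ S : Set (Wd n), IsComp S (ΔL (tri x y z)) (3 * n) := by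
  have e : tri x y z = List.ofFn ![x, y, y - x, x + y, z, x + y + z, x + y + 2 * z, x + z, y + z] := by
    simp [tri, List.ofFn_succ, Fin.succ]
  rw [e] at hn h ⊢
  rw [List.nodup_ofFn] at hn
  refine comp_lab (m := 3) (fun w a => ((![![0, x, y, x + y], ![0, z, x + y + z, x + y + 2 * z],
      ![0, x + z, y + z, x + y + 2 * z]] : Fin 3 → Fin 4 → ℤ) w a : ZMod n)) ![![1, 2, 2, 1], ![1, 2, 2, 1], ![2, 1, 1, 2]]
    _ hn (fun i => h _ (by rw [List.mem_ofFn]; exact ⟨i, rfl⟩)) tlab (by decide) ?_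
    (by decide +kernel) (by decide +kernel)
  intro w a b hab
  fin_cases w <;> fin_cases a <;> fin_cases b <;> first | (exact absurd rfl hab) | (simp [sval, tlab]; try ring)

end CC

namespace CC
variable {n : ℕ} [NeZero n]

def hP (b h : ℕ) : Fin 4 → ZMod n := ![0, (h : ZMod n), (b : ZMod n), (b : ZMod n) + (h : ZMod n)]
def hc : Fin 4 → Fin 3 := ![1, 1, 2, 2]

theorem nat_cast_ne (d : ℕ) (h0 : 0 < d) (h1 : d < n) : (d : ZMod n) ≠ 0 := by
  intro h
  rw [ZMod.natCast_eq_zero_iff] at h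
  exact absurd (Nat.le_of_dvd h0 h) (by omega)

section half
variable {b h : ℕ} (hn : n = 2 * h) (hb : 0 < b) (hbh : b < h)
include hn hb hbh

theorem hh_zero : (h : ZMod n) + h = 0 := by
  have : ((2 * h : ℕ) : ZMod n) = 0 := by rw [← hn]; simp
  push_cast at this
  linear_combination this

theorem hP_inj : Function.Injective (hP b h : Fin 4 → ZMod n) := by
  have e := hh_zero hn hb hbh
  have h1 := nat_cast_ne (n := n) h (by omega) (by omega)
  have h2 := nat_cast_ne (n := n) b (by omega) (by omega)
  have h3 := nat_cast_ne (n := n) (b + h) (by omega) (by omega)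
  push_cast at h3
  have h4 : (h : ZMod n) ≠ b := by
    intro e'
    apply h3
    rw [← e', e]
  have h5 : (h : ZMod n) ≠ (b : ZMod n) + h := by
    intro e'
    exact h2 (by linear_combination -e')
  have h6 : (b : ZMod n) ≠ (b : ZMod n) + h := by
    intro e'
    exact h1 (by linear_combination -e')
  intro x y hxy
  fin_cases x <;> fin_cases y <;> first | rfl | (exfalso; simp [hP] at hxy; try first | exact h1 hxy | exact h1 hxy.symm | exact h2 hxy | exact h2 hxy.symm | exact h3 hxy | exact h3 hxy.symm | exact h4 hxy | exact h4 hxy.symm | exact h5 hxy | exact h5 hxy.symm | exact h6 hxy | exact h6 hxy.symm | omega)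

theorem hP_same (x y : Fin 4) (he : hc x = hc y) :
    (hP b h x : ZMod n) - hP b h y = 0 ∨ (hP b h x : ZMod n) - hP b h y = (h : ZMod n) := by
  have e := hh_zero hn hb hbh
  fin_cases x <;> fin_cases y <;> simp [hP, hc] at he ⊢ <;>
    (right; linear_combination -e)

theorem hP_diff (x y : Fin 4) (he : hc x = 1) (he' : hc y = 2) :
    (hP b h x : ZMod n) - hP b h y = -(b : ZMod n) ∨
      (hP b h x : ZMod n) - hP b h y = -(b : ZMod n) + (h : ZMod n) := by
  have e := hh_zero hn hb hbh
  fin_cases x <;> fin_cases y <;> simp [hP, hc] at he he' ⊢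
  · right; linear_combination -e
  · right; ring

theorem half_good (h2b : 2 * b ≠ h) (t t' : ZMod n) (h0 : t - t' ≠ 0) (h1 : t - t' ≠ h) :
    Good (sh t (mk (hP b h) hc)) (sh t' (mk (hP b h) hc)) := by
  have e := hh_zero hn hb hbh
  have inj := hP_inj hn hb hbh
  have key : ∀ a a', (hP b h a : ZMod n) - t = hP b h a' - t' → hc a ≠ hc a' := by
    intro a a' et he
    rcases hP_same hn hb hbh a a' he with h' | h'
    · exact h0 (by linear_combination h' - et)
    · exact h1 (by linear_combination h' - et)
  have hcv : ∀ a, hc a = 1 ∨ hc a = 2 := by decide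
  have key1 : ∀ a a', hc a = 1 → (hP b h a : ZMod n) - t = hP b h a' - t' →
      t - t' = -b ∨ t - t' = -b + h := by
    intro a a' ha et
    have := key a a' et
    have ha' : hc a' = 2 := (hcv a').resolve_left (fun h => this (ha.trans h.symm))
    rcases hP_diff hn hb hbh a a' ha ha' with h' | h'
    · left; linear_combination h' - et
    · right; linear_combination h' - et
  have key2 : ∀ a a', hc a = 2 → (hP b h a : ZMod n) - t = hP b h a' - t' →
      t - t' = b ∨ t - t' = b + h := by
    intro a a' ha et
    have := key a a' et
    have ha' : hc a' = 1 := (hcv a').resolve_right (fun h => this (ha.trans h.symm))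
    rcases hP_diff hn hb hbh a' a ha' ha with h' | h'
    · left; linear_combination -h' - et
    · right; linear_combination -h' - et - e
  have key3 : ∀ a a' d d', hc a = 1 → hc d = 2 → (hP b h a : ZMod n) - t = hP b h a' - t' →
      (hP b h d : ZMod n) - t = hP b h d' - t' → False := by
    intro a a' d d' ha hd e1 e2
    have c1 : ((2 * b : ℕ) : ZMod n) ≠ 0 := nat_cast_ne _ (by omega) (by omega)
    have c2 : ((2 * b : ℕ) : ZMod n) ≠ h := by
      intro hh
      have := (ZMod.natCast_eq_natCast_iff' _ _ _).1 hh
      rw [Nat.mod_eq_of_lt (by omega), Nat.mod_eq_of_lt (by omega)] at this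
      exact h2b this
    push_cast at c1 c2
    rcases key1 a a' ha e1 with h3 | h3 <;> rcases key2 d d' hd e2 with h4 | h4
    · apply c1; linear_combination h3 - h4
    · apply c2; linear_combination h3 - h4 - e
    · apply c2; linear_combination h3 - h4 
    · apply c1; linear_combination h3 - h4
  apply sh_mk_common inj inj
  · intro a _ a' _ _ _ _ et
    exact key a a' et
  · intro a x d a' x' d' h1 h2 h3 _ _ _ e1 e2 et
    have ex : (hP b h x : ZMod n) - t = hP b h x' - t' := by linear_combination e1 + et
    have ed : (hP b h d : ZMod n) - t = hP b h d' - t' := by linear_combination e2 + et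
    have : ∀ a x d : Fin 4, a ≠ x → a ≠ d → x ≠ d → hc a = hc x → hc a = hc d → False := by decide
    rcases hcv a with ha | ha <;> rcases hcv x with hx | hx <;> rcases hcv d with hd | hd
    · exact this a x d h1 h2 h3 (ha.trans hx.symm) (ha.trans hd.symm)
    · exact key3 a a' d d' ha hd et ed
    · exact key3 a a' x x' ha hx et ex
    · exact key3 a a' x x' ha hx et ex
    · exact key3 x x' a a' hx ha ex et
    · exact key3 x x' a a' hx ha ex et
    · exact key3 d d' a a' hd ha ed et
    · exact this a x d h1 h2 h3 (ha.trans hx.symm) (ha.trans hd.symm)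

theorem half_per : sh (h : ZMod n) (mk (hP b h) hc) = mk (hP b h) hc := by
  have e := hh_zero hn hb hbh
  have inj := hP_inj hn hb hbh
  have key : ∀ a : Fin 4, ∃ a', (hP b h a : ZMod n) + (h : ZMod n) = hP b h a' ∧ hc a = hc a' := by
    intro a
    fin_cases a
    · exact ⟨1, by simp [hP], rfl⟩
    · exact ⟨0, by simp [hP, e], rfl⟩
    · exact ⟨3, by simp [hP], rfl⟩
    · refine ⟨2, ?_, rfl⟩
      simp [hP, add_assoc, e]
  funext i
  simp only [sh]
  by_cases hi : ∃ a, i = hP b h a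
  · obtain ⟨a, rfl⟩ := hi
    obtain ⟨a', h1, h2⟩ := key a
    rw [h1, mk_at inj, mk_at inj, h2]
  · have h1 : mk (hP b h) hc i = 0 := by
      by_contra hc
      exact hi (mk_ne hc)
    rw [h1]
    by_contra hc
    obtain ⟨a, ha⟩ := mk_ne hc
    obtain ⟨a', h2, -⟩ := key a
    exact hi ⟨a', by rw [← h2, ← ha, add_assoc, e, add_zero]⟩

theorem half_comp (h2b : 2 * b ≠ h) :
    IsComp (Set.range fun t : ZMod n => sh t (mk (hP b h) hc))
      (ΔL [(b : ℤ), (h : ℤ) - b, (h : ℤ)]) h := by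
  have e := hh_zero hn hb hbh
  have inj := hP_inj hn hb hbh
  have hw : (supp (mk (hP b h : Fin 4 → ZMod n) hc)).card = 4 := mk_supp inj (by decide)
  have hG : ∀ t t' : ZMod n, sh t (mk (hP b h) hc) ≠ sh t' (mk (hP b h) hc) →
      Good (sh t (mk (hP b h) hc)) (sh t' (mk (hP b h) hc)) := by
    intro t t' hne
    apply half_good hn hb hbh h2b
    · intro h; apply hne; rw [sub_eq_zero.1 h]
    · intro h'
      apply hne
      have : t = t' + h := by linear_combination h'
      rw [this, ← sh_sh, half_per hn hb hbh]
  refine ⟨?_, ?_, ?_, ?_, ?_⟩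
  · rintro _ ⟨t, rfl⟩
    simp only [sh_supp, hw]
  · rintro _ ⟨t, rfl⟩ _ ⟨t', rfl⟩ hne
    exact hG t t' hne
  · rintro _ ⟨t, rfl⟩ s
    exact ⟨s + t, by simp only [sh_sh]⟩
  · have : (Set.range fun t : ZMod n => sh t (mk (hP b h) hc)) =
        (fun k : ℕ => sh (k : ZMod n) (mk (hP b h) hc)) '' (Finset.range h : Set ℕ) := by
      ext u
      simp only [Set.mem_range, Set.mem_image, Finset.coe_range, Set.mem_Iio]
      constructor
      · rintro ⟨t, rfl⟩
        have hv := ZMod.val_lt t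
        have ht : ((t.val : ℕ) : ZMod n) = t := ZMod.natCast_zmod_val t
        by_cases hlt : t.val < h
        · exact ⟨t.val, hlt, by rw [ht]⟩
        · refine ⟨t.val - h, by omega, ?_⟩
          have h1 : t = ((t.val - h : ℕ) : ZMod n) + h := by
            conv_lhs => rw [← ht]
            rw [← Nat.cast_add]
            congr 1
            omega
          conv_rhs => rw [h1, ← sh_sh, half_per hn hb hbh]
      · rintro ⟨k, _, rfl⟩
        exact ⟨_, rfl⟩
    rw [this, Set.ncard_image_of_injOn]
    · simp
    · intro k hk k' hk' he
      simp only [Finset.coe_range, Set.mem_Iio] at hk hk'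
      simp only at he
      have key : ∀ d : ℕ, d < h → ∀ d' < h, (d : ZMod n) - d' ≠ h := by
        intro d hd d' hd' h1
        have h2 : ((d' + h : ℕ) : ZMod n) = (d : ℕ) := by push_cast; linear_combination -h1
        have := (ZMod.natCast_eq_natCast_iff' _ _ _).1 h2
        rw [Nat.mod_eq_of_lt (by omega), Nat.mod_eq_of_lt (by omega)] at this
        omega
      by_contra hne
      apply good_irrefl (u := sh (k : ZMod n) (mk (hP b h) hc)) (by rw [sh_supp, hw])
      nth_rewrite 2 [he]
      apply half_good hn hb hbh h2b
      · intro h1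
        have := (ZMod.natCast_eq_natCast_iff' k k' n).1 (sub_eq_zero.1 h1)
        rw [Nat.mod_eq_of_lt (by omega), Nat.mod_eq_of_lt (by omega)] at this
        exact hne this
      · exact key k hk k' hk'
  · rintro _ ⟨t, rfl⟩ p q hpq h1 h2
    obtain ⟨a, ha⟩ := mk_ne h1
    obtain ⟨a', hb'⟩ := mk_ne h2
    have e1 : q - p = (hP b h a' : ZMod n) - hP b h a := by rw [← ha, ← hb']; ring
    have hne : a ≠ a' := by
      rintro rfl
      rw [← ha] at hb'
      exact hpq (add_right_cancel hb').symm
    rw [e1]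
    have m1 : ∀ z : ZMod n, (z = b ∨ z = -b) → z ∈ ΔL (n := n) [(b : ℤ), (h : ℤ) - b, (h : ℤ)] :=
      fun z hz => ⟨b, by simp, by simpa using hz⟩
    have m2 : ∀ z : ZMod n, (z = h - b ∨ z = -(h - b)) → z ∈ ΔL (n := n) [(b : ℤ), (h : ℤ) - b, (h : ℤ)] :=
      fun z hz => ⟨h - b, by simp, by simpa using hz⟩
    have m3 : ∀ z : ZMod n, (z = h ∨ z = -h) → z ∈ ΔL (n := n) [(b : ℤ), (h : ℤ) - b, (h : ℤ)] :=
      fun z hz => ⟨h, by simp, by simpa using hz⟩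
    fin_cases a <;> fin_cases a' <;> first | exact absurd rfl hne | skip
    all_goals simp only [hP, Fin.zero_eta, Fin.mk_one, Fin.reduceFinMk, Matrix.cons_val]
    · apply m3; left; ring
    · apply m1; left; ring
    · apply m2; right; linear_combination e
    · apply m3; right; ring
    · apply m2; right; ring
    · apply m1; left; ring
    · apply m1; right; ring
    · apply m2; left; ring
    · apply m3; left; ring
    · apply m2; left; linear_combination -e
    · apply m1; right; ring
    · apply m3; right; ring

end half

end CC

namespace CC
section
variable {n : ℕ} [NeZero n]

theorem blocks_comp (Bs : List Blk) (hn : (Bs.flatMap bd).Nodup)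
    (h : ∀ d ∈ Bs.flatMap bd, 0 < d ∧ 2 * d < n) :
    ∃ S : Set (Wd n), IsComp S (ΔL (Bs.flatMap bd)) (2 * n * Bs.length) := by
  induction Bs with
  | nil =>
    refine ⟨∅, ?_⟩
    have : ΔL (n := n) (List.flatMap bd []) = ∅ := by
      ext z; simp [ΔL]
    rw [this]
    exact comp_empty
  | cons B Bs ih =>
    rw [List.flatMap_cons] at hn h ⊢
    obtain ⟨h1, h2, h3⟩ := List.nodup_append'.1 hn
    obtain ⟨S, hS⟩ := ih h2 (fun d hd => h d (List.mem_append_right _ hd))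
    obtain ⟨T, hT⟩ := pure_comp (n := n) B h1 (fun d hd => h d (List.mem_append_left _ hd))
    refine ⟨T ∪ S, ?_⟩
    have := comp_union hT hS (ΔL_disj (fun d hd => ?_) (fun d hd => ?_) h3)
    · rw [ΔL_append]
      convert this using 1
      rw [List.length_cons]; ring
    · have := h d (List.mem_append_left _ hd); omega
    · have := h d (List.mem_append_right _ hd); omega

def Res (n : ℕ) [NeZero n] : Prop := ∃ (S : Set (Wd n)) (Δ : Set (ZMod n)), IsComp S Δ (codeBound n)

theorem Res.of {S : Set (Wd n)} {Δ : Set (ZMod n)} {m : ℕ} (h : IsComp S Δ m)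
    (hm : codeBound n = m) : Res n := ⟨S, Δ, hm ▸ h⟩

theorem final (h : Res n)
    (hn : n % 12 = 1 ∨ n % 12 = 2 ∨ n % 12 = 3 ∨ n % 12 = 6 ∨ n % 24 = 0) :
    ∃ 𝓒 : Set (ZMod n → Fin 3), IsCyclicCode643 n 𝓒 ∧ 𝓒.ncard = codeBound n ∧
      ∀ 𝓓 : Set (ZMod n → Fin 3), IsCyclicCode643 n 𝓓 → 𝓓.ncard ≤ 𝓒.ncard := by
  obtain ⟨S, Δ, hS⟩ := h
  refine ⟨S, ⟨hS.w, ?_, fun u hu => hS.s u hu 1⟩, hS.c, ?_⟩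
  · intro u hu v hv huv
    exact good_dist u v (hS.w u hu) (hS.w v hv) (hS.g u hu v hv huv)
  · intro D hD
    rw [hS.c]
    have hfin : D.Finite := Set.toFinite D
    rw [Set.ncard_eq_toFinset_card D hfin]
    have hsh : ∀ u ∈ D, ∀ k : ℕ, sh (k : ZMod n) u ∈ D := by
      intro u hu k
      induction k with
      | zero => simpa [sh_zero] using hu
      | succ k ih =>
        have := hD.2.2 _ ih
        have e : (fun i => sh (k : ZMod n) u (i + 1)) = sh ((k + 1 : ℕ) : ZMod n) u := by
          funext i
          simp only [sh]
          congr 1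
          push_cast
          ring
        rw [e] at this
        exact this
    apply upper _ hn
    refine ⟨?_, ?_, ?_⟩
    · intro u hu
      exact hD.1 u (by simpa using hu)
    · intro u hu v hv
      exact hD.2.1 u (by simpa using hu) v (by simpa using hv)
    · intro u hu t
      have := hsh u (by simpa using hu) t.val
      rw [ZMod.natCast_zmod_val] at this
      simpa using this

end

def Sys (D : ℤ) (ex : List ℤ) (k : ℕ) : Prop :=
  ∃ Bs : List Blk, Bs.length = k ∧ (ex ++ Bs.flatMap bd).Nodup ∧
    ∀ d ∈ ex ++ Bs.flatMap bd, 0 < d ∧ d ≤ D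

theorem resI {k : ℕ} (h : Sys (6 * k) [] k) (n : ℕ) [NeZero n]
    (hn : n = 12 * k + 1 ∨ n = 12 * k + 2 ∨ n = 12 * k + 3) : Res n := by
  obtain ⟨Bs, h1, h2, h3⟩ := h
  obtain ⟨S, hS⟩ := blocks_comp (n := n) Bs h2 (fun d hd => by
    have := h3 d hd
    omega)
  refine Res.of hS ?_
  rw [h1]
  unfold codeBound
  rw [if_pos (by rw [Nat.odd_iff]; omega)]
  have : (n - 1) / 6 = 2 * k := by omega
  rw [this]; ring

theorem resII {k : ℕ} (b : ℤ) (h : Sys (6 * k + 2) [b, 6 * k + 3 - b] k) (n : ℕ) [NeZero n]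
    (hn : n = 12 * k + 6) : Res n := by
  obtain ⟨Bs, h1, h2, h3⟩ := h
  have hb := h3 b (by simp)
  have hb' := h3 (6 * k + 3 - b) (by simp)
  obtain ⟨h4, h5, h6⟩ := List.nodup_append'.1 h2
  obtain ⟨S, hS⟩ := blocks_comp (n := n) Bs h5 (fun d hd => by
    have := h3 d (List.mem_append_right _ hd)
    omega)
  obtain ⟨c, rfl⟩ := Int.eq_ofNat_of_zero_le hb.1.le
  have hH := half_comp (n := n) (b := c) (h := 6 * k + 3) (by omega) (by omega) (by omega) (by omega)
  have := comp_union hS hH (ΔL_disj (fun d hd => by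
    have := h3 d (List.mem_append_right _ hd)
    omega) (fun d hd => by
      simp only [List.mem_cons, List.not_mem_nil, or_false] at hd
      push_cast at hd
      omega) (by
      intro d hd hd'
      simp only [List.mem_cons, List.not_mem_nil, or_false] at hd'
      push_cast at hd'
      rcases hd' with hd' | hd' | hd'
      · exact h6 (by simp [hd']) hd
      · exact h6 (by simp [hd']) hd
      · have := h3 d (List.mem_append_right _ hd)
        omega))
  refine Res.of this ?_
  rw [h1]
  unfold codeBound
  rw [if_neg (by rw [Nat.odd_iff]; omega)]
  have : (n - 1) / 6 = 2 * k := by omega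
  rw [this]
  have : n / 2 = 6 * k + 3 := by omega
  rw [this]
  ring

theorem resIII {k : ℕ} (x y z b : ℤ) (h : Sys (6 * k + 11) (tri x y z ++ [b, 6 * k + 12 - b]) k)
    (n : ℕ) [NeZero n] (hn : n = 12 * k + 24) : Res n := by
  obtain ⟨Bs, h1, h2, h3⟩ := h
  have hb := h3 b (by simp)
  have hb' := h3 (6 * k + 12 - b) (by simp)
  obtain ⟨h4, h5, h6⟩ := List.nodup_append'.1 h2
  obtain ⟨h7, h8, h9⟩ := List.nodup_append'.1 h4
  obtain ⟨S, hS⟩ := blocks_comp (n := n) Bs h5 (fun d hd => by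
    have := h3 d (List.mem_append_right _ hd)
    omega)
  obtain ⟨T, hT⟩ := tri_comp (n := n) x y z h7 (fun d hd => by
    have := h3 d (List.mem_append_left _ (List.mem_append_left _ hd))
    omega)
  obtain ⟨c, rfl⟩ := Int.eq_ofNat_of_zero_le hb.1.le
  have hc : (c : ℤ) ≠ 6 * k + 12 - c := by
    intro h
    simp [← h] at h8
  have hH := half_comp (n := n) (b := c) (h := 6 * k + 12) (by omega) (by omega) (by omega) (by omega)
  have hST := comp_union hT hS (ΔL_disj (fun d hd => by
    have := h3 d (List.mem_append_left _ (List.mem_append_left _ hd))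
    omega) (fun d hd => by
    have := h3 d (List.mem_append_right _ hd)
    omega) (fun d hd hd' => h6 (List.mem_append_left _ hd) hd'))
  rw [← ΔL_append] at hST
  have hr : ∀ d ∈ tri x y z ++ Bs.flatMap bd, 0 < d ∧ d ≤ 6 * k + 11 := by
    intro d hd
    rcases List.mem_append.1 hd with hd | hd
    · exact h3 d (List.mem_append_left _ (List.mem_append_left _ hd))
    · exact h3 d (List.mem_append_right _ hd)
  have := comp_union hST hH (ΔL_disj (fun d hd => by
    have := hr d hd
    omega) (fun d hd => by
      simp only [List.mem_cons, List.not_mem_nil, or_false] at hd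
      push_cast at hd
      omega) (by
      intro d hd hd'
      simp only [List.mem_cons, List.not_mem_nil, or_false] at hd'
      push_cast at hd'
      rcases hd' with hd' | hd' | hd'
      · rcases List.mem_append.1 hd with hd | hd
        · exact h9 hd (by simp [hd'])
        · exact h6 (by simp [hd']) hd
      · rcases List.mem_append.1 hd with hd | hd
        · exact h9 hd (by simp [hd'])
        · exact h6 (by simp [hd']) hd
      · have := hr d hd
        omega))
  refine Res.of this ?_
  rw [h1]
  unfold codeBound
  rw [if_neg (by rw [Nat.odd_iff]; omega)]
  have : (n - 1) / 6 = 2 * k + 3 := by omega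
  rw [this]
  have : n / 2 = 6 * k + 12 := by omega
  rw [this]
  ring

end CC

namespace CC

abbrev Pc := ℤ × ℤ × ℤ
/-- value of an affine piece -/
def ev (M : ℕ) (x : Pc) (i : ℕ) : ℤ := x.1 * M + x.2.1 + x.2.2 * i
def psub (x y : Pc) : Pc := (x.1 - y.1, x.2.1 - y.2.1, x.2.2 - y.2.2)
abbrev Fam := (Pc × Pc × Pc) × ℕ × ℕ
abbrev LP := Pc × ℕ × ℕ

def pcs (f : Fam) : List Pc :=
  [f.1.1, f.1.2.1, f.1.2.2, psub f.1.2.1 f.1.1, psub f.1.2.2 f.1.1, psub f.1.2.2 f.1.2.1]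
def lps (f : Fam) : List LP := (pcs f).map fun x => (x, f.2)
def len (M : ℕ) (l : ℕ × ℕ) : ℕ := l.1 * M + l.2
def vals (M : ℕ) (x : LP) : List ℤ := (List.range (len M x.2)).map (ev M x.1)
def blks (M : ℕ) (f : Fam) : List Blk :=
  (List.range (len M f.2)).map fun i => (ev M f.1.1 i, ev M f.1.2.1 i, ev M f.1.2.2 i)

def plo (x : LP) : ℤ × ℤ :=
  if 0 ≤ x.1.2.2 then (x.1.1, x.1.2.1)
  else (x.1.1 + x.1.2.2 * x.2.1, x.1.2.1 + x.1.2.2 * (x.2.2 - 1))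
def phi (x : LP) : ℤ × ℤ :=
  if 0 ≤ x.1.2.2 then (x.1.1 + x.1.2.2 * x.2.1, x.1.2.1 + x.1.2.2 * (x.2.2 - 1))
  else (x.1.1, x.1.2.1)
def alt (x y : ℤ × ℤ) : Bool := decide (x.1 ≤ y.1) && decide (x.2 < y.2)
def msep (g : ℤ) (x y : Pc) : Bool :=
  decide (x.2.2 % g = 0) && decide (y.2.2 % g = 0) && decide ((x.1 - y.1) % g = 0) &&
    decide ((x.2.1 - y.2.1) % g ≠ 0)
def sep (x y : LP) : Bool :=
  alt (phi x) (plo y) || alt (phi y) (plo x) || msep 2 x.1 y.1 || msep 3 x.1 y.1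
def self (D : ℤ × ℤ) (x : LP) : Bool :=
  (decide (x.1.2.2 ≠ 0) || (x.2.1 == 0 && decide (x.2.2 ≤ 1))) && alt (0, 0) (plo x) && alt (phi x) D
def pw (D : ℤ × ℤ) : List LP → Bool
  | [] => true
  | x :: l => self D x && l.all (sep x) && pw D l

theorem ev_bd (M : ℕ) (x : LP) (i : ℕ) (hi : i < len M x.2) :
    (plo x).1 * M + (plo x).2 ≤ ev M x.1 i ∧ ev M x.1 i ≤ (phi x).1 * M + (phi x).2 := by
  obtain ⟨⟨p, q, s⟩, k, c⟩ := x
  simp only [len] at hi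
  have hi' : (0 : ℤ) ≤ k * M + c - 1 - i := by
    have : (i : ℤ) < ((k * M + c : ℕ) : ℤ) := by exact_mod_cast hi
    push_cast at this
    omega
  have h0 : (0 : ℤ) ≤ i := by positivity
  unfold plo phi ev
  simp only
  split
  · next hs =>
    simp only
    constructor
    · nlinarith [mul_nonneg hs h0]
    · nlinarith [mul_nonneg hs hi']
  · next hs =>
    simp only
    have hs' : (0 : ℤ) ≤ -s := by omega
    constructor
    · nlinarith [mul_nonneg hs' hi']
    · nlinarith [mul_nonneg hs' h0]

theorem alt_lt {x y : ℤ × ℤ} (h : alt x y = true) (M : ℕ) : x.1 * M + x.2 < y.1 * M + y.2 := by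
  simp only [alt, Bool.and_eq_true, decide_eq_true_eq] at h
  have : x.1 * M ≤ y.1 * M := mul_le_mul_of_nonneg_right h.1 (by positivity)
  omega

theorem msep_ne {g : ℤ} {x y : Pc} (h : msep g x y = true) (M i j : ℕ) : ev M x i ≠ ev M y j := by
  simp only [msep, Bool.and_eq_true, decide_eq_true_eq] at h
  obtain ⟨⟨⟨h1, h2⟩, h3⟩, h4⟩ := h
  intro e
  apply h4
  apply Int.emod_eq_zero_of_dvd
  have e' : x.2.1 - y.2.1 = y.2.2 * j - x.2.2 * i - (x.1 - y.1) * M := by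
    unfold ev at e
    linear_combination e
  rw [e']
  exact dvd_sub (dvd_sub ((Int.dvd_of_emod_eq_zero h2).mul_right _)
    ((Int.dvd_of_emod_eq_zero h1).mul_right _)) ((Int.dvd_of_emod_eq_zero h3).mul_right _)

theorem sep_disj {x y : LP} (h : sep x y = true) (M : ℕ) : (vals M x).Disjoint (vals M y) := by
  intro d hx hy
  simp only [vals, List.mem_map, List.mem_range] at hx hy
  obtain ⟨i, hi, rfl⟩ := hx
  obtain ⟨j, hj, e⟩ := hy
  have b1 := ev_bd M x i hi
  have b2 := ev_bd M y j hj
  simp only [sep, Bool.or_eq_true] at h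
  rcases h with ((h | h) | h) | h
  · have := alt_lt h M; omega
  · have := alt_lt h M; omega
  · exact msep_ne h M i j e.symm
  · exact msep_ne h M i j e.symm

theorem self_sound {D : ℤ × ℤ} {x : LP} (h : self D x = true) (M : ℕ) :
    (vals M x).Nodup ∧ ∀ d ∈ vals M x, 0 < d ∧ d < D.1 * M + D.2 := by
  simp only [self, Bool.and_eq_true, Bool.or_eq_true, decide_eq_true_eq, beq_iff_eq] at h
  obtain ⟨⟨h1, h2⟩, h3⟩ := h
  constructor
  · unfold vals
    rw [List.nodup_map_iff_inj_on List.nodup_range]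
    intro i hi j hj e
    rw [List.mem_range] at hi hj
    rcases h1 with h1 | ⟨h1, h1'⟩
    · unfold ev at e
      have : x.1.2.2 * i = x.1.2.2 * j := by omega
      exact_mod_cast mul_left_cancel₀ h1 this
    · simp only [len, h1] at hi hj
      omega
  · intro d hd
    simp only [vals, List.mem_map, List.mem_range] at hd
    obtain ⟨i, hi, rfl⟩ := hd
    have b := ev_bd M x i hi
    have h4 := alt_lt h2 M
    have h5 := alt_lt h3 M
    simp only [zero_mul, zero_add] at h4
    omega

theorem pw_sound {D : ℤ × ℤ} {l : List LP} (h : pw D l = true) (M : ℕ) :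
    (l.flatMap (vals M)).Nodup ∧ ∀ d ∈ l.flatMap (vals M), 0 < d ∧ d < D.1 * M + D.2 := by
  induction l with
  | nil => simp
  | cons x l ih =>
    simp only [pw, Bool.and_eq_true, List.all_eq_true] at h
    obtain ⟨⟨h1, h2⟩, h3⟩ := h
    obtain ⟨i1, i2⟩ := ih h3
    obtain ⟨s1, s2⟩ := self_sound h1 M
    rw [List.flatMap_cons]
    constructor
    · rw [List.nodup_append']
      refine ⟨s1, i1, ?_⟩
      intro d hd hd'
      rw [List.mem_flatMap] at hd'
      obtain ⟨y, hy, hd'⟩ := hd'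
      exact sep_disj (h2 y hy) M hd hd'
    · intro d hd
      rcases List.mem_append.1 hd with hd | hd
      · exact s2 d hd
      · exact i2 d hd

theorem bd_blks (M : ℕ) (f : Fam) :
    ((blks M f).flatMap bd).Perm ((lps f).flatMap (vals M)) := by
  have e1 : (blks M f).flatMap bd =
      (List.range (len M f.2)).flatMap fun i => (pcs f).map fun x => ev M x i := by
    rw [blks, List.flatMap_map]
    congr 1
    funext i
    simp only [bd, pcs, List.map_cons, List.map_nil, List.cons.injEq, and_true, true_and]
    refine ⟨?_, ?_, ?_⟩ <;> (simp only [ev, psub]; ring)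
  have e2 : (lps f).flatMap (vals M) =
      (pcs f).flatMap fun x => (List.range (len M f.2)).map fun i => ev M x i := by
    rw [lps, List.flatMap_map]
    rfl
  rw [e1, e2, ← Multiset.coe_eq_coe, ← Multiset.coe_bind, ← Multiset.coe_bind]
  have := Multiset.bind_map_comm (List.range (len M f.2) : Multiset ℕ) (pcs f : Multiset Pc)
    (f := fun i x => ev M x i)
  simpa using this

def exl (e : ℤ × ℤ) : LP := ((e.1, e.2, 0), 0, 1)

def chk (D : ℤ × ℤ) (ex : List (ℤ × ℤ)) (fs : List Fam) (K : ℕ × ℕ) : Bool :=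
  pw D (ex.map exl ++ fs.flatMap lps) && (fs.map fun f => f.2.1).sum == K.1 &&
    (fs.map fun f => f.2.2).sum == K.2

theorem perm_fs (M : ℕ) (fs : List Fam) :
    ((fs.flatMap (blks M)).flatMap bd).Perm ((fs.flatMap lps).flatMap (vals M)) := by
  induction fs with
  | nil => simp
  | cons f fs ih =>
    simp only [List.flatMap_cons, List.flatMap_append]
    exact (bd_blks M f).append ih

theorem chk_sound {D : ℤ × ℤ} {ex : List (ℤ × ℤ)} {fs : List Fam} {K : ℕ × ℕ}
    (h : chk D ex fs K = true) (M : ℕ) :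
    Sys (D.1 * M + D.2 - 1) (ex.map fun e : ℤ × ℤ => e.1 * (M : ℤ) + e.2) (K.1 * M + K.2) := by
  simp only [chk, Bool.and_eq_true, beq_iff_eq] at h
  obtain ⟨⟨h1, h2⟩, h3⟩ := h
  obtain ⟨h4, h5⟩ := pw_sound h1 M
  have e1 : (ex.map exl).flatMap (vals M) = ex.map fun e : ℤ × ℤ => e.1 * (M : ℤ) + e.2 := by
    clear h1 h4 h5
    induction ex with
    | nil => rfl
    | cons e ex ih =>
      rw [List.map_cons, List.flatMap_cons, ih, List.map_cons]
      simp [vals, exl, len, ev]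
  have p : (ex.map (fun e => e.1 * (M : ℤ) + e.2) ++ (fs.flatMap (blks M)).flatMap bd).Perm
      ((ex.map exl ++ fs.flatMap lps).flatMap (vals M)) := by
    rw [List.flatMap_append, e1]
    exact (List.Perm.refl _).append (perm_fs M fs)
  refine ⟨fs.flatMap (blks M), ?_, p.nodup_iff.2 h4, ?_⟩
  · rw [← h2, ← h3]
    clear h1 h2 h3 h4 h5 p
    induction fs with
    | nil => simp
    | cons f fs ih =>
      simp only [List.flatMap_cons, List.length_append, ih, List.map_cons, List.sum_cons]
      simp only [blks, len, List.length_map, List.length_range]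
      ring
  · intro d hd
    have := h5 d (p.mem_iff.1 hd)
    omega

/-! concrete small systems -/
def nbd (B : ℕ × ℕ × ℕ) : List ℕ :=
  [B.1, B.2.1, B.2.2, B.2.1 - B.1, B.2.2 - B.1, B.2.2 - B.2.1]
def mck (D : ℕ) : ℕ → List ℕ → Bool
  | _, [] => true
  | m, d :: l => (d != 0) && Nat.ble d D && !(m.testBit d) && mck D (m ||| 2 ^ d) l
def bck (B : ℕ × ℕ × ℕ) : Bool := Nat.ble B.1 B.2.1 && Nat.ble B.2.1 B.2.2
def sck (D : ℕ) (ex : List ℕ) (Bs : List (ℕ × ℕ × ℕ)) : Bool :=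
  Bs.all bck && mck D 0 (ex ++ Bs.flatMap nbd)

theorem mck_sound (D m : ℕ) (l : List ℕ) (h : mck D m l = true) :
    l.Nodup ∧ (∀ d ∈ l, 0 < d ∧ d ≤ D) ∧ ∀ d ∈ l, m.testBit d = false := by
  induction l generalizing m with
  | nil => simp
  | cons d l ih =>
    simp only [mck, Bool.and_eq_true, Bool.not_eq_true', bne_iff_ne, Nat.ble_eq] at h
    obtain ⟨⟨⟨h1, h2⟩, h3⟩, h4⟩ := h
    obtain ⟨i1, i2, i3⟩ := ih _ h4
    refine ⟨?_, ?_, ?_⟩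
    · rw [List.nodup_cons]
      refine ⟨?_, i1⟩
      intro hd
      have := i3 d hd
      simp [Nat.testBit_or, Nat.testBit_two_pow_self] at this
    · intro e he
      rcases List.mem_cons.1 he with rfl | he
      · omega
      · exact i2 e he
    · intro e he
      rcases List.mem_cons.1 he with rfl | he
      · exact h3
      · have := i3 e he
        rw [Nat.testBit_or, Bool.or_eq_false_iff] at this
        exact this.1

theorem sck_sound {D : ℕ} {ex : List ℕ} {Bs : List (ℕ × ℕ × ℕ)} (h : sck D ex Bs = true) :
    Sys D (ex.map fun x : ℕ => (x : ℤ)) Bs.length := by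
  simp only [sck, Bool.and_eq_true, List.all_eq_true] at h
  obtain ⟨h1, h2⟩ := h
  obtain ⟨h3, h4, -⟩ := mck_sound _ _ _ h2
  have e : ex.map (fun x : ℕ => (x : ℤ)) ++
      (Bs.map fun B => ((B.1 : ℤ), (B.2.1 : ℤ), (B.2.2 : ℤ))).flatMap bd =
      (ex ++ Bs.flatMap nbd).map (fun x : ℕ => (x : ℤ)) := by
    rw [List.map_append, List.flatMap_map, List.map_flatMap]
    congr 1
    apply List.flatMap_congr
    intro B hB
    have := h1 B hB
    simp only [bck, Bool.and_eq_true, Nat.ble_eq] at this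
    simp only [bd, nbd, List.map_cons, List.map_nil]
    rw [Nat.cast_sub this.1, Nat.cast_sub this.2, Nat.cast_sub (this.1.trans this.2)]
  refine ⟨Bs.map fun B => ((B.1 : ℤ), (B.2.1 : ℤ), (B.2.2 : ℤ)), by simp, ?_, ?_⟩
  · rw [e]
    exact h3.map (fun a b h => by exact_mod_cast h)
  · rw [e]
    intro d hd
    rw [List.mem_map] at hd
    obtain ⟨x, hx, rfl⟩ := hd
    have := h4 x hx
    omega

end CC

namespace CC

/-- cyclic distance label -/
def lb (n : ℕ) (f : Fin 4 → ℕ) (a b : Fin 4) : ℕ := (f b + n - f a) % n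

theorem lb_cast {n : ℕ} [NeZero n] {f : Fin 4 → ℕ} (hf : ∀ a, f a < n) (a b : Fin 4) :
    ((lb n f a b : ℕ) : ZMod n) = (f b : ZMod n) - f a := by
  have := hf a
  rw [lb, ZMod.natCast_mod, Nat.cast_sub (by omega)]
  simp

theorem lb_eq {n : ℕ} [NeZero n] {f g : Fin 4 → ℕ} (hf : ∀ a, f a < n) (hg : ∀ a, g a < n)
    {a b a' b' : Fin 4} (h : (f b : ZMod n) - f a = (g b' : ZMod n) - g a') :
    lb n f a b = lb n g a' b' := by
  rw [← lb_cast hf, ← lb_cast hg, ZMod.natCast_eq_natCast_iff'] at h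
  simpa [lb] using h

theorem inj_cast {n : ℕ} [NeZero n] {f : Fin 4 → ℕ} (hf : ∀ a, f a < n)
    (hi : ∀ a b, f a = f b → a = b) : Function.Injective fun a => ((f a : ℕ) : ZMod n) := by
  intro a b h
  have := (ZMod.natCast_eq_natCast_iff' _ _ _).1 h
  rw [Nat.mod_eq_of_lt (hf a), Nat.mod_eq_of_lt (hf b)] at this
  exact hi a b this

def c2 (n : ℕ) (f g : Fin 4 → ℕ) (c d : Fin 4 → Fin 3) (e : Bool) : Bool :=
  decide (∀ a b a' b' : Fin 4, (a == b || a' == b' || lb n f a b != lb n g a' b' ||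
    (e && a == a') || (c a != d a' && decide (∀ x x' : Fin 4, (a == x || b == x || a' == x' || b' == x' ||
      lb n f a x != lb n g a' x') = true))) = true)

theorem c2_sound {n : ℕ} {f g : Fin 4 → ℕ} {c d : Fin 4 → Fin 3} {e : Bool}
    (h : c2 n f g c d e = true) (a b a' b' : Fin 4) (h1 : a ≠ b) (h2 : a' ≠ b')
    (h3 : lb n f a b = lb n g a' b') : (e = true ∧ a = a') ∨ (c a ≠ d a' ∧
      ∀ x x', a ≠ x → b ≠ x → a' ≠ x' → b' ≠ x' → lb n f a x ≠ lb n g a' x') := by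
  simp only [c2, decide_eq_true_eq, Bool.or_eq_true, Bool.and_eq_true, beq_iff_eq, bne_iff_ne] at h
  rcases h a b a' b' with (((h | h) | h) | h) | h
  · exact absurd h h1
  · exact absurd h h2
  · exact absurd h3 h
  · exact Or.inl h
  · right
    refine ⟨h.1, ?_⟩
    intro x x' i1 i2 i3 i4
    rcases h.2 x x' with (((j | j) | j) | j) | j
    · exact absurd j i1
    · exact absurd j i2
    · exact absurd j i3
    · exact absurd j i4
    · exact j

def okB (n : ℕ) (f : Fin 4 → ℕ) : Bool :=
  decide ((∀ a, f a < n) ∧ (∀ a b, f a = f b → a = b))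

def xck (n m : ℕ) (Q : Fin m → Fin 4 → ℕ) (c : Fin m → Fin 4 → Fin 3) : Bool :=
  decide (∀ w, okB n (Q w) = true) && decide (∀ w a, c w a ≠ 0) &&
    decide (∀ w w', c2 n (Q w) (Q w') (c w) (c w') (w == w') = true)

theorem xcomp {n m : ℕ} [NeZero n] {Q : Fin m → Fin 4 → ℕ} {c : Fin m → Fin 4 → Fin 3}
    (h : xck n m Q c = true) :
    IsComp (Set.range fun x : Fin m × ZMod n => sh x.2 (mk (fun a => (Q x.1 a : ZMod n)) (c x.1)))
      Set.univ (m * n) := by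
  simp only [xck, Bool.and_eq_true, decide_eq_true_eq] at h
  obtain ⟨⟨h1, h2⟩, h3⟩ := h
  simp only [okB, decide_eq_true_eq] at h1
  apply comp_list (fun w a => (Q w a : ZMod n)) c (fun w => lb n (Q w)) Set.univ
  · exact fun w => inj_cast (h1 w).1 (h1 w).2
  · exact h2
  · intro w w' a b a' b' _ _ e
    exact lb_eq (h1 w).1 (h1 w').1 e
  · intro w w' a b a' b' i1 i2 i3
    rcases c2_sound (h3 w w') a b a' b' i1 i2 i3 with i | i
    · exact Or.inl ⟨by simpa using i.1, i.2⟩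
    · exact Or.inr i.1
  · intro w w' a b a' b' i1 i2 i3 d d' j1 j2 j3 j4 j5
    rcases c2_sound (h3 w w') a b a' b' i1 i2 i3 with i | i
    · exact ⟨by simpa using i.1, i.2⟩
    · exact absurd j5 (i.2 d d' j1 j2 j3 j4)
  · intros; trivial

theorem xres {n m : ℕ} [NeZero n] {Q : Fin m → Fin 4 → ℕ} {c : Fin m → Fin 4 → Fin 3}
    (h : xck n m Q c = true) (hm : codeBound n = m * n) : Res n := Res.of (xcomp h) hm

def hQ (b h : ℕ) : Fin 4 → ℕ := ![0, h, b, b + h]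

def yck (n m b h : ℕ) (Q : Fin m → Fin 4 → ℕ) (c : Fin m → Fin 4 → Fin 3) : Bool :=
  xck n m Q c && okB n (hQ b h) && decide (∀ w, c2 n (hQ b h) (Q w) hc (c w) false = true)

theorem yres {n m : ℕ} [NeZero n] (b h : ℕ) (hn : n = 2 * h) (hb : 0 < b) (hbh : b < h)
    (h2b : 2 * b ≠ h) {Q : Fin m → Fin 4 → ℕ} {c : Fin m → Fin 4 → Fin 3}
    (hy : yck n m b h Q c = true) (hm : codeBound n = h + m * n) : Res n := by
  simp only [yck, Bool.and_eq_true, decide_eq_true_eq] at hy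
  obtain ⟨⟨h1, h2⟩, h3⟩ := hy
  refine Res.of (comp_union' (half_comp hn hb hbh h2b) (xcomp h1) ?_) hm
  simp only [xck, Bool.and_eq_true, decide_eq_true_eq, okB] at h1 h2
  obtain ⟨⟨h4, -⟩, -⟩ := h1
  have e : (hP b h : Fin 4 → ZMod n) = fun a => ((hQ b h a : ℕ) : ZMod n) := by
    funext a
    fin_cases a <;> simp [hP, hQ]
  rw [e]
  rintro _ ⟨t, rfl⟩ _ ⟨⟨w, t'⟩, rfl⟩
  apply sh_mk_common (inj_cast h2.1 h2.2) (inj_cast (h4 w).1 (h4 w).2)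
  · intro a b a' b' i1 i2 i3 _
    rcases c2_sound (h3 w) a b a' b' i1 i2 (lb_eq h2.1 (h4 w).1 i3) with i | i
    · exact absurd i.1 (by simp)
    · exact i.1
  · intro a b d a' b' d' i1 i2 i3 j1 j2 j3 k1 k2
    rcases c2_sound (h3 w) a b a' b' i1 j1 (lb_eq h2.1 (h4 w).1 k1) with i | i
    · exact absurd i.1 (by simp)
    · exact absurd (lb_eq h2.1 (h4 w).1 k2) (i.2 d d' i2 i3 j2 j3)

theorem e25 : Res 25 :=
  xres (m := 4)
    (Q := ![![0, 1, 11, 15], ![0, 1, 3, 9], ![0, 5, 12, 17], ![0, 2, 6, 9]])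
    (c := ![![1, 1, 2, 2], ![2, 2, 2, 2], ![1, 2, 2, 1], ![1, 1, 1, 1]])
    (by decide +kernel) (by decide +kernel)

theorem e26 : Res 26 :=
  xres (m := 4)
    (Q := ![![0, 4, 6, 14], ![0, 3, 4, 11], ![0, 3, 5, 12], ![0, 5, 6, 15]])
    (c := ![![2, 1, 2, 1], ![1, 1, 2, 2], ![2, 2, 1, 1], ![1, 2, 1, 2]])
    (by decide +kernel) (by decide +kernel)

theorem e27 : Res 27 :=
  xres (m := 4)
    (Q := ![![0, 3, 11, 12], ![0, 4, 5, 11], ![0, 7, 9, 13], ![0, 5, 13, 15]])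
    (c := ![![2, 2, 1, 1], ![1, 2, 2, 2], ![1, 1, 2, 1], ![2, 1, 2, 1]])
    (by decide +kernel) (by decide +kernel)

theorem e37 : Res 37 :=
  xres (m := 6)
    (Q := ![![0, 2, 10, 22], ![0, 8, 13, 23], ![0, 9, 16, 20], ![0, 12, 21, 23], ![0, 1, 4, 7], ![0, 13, 18, 19]])
    (c := ![![2, 1, 2, 2], ![2, 1, 1, 1], ![2, 2, 2, 1], ![1, 1, 1, 2], ![1, 1, 2, 1], ![1, 2, 2, 2]])
    (by decide +kernel) (by decide +kernel)

theorem e38 : Res 38 :=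
  xres (m := 6)
    (Q := ![![0, 3, 5, 15], ![0, 1, 7, 16], ![0, 2, 14, 18], ![0, 13, 18, 24], ![0, 7, 10, 11], ![0, 8, 17, 25]])
    (c := ![![2, 1, 1, 1], ![1, 1, 2, 2], ![2, 2, 2, 1], ![1, 1, 2, 1], ![2, 1, 2, 2], ![2, 1, 1, 2]])
    (by decide +kernel) (by decide +kernel)

theorem e39 : Res 39 :=
  xres (m := 6)
    (Q := ![![0, 2, 10, 17], ![0, 1, 10, 14], ![0, 8, 14, 23], ![0, 17, 20, 21], ![0, 3, 5, 16], ![0, 7, 12, 18]])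
    (c := ![![2, 1, 1, 2], ![1, 2, 2, 2], ![2, 2, 1, 1], ![1, 1, 2, 1], ![2, 1, 2, 1], ![2, 1, 1, 2]])
    (by decide +kernel) (by decide +kernel)

theorem e18 : Res 18 :=
  yres (m := 2) 1 9 (by norm_num) (by norm_num) (by norm_num) (by norm_num)
    (Q := ![![0, 5, 8, 12], ![0, 4, 6, 7]])
    (c := ![![1, 2, 2, 2], ![1, 1, 2, 1]])
    (by decide +kernel) (by decide +kernel)

theorem e24 : Res 24 :=
  yres (m := 3) 1 12 (by norm_num) (by norm_num) (by norm_num) (by norm_num)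
    (Q := ![![0, 6, 14, 15], ![0, 7, 13, 17], ![0, 3, 5, 8]])
    (c := ![![2, 2, 2, 1], ![2, 1, 1, 1], ![1, 2, 2, 1]])
    (by decide +kernel) (by decide +kernel)

theorem e48 : Res 48 :=
  yres (m := 7) 1 24 (by norm_num) (by norm_num) (by norm_num) (by norm_num)
    (Q := ![![0, 9, 19, 27], ![0, 8, 21, 28], ![0, 6, 9, 13], ![0, 14, 26, 30], ![0, 10, 12, 15], ![0, 15, 29, 31], ![0, 11, 17, 22]])
    (c := ![![2, 2, 1, 1], ![2, 2, 1, 1], ![1, 2, 1, 2], ![2, 2, 2, 1], ![1, 2, 1, 2], ![2, 1, 1, 2], ![1, 2, 1, 1]])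
    (by decide +kernel) (by decide +kernel)

end CC

namespace CC

abbrev NB := ℕ × ℕ × ℕ

theorem smI (k : ℕ) (Bs : List NB) (h : sck (6 * k) [] Bs = true) (hl : Bs.length = k) :
    Sys (6 * k) [] k := by
  have := sck_sound h
  rw [hl] at this
  simpa using this

theorem smII (k b : ℕ) (Bs : List NB) (hb : b ≤ 6 * k + 3)
    (h : sck (6 * k + 2) [b, 6 * k + 3 - b] Bs = true)
    (hl : Bs.length = k) : ∃ b : ℤ, Sys (6 * k + 2) [b, 6 * k + 3 - b] k := by
  have := sck_sound h
  rw [hl] at this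
  refine ⟨b, ?_⟩
  simp only [List.map_cons, List.map_nil, Nat.cast_sub hb] at this
  push_cast at this
  exact this

def trn (x y z : ℕ) : List ℕ :=
  [x, y, y - x, x + y, z, x + y + z, x + y + 2 * z, x + z, y + z]

theorem smIII (k b x y z : ℕ) (Bs : List NB) (hb : b ≤ 6 * k + 12) (hxy : x ≤ y)
    (h : sck (6 * k + 11) (trn x y z ++ [b, 6 * k + 12 - b]) Bs = true)
    (hl : Bs.length = k) :
    ∃ x y z b : ℤ, Sys (6 * k + 11) (tri x y z ++ [b, 6 * k + 12 - b]) k := by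
  have := sck_sound h
  rw [hl] at this
  refine ⟨x, y, z, b, ?_⟩
  simp only [trn, List.map_cons, List.map_nil, List.map_append, Nat.cast_sub hb, Nat.cast_sub hxy] at this
  push_cast at this
  exact this

theorem fmI (r L0 : ℕ) (fs : List Fam)
    (h : chk (36, 36 * L0 + 6 * r + 1) [] fs (6, 6 * L0 + r) = true) (k : ℕ) (hr : k % 6 = r)
    (hk : 6 * L0 ≤ k) : Sys (6 * k) [] k := by
  have := chk_sound h (k / 6 - L0)
  have e : k = 6 * (k / 6 - L0) + (6 * L0 + r) := by omega
  convert this using 1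
  · push_cast; omega
  · rfl

theorem fmII (r L0 : ℕ) (b : ℤ × ℤ) (fs : List Fam)
    (h : chk (36, 36 * L0 + 6 * r + 3) [b, (36 - b.1, 36 * L0 + 6 * r + 3 - b.2)] fs
      (6, 6 * L0 + r) = true) (k : ℕ) (hr : k % 6 = r)
    (hk : 6 * L0 ≤ k) : ∃ b : ℤ, Sys (6 * k + 2) [b, 6 * k + 3 - b] k := by
  have := chk_sound h (k / 6 - L0)
  have e : k = 6 * (k / 6 - L0) + (6 * L0 + r) := by omega
  have e' : (k : ℤ) = 6 * ((k / 6 - L0 : ℕ) : ℤ) + (6 * L0 + r) := by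
    conv_lhs => rw [e]
    push_cast; rfl
  refine ⟨b.1 * ((k / 6 - L0 : ℕ) : ℤ) + b.2, ?_⟩
  convert this using 1
  · rw [e']; ring
  · simp only [List.map_cons, List.map_nil]
    rw [e']; ring_nf

def tr2 (x y z : ℤ × ℤ) : List (ℤ × ℤ) :=
  [x, y, y - x, x + y, z, x + y + z, x + y + z + z, x + z, y + z]

theorem fmIII (r L0 : ℕ) (b x y z : ℤ × ℤ) (fs : List Fam)
    (h : chk (36, 36 * L0 + 6 * r + 12) (tr2 x y z ++ [b, (36 - b.1, 36 * L0 + 6 * r + 12 - b.2)]) fs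
      (6, 6 * L0 + r) = true) (k : ℕ) (hr : k % 6 = r)
    (hk : 6 * L0 ≤ k) : ∃ x y z b : ℤ, Sys (6 * k + 11) (tri x y z ++ [b, 6 * k + 12 - b]) k := by
  have := chk_sound h (k / 6 - L0)
  have e : k = 6 * (k / 6 - L0) + (6 * L0 + r) := by omega
  have e' : (k : ℤ) = 6 * ((k / 6 - L0 : ℕ) : ℤ) + (6 * L0 + r) := by
    conv_lhs => rw [e]
    push_cast; rfl
  refine ⟨x.1 * ((k / 6 - L0 : ℕ) : ℤ) + x.2, y.1 * ((k / 6 - L0 : ℕ) : ℤ) + y.2,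
    z.1 * ((k / 6 - L0 : ℕ) : ℤ) + z.2, b.1 * ((k / 6 - L0 : ℕ) : ℤ) + b.2, ?_⟩
  convert this using 1
  · rw [e']; ring
  · simp only [tr2, tri, List.map_cons, List.map_nil, List.map_append, Prod.fst_add, Prod.snd_add,
      Prod.fst_sub, Prod.snd_sub]
    rw [e']
    ring_nf

end CC

namespace CC

def dI0 : List Fam := [
    (((10,42,1),(13,47,-2),(35,136,-1)),1,1), (((5,21,1),(26,106,2),(36,142,-1)),1,2),
    (((0,4,3),(26,105,2),(31,124,1)),1,2), (((7,34,3),(11,48,2),(28,112,1)),1,0),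
    (((13,55,1),(16,61,-2),(34,134,-1)),1,1), (((7,32,3),(14,58,2),(32,129,1)),1,2),
    (((4,15,0),(11,46,0),(21,80,0)),0,1), (((3,10,0),(17,69,0),(36,143,0)),0,1),
    (((10,41,0),(13,49,0),(35,137,0)),0,1), (((3,9,0),(13,48,0),(29,112,0)),0,1),
    (((0,1,0),(19,78,0),(32,128,0)),0,1), (((0,3,0),(23,93,0),(29,117,0)),0,1),
    (((11,44,0),(21,81,0),(34,135,0)),0,1), (((0,2,0),(13,53,0),(29,115,0)),0,1),
    (((7,30,0),(14,57,0),(33,132,0)),0,1), (((3,14,0),(31,123,0),(35,140,0)),0,1),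
    (((3,13,0),(19,76,0),(36,144,0)),0,1), (((3,12,0),(21,84,0),(26,104,0)),0,1),
    (((7,28,0),(17,66,0),(28,111,0)),0,1), (((3,11,0),(17,67,0),(28,110,0)),0,1),
    (((4,16,0),(25,98,0),(35,138,0)),0,1), (((6,23,0),(13,52,0),(35,139,0)),0,1)]

theorem tI0 (k : ℕ) (hr : k % 6 = 0) (hk : 24 ≤ k) :
    Sys (6 * k) [] k :=
  fmI 0 4  dI0 (by decide +kernel) k hr hk

def dI1 : List Fam := [
    (((0,4,3),(9,40,2),(32,134,1)),1,2), (((0,5,3),(25,105,1),(30,127,2)),1,2),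
    (((3,15,1),(21,83,-2),(28,114,-1)),1,1), (((9,39,2),(14,59,1),(27,112,-1)),1,2),
    (((6,27,1),(19,75,-1),(34,144,2)),1,0), (((0,3,3),(21,87,1),(34,143,2)),1,2),
    (((0,2,0),(25,103,0),(36,146,0)),0,1), (((4,18,0),(15,67,0),(33,136,0)),0,1),
    (((6,26,0),(19,76,0),(34,141,0)),0,1), (((3,9,0),(18,75,0),(36,147,0)),0,1),
    (((3,10,0),(18,71,0),(29,119,0)),0,1), (((7,27,0),(7,28,0),(29,117,0)),0,1),
    (((3,11,0),(21,85,0),(32,131,0)),0,1), (((6,24,0),(15,62,0),(36,148,0)),0,1),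
    (((6,25,0),(19,77,0),(32,132,0)),0,1), (((3,14,0),(28,116,0),(33,137,0)),0,1),
    (((11,45,0),(14,58,0),(36,149,0)),0,1), (((4,17,0),(13,54,0),(36,150,0)),0,1),
    (((3,12,0),(22,92,0),(30,125,0)),0,1), (((7,30,0),(15,64,0),(26,108,0)),0,1),
    (((4,16,0),(23,97,0),(30,126,0)),0,1), (((11,47,0),(19,79,0),(34,142,0)),0,1)]

theorem tI1 (k : ℕ) (hr : k % 6 = 1) (hk : 24 ≤ k) :
    Sys (6 * k) [] k :=
  fmI 1 4  dI1 (by decide +kernel) k hr hk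

def dI2 : List Fam := [
    (((0,3,3),(9,32,2),(32,109,1)),1,1), (((0,5,3),(25,87,1),(30,105,2)),1,1),
    (((3,11,1),(21,66,-2),(28,92,-1)),1,0), (((9,33,2),(14,49,1),(27,92,-1)),1,1),
    (((6,20,1),(19,64,-1),(34,115,2)),1,2), (((0,4,3),(21,73,1),(34,118,2)),1,1),
    (((5,17,0),(9,30,0),(30,101,0)),0,1), (((7,24,0),(21,72,0),(30,103,0)),0,1),
    (((8,26,0),(11,35,0),(36,120,0)),0,1), (((3,6,0),(18,62,0),(36,119,0)),0,1),
    (((4,11,0),(23,78,0),(29,97,0)),0,1), (((4,15,0),(15,55,0),(26,89,0)),0,1),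
    (((4,12,0),(15,53,0),(33,111,0)),0,1), (((3,7,0),(26,88,0),(29,98,0)),0,1),
    (((3,8,0),(25,83,0),(33,110,0)),0,1), (((11,36,0),(15,50,0),(34,116,0)),0,1),
    (((8,28,0),(19,65,0),(30,104,0)),0,1), (((7,23,0),(7,25,0),(28,93,0)),0,1),
    (((7,22,0),(18,60,0),(33,112,0)),0,1), (((0,1,0),(14,47,0),(32,108,0)),0,1)]

theorem tI2 (k : ℕ) (hr : k % 6 = 2) (hk : 18 ≤ k) :
    Sys (6 * k) [] k :=
  fmI 2 3  dI2 (by decide +kernel) k hr hk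

def dI3 : List Fam := [
    (((10,27,1),(13,30,-2),(35,88,-1)),1,0), (((5,15,1),(26,70,2),(36,90,-1)),1,0),
    (((0,4,3),(26,69,2),(31,82,1)),1,0), (((7,24,3),(11,33,2),(28,73,1)),1,0),
    (((13,34,1),(16,36,-2),(34,86,-1)),1,0), (((7,25,3),(14,41,2),(32,85,1)),1,0),
    (((6,15,0),(16,38,0),(23,59,0)),0,1), (((7,22,0),(10,26,0),(29,78,0)),0,1),
    (((5,14,0),(21,54,0),(34,87,0)),0,1), (((6,16,0),(23,58,0),(34,88,0)),0,1),
    (((0,2,0),(18,49,0),(31,81,0)),0,1), (((3,9,0),(17,43,0),(31,80,0)),0,1),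
    (((3,8,0),(14,39,0),(35,90,0)),0,1), (((0,3,0),(18,48,0),(25,65,0)),0,1),
    (((7,19,0),(18,46,0),(29,74,0)),0,1), (((10,24,0),(14,36,0),(31,77,0)),0,1),
    (((7,18,0),(11,29,0),(33,86,0)),0,1), (((4,10,0),(14,35,0),(33,85,0)),0,1),
    (((3,7,0),(28,70,0),(32,83,0)),0,1), (((3,5,0),(28,69,0),(35,89,0)),0,1),
    (((0,1,0),(23,61,0),(26,67,0)),0,1)]

theorem tI3 (k : ℕ) (hr : k % 6 = 3) (hk : 12 ≤ k) :
    Sys (6 * k) [] k :=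
  fmI 3 2  dI3 (by decide +kernel) k hr hk

def dI4 : List Fam := [
    (((0,2,3),(9,26,2),(32,90,1)),1,1), (((0,3,3),(25,70,1),(30,85,2)),1,1),
    (((3,10,1),(21,54,-2),(28,76,-1)),1,0), (((9,29,2),(14,41,1),(27,75,-1)),1,0),
    (((6,18,1),(19,51,-1),(34,96,2)),1,0), (((0,4,3),(21,59,1),(34,97,2)),1,0),
    (((3,4,0),(18,45,0),(29,78,0)),0,1), (((3,5,0),(18,47,0),(36,96,0)),0,1),
    (((4,12,0),(15,46,0),(26,75,0)),0,1), (((3,6,0),(22,61,0),(33,92,0)),0,1),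
    (((0,1,0),(21,57,0),(30,84,0)),0,1), (((4,11,0),(7,20,0),(29,79,0)),0,1),
    (((8,23,0),(23,66,0),(34,94,0)),0,1), (((4,10,0),(19,54,0),(26,72,0)),0,1),
    (((6,17,0),(19,53,0),(33,93,0)),0,1), (((3,8,0),(21,58,0),(28,77,0)),0,1),
    (((3,7,0),(14,39,0),(32,87,0)),0,1), (((8,22,0),(13,35,0),(22,60,0)),0,1),
    (((6,16,0),(13,37,0),(32,89,0)),0,1), (((5,14,0),(23,65,0),(34,95,0)),0,1)]

theorem tI4 (k : ℕ) (hr : k % 6 = 4) (hk : 12 ≤ k) :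
    Sys (6 * k) [] k :=
  fmI 4 2  dI4 (by decide +kernel) k hr hk

def dI5 : List Fam := [
    (((0,5,3),(21,61,2),(26,75,1)),1,0), (((5,16,1),(21,62,2),(31,87,-1)),1,1),
    (((3,12,1),(13,35,-2),(36,101,-1)),1,1), (((6,19,1),(16,43,-2),(35,98,-1)),1,0),
    (((0,4,3),(11,34,2),(29,84,1)),1,0), (((0,3,3),(14,42,2),(33,95,1)),1,1),
    (((3,4,0),(3,6,0),(30,84,0)),0,1), (((3,5,0),(23,61,0),(33,91,0)),0,1),
    (((7,19,0),(14,43,0),(34,98,0)),0,1), (((0,1,0),(21,58,0),(24,69,0)),0,1),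
    (((14,40,0),(17,48,0),(35,99,0)),0,1), (((6,17,0),(29,82,0),(35,100,0)),0,1),
    (((5,15,0),(18,52,0),(31,88,0)),0,1), (((4,13,0),(27,76,0),(31,90,0)),0,1),
    (((3,7,0),(13,34,0),(24,67,0)),0,1), (((3,9,0),(29,81,0),(36,102,0)),0,1),
    (((7,22,0),(17,50,0),(34,97,0)),0,1), (((10,26,0),(23,64,0),(34,96,0)),0,1),
    (((11,31,0),(14,41,0),(30,85,0)),0,1), (((7,20,0),(17,49,0),(33,94,0)),0,1)]

theorem tI5 (k : ℕ) (hr : k % 6 = 5) (hk : 12 ≤ k) :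
    Sys (6 * k) [] k :=
  fmI 5 2  dI5 (by decide +kernel) k hr hk

def dII0 : List Fam := [
    (((0,4,3),(9,32,2),(32,104,1)),1,0), (((0,6,3),(25,81,1),(30,99,2)),1,1),
    (((3,11,1),(21,63,-2),(28,87,-1)),1,0), (((9,31,2),(14,47,1),(27,87,-1)),1,1),
    (((6,19,1),(19,58,-1),(34,109,2)),1,1), (((0,5,3),(21,69,1),(34,112,2)),1,0),
    (((15,50,0),(18,54,0),(33,107,0)),0,1), (((3,5,0),(14,43,0),(29,91,0)),0,1),
    (((8,28,0),(11,36,0),(30,100,0)),0,1), (((0,3,0),(15,52,0),(19,63,0)),0,1),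
    (((0,1,0),(14,46,0),(25,78,0)),0,1), (((3,10,0),(21,65,0),(32,102,0)),0,1),
    (((4,13,0),(11,34,0),(32,101,0)),0,1), (((4,14,0),(23,73,0),(32,103,0)),0,1),
    (((8,24,0),(11,33,0),(30,94,0)),0,1), (((5,17,0),(9,29,0),(30,97,0)),0,1),
    (((4,15,0),(26,84,0),(34,110,0)),0,1), (((7,20,0),(26,82,0),(33,105,0)),0,1),
    (((0,2,0),(23,76,0),(30,98,0)),0,1), (((8,25,0),(21,66,0),(34,108,0)),0,1),
    (((8,27,0),(22,71,0),(33,106,0)),0,1)]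

theorem tII0 (k : ℕ) (hr : k % 6 = 0) (hk : 18 ≤ k) :
    ∃ b : ℤ, Sys (6 * k + 2) [b, 6 * k + 3 - b] k :=
  fmII 0 3 (3,7) dII0 (by decide +kernel) k hr hk

def dII1 : List Fam := [
    (((0,5,3),(9,32,2),(32,104,1)),1,0), (((0,3,3),(25,80,1),(30,96,2)),1,2),
    (((3,9,1),(21,61,-2),(28,85,-1)),1,0), (((9,31,2),(14,46,1),(27,84,-1)),1,0),
    (((6,19,1),(19,58,-1),(34,109,2)),1,1), (((0,4,3),(21,68,1),(34,110,2)),1,1),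
    (((11,37,0),(15,46,0),(30,99,0)),0,1), (((3,7,0),(11,31,0),(26,83,0)),0,1),
    (((4,15,0),(7,20,0),(22,69,0)),0,1), (((0,2,0),(21,65,0),(28,88,0)),0,1),
    (((11,33,0),(18,55,0),(36,111,0)),0,1), (((11,32,0),(19,59,0),(33,104,0)),0,1),
    (((0,1,0),(32,102,0),(36,116,0)),0,1), (((7,21,0),(28,87,0),(36,112,0)),0,1),
    (((4,13,0),(22,70,0),(36,113,0)),0,1), (((4,12,0),(13,40,0),(34,107,0)),0,1),
    (((4,10,0),(19,60,0),(30,94,0)),0,1), (((3,8,0),(14,44,0),(33,105,0)),0,1),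
    (((6,18,0),(15,48,0),(28,89,0)),0,1), (((4,11,0),(27,85,0),(36,114,0)),0,1),
    (((8,26,0),(23,73,0),(34,108,0)),0,1)]

theorem tII1 (k : ℕ) (hr : k % 6 = 1) (hk : 18 ≤ k) :
    ∃ b : ℤ, Sys (6 * k + 2) [b, 6 * k + 3 - b] k :=
  fmII 1 3 (11,38) dII1 (by decide +kernel) k hr hk

def dII2 : List Fam := [
    (((0,3,3),(21,53,2),(26,65,1)),1,0), (((5,15,1),(21,56,2),(31,76,-1)),1,0),
    (((3,9,1),(13,28,-2),(36,85,-1)),1,0), (((6,16,1),(16,37,-2),(35,84,-1)),1,0),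
    (((0,4,3),(11,29,2),(29,71,1)),1,0), (((0,5,3),(14,38,2),(33,80,1)),1,0),
    (((5,14,0),(16,40,0),(35,85,0)),0,1), (((5,13,0),(21,51,0),(34,83,0)),0,1),
    (((0,2,0),(24,60,0),(34,82,0)),0,1), (((4,9,0),(23,53,0),(34,81,0)),0,1),
    (((0,1,0),(3,4,0),(33,78,0)),0,1), (((10,24,0),(14,36,0),(33,79,0)),0,1),
    (((6,15,0),(23,56,0),(30,76,0)),0,1), (((4,11,0),(17,42,0),(30,75,0)),0,1),
    (((7,17,0),(26,63,0),(36,86,0)),0,1), (((3,5,0),(27,67,0),(30,73,0)),0,1),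
    (((7,16,0),(14,37,0),(27,66,0)),0,1), (((3,8,0),(7,18,0),(27,65,0)),0,1),
    (((3,7,0),(14,34,0),(24,59,0)),0,1), (((13,30,0),(20,49,0),(34,84,0)),0,1)]

theorem tII2 (k : ℕ) (hr : k % 6 = 2) (hk : 12 ≤ k) :
    ∃ b : ℤ, Sys (6 * k + 2) [b, 6 * k + 3 - b] k :=
  fmII 2 2 (16,39) dII2 (by decide +kernel) k hr hk

def dII3 : List Fam := [
    (((0,5,3),(9,35,2),(32,114,1)),1,1), (((0,4,3),(25,89,1),(30,108,2)),1,2),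
    (((3,12,1),(21,68,-2),(28,96,-1)),1,0), (((9,34,2),(14,50,1),(27,92,-1)),1,1),
    (((6,22,1),(19,65,-1),(34,122,2)),1,1), (((0,3,3),(21,74,1),(34,119,2)),1,2),
    (((13,44,0),(21,72,0),(36,128,0)),0,1), (((14,47,0),(18,59,0),(36,123,0)),0,1),
    (((15,55,0),(18,63,0),(36,125,0)),0,1), (((7,26,0),(25,86,0),(36,127,0)),0,1),
    (((4,13,0),(11,36,0),(36,124,0)),0,1), (((9,32,0),(27,93,0),(36,126,0)),0,1),
    (((0,1,0),(23,81,0),(34,118,0)),0,1), (((5,17,0),(27,95,0),(32,113,0)),0,1),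
    (((6,21,0),(15,52,0),(34,120,0)),0,1), (((4,14,0),(11,39,0),(32,112,0)),0,1),
    (((0,2,0),(15,53,0),(30,107,0)),0,1), (((8,29,0),(11,40,0),(30,106,0)),0,1),
    (((3,9,0),(7,24,0),(26,91,0)),0,1), (((3,10,0),(14,48,0),(28,97,0)),0,1)]

theorem tII3 (k : ℕ) (hr : k % 6 = 3) (hk : 18 ≤ k) :
    ∃ b : ℤ, Sys (6 * k + 2) [b, 6 * k + 3 - b] k :=
  fmII 3 3 (7,27) dII3 (by decide +kernel) k hr hk

def dII4 : List Fam := [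
    (((0,3,3),(9,28,2),(32,89,1)),1,0), (((0,5,3),(25,69,1),(30,83,2)),1,0),
    (((3,9,1),(21,52,-2),(28,74,-1)),1,0), (((9,27,2),(14,40,1),(27,72,-1)),1,0),
    (((6,16,1),(19,49,-1),(34,93,2)),1,1), (((0,4,3),(21,59,1),(34,96,2)),1,0),
    (((3,3,0),(33,89,0),(36,95,0)),0,1), (((4,13,0),(15,45,0),(26,72,0)),0,1),
    (((8,25,0),(11,29,0),(26,71,0)),0,1), (((3,5,0),(25,66,0),(32,83,0)),0,1),
    (((0,2,0),(19,55,0),(23,64,0)),0,1), (((0,1,0),(26,70,0),(30,80,0)),0,1),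
    (((6,15,0),(21,56,0),(36,96,0)),0,1), (((7,20,0),(25,68,0),(34,94,0)),0,1),
    (((8,23,0),(14,37,0),(27,73,0)),0,1), (((8,22,0),(15,43,0),(36,97,0)),0,1),
    (((4,11,0),(23,63,0),(36,98,0)),0,1), (((3,8,0),(14,39,0),(33,90,0)),0,1),
    (((3,7,0),(25,67,0),(33,91,0)),0,1), (((4,12,0),(11,30,0),(32,88,0)),0,1),
    (((11,28,0),(18,47,0),(32,85,0)),0,1)]

theorem tII4 (k : ℕ) (hr : k % 6 = 4) (hk : 12 ≤ k) :
    ∃ b : ℤ, Sys (6 * k + 2) [b, 6 * k + 3 - b] k :=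
  fmII 4 2 (13,34) dII4 (by decide +kernel) k hr hk

def dII5 : List Fam := [
    (((0,4,3),(9,30,2),(32,95,1)),1,0), (((0,6,3),(25,74,1),(30,92,2)),1,1),
    (((3,10,1),(21,57,-2),(28,79,-1)),1,0), (((9,27,2),(14,42,1),(27,76,-1)),1,0),
    (((6,19,1),(19,54,-1),(34,102,2)),1,0), (((0,2,3),(21,62,1),(34,101,2)),1,1),
    (((4,15,0),(15,42,0),(30,91,0)),0,1), (((13,36,0),(13,37,0),(27,77,0)),0,1),
    (((4,12,0),(27,78,0),(32,94,0)),0,1), (((3,8,0),(21,59,0),(30,87,0)),0,1),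
    (((7,20,0),(28,81,0),(36,103,0)),0,1), (((3,9,0),(28,80,0),(32,93,0)),0,1),
    (((5,17,0),(23,69,0),(30,90,0)),0,1), (((3,5,0),(18,48,0),(36,102,0)),0,1),
    (((7,19,0),(25,72,0),(36,104,0)),0,1), (((8,25,0),(11,29,0),(26,75,0)),0,1),
    (((3,7,0),(25,70,0),(33,96,0)),0,1), (((8,23,0),(19,58,0),(30,88,0)),0,1),
    (((15,44,0),(19,55,0),(34,100,0)),0,1), (((0,3,0),(11,34,0),(33,98,0)),0,1),
    (((4,10,0),(8,24,0),(19,57,0)),0,1)]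

theorem tII5 (k : ℕ) (hr : k % 6 = 5) (hk : 12 ≤ k) :
    ∃ b : ℤ, Sys (6 * k + 2) [b, 6 * k + 3 - b] k :=
  fmII 5 2 (13,38) dII5 (by decide +kernel) k hr hk

def dIII0 : List Fam := [
    (((0,4,3),(9,34,2),(32,110,1)),1,1), (((0,5,3),(25,86,1),(30,105,2)),1,1),
    (((3,11,1),(21,65,-2),(28,91,-1)),1,0), (((9,33,2),(14,49,1),(27,91,-1)),1,0),
    (((6,21,1),(19,62,-1),(34,118,2)),1,0), (((0,3,3),(21,73,1),(34,117,2)),1,1),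
    (((11,33,0),(15,49,0),(26,91,0)),0,1), (((9,31,0),(15,51,0),(34,116,0)),0,1),
    (((4,11,0),(25,83,0),(34,115,0)),0,1), (((7,22,0),(15,50,0),(28,93,0)),0,1),
    (((3,7,0),(18,62,0),(36,118,0)),0,1), (((4,14,0),(11,38,0),(30,101,0)),0,1),
    (((4,12,0),(19,66,0),(30,102,0)),0,1), (((3,8,0),(26,88,0),(29,97,0)),0,1),
    (((11,35,0),(19,64,0),(30,103,0)),0,1), (((3,10,0),(21,67,0),(32,108,0)),0,1),
    (((8,27,0),(22,74,0),(36,119,0)),0,1), (((11,37,0),(15,52,0),(33,112,0)),0,1),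
    (((11,40,0),(14,46,0),(29,99,0)),0,1), (((4,13,0),(18,61,0),(25,82,0)),0,1),
    (((0,2,0),(7,25,0),(32,109,0)),0,1)]

theorem tIII0 (k : ℕ) (hr : k % 6 = 0) (hk : 18 ≤ k) :
    ∃ x y z b : ℤ, Sys (6 * k + 11) (tri x y z ++ [b, 6 * k + 12 - b]) k :=
  fmIII 0 3 (8,26) (0,1) (23,78) (5,17) dIII0 (by decide +kernel) k hr hk

def dIII2 : List Fam := [
    (((0,6,3),(9,37,2),(32,120,1)),1,1), (((0,4,3),(25,93,1),(30,113,2)),1,1),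
    (((3,13,1),(21,73,-2),(28,101,-1)),1,0), (((9,36,2),(14,53,1),(27,98,-1)),1,1),
    (((6,24,1),(19,68,-1),(34,126,2)),1,1), (((0,5,3),(21,79,1),(34,127,2)),1,1),
    (((3,7,0),(18,67,0),(36,128,0)),0,1), (((0,2,0),(23,88,0),(26,96,0)),0,1),
    (((8,28,0),(23,87,0),(34,125,0)),0,1), (((0,1,0),(19,73,0),(32,119,0)),0,1),
    (((5,19,0),(9,33,0),(34,123,0)),0,1), (((4,13,0),(15,55,0),(34,124,0)),0,1),
    (((3,9,0),(22,80,0),(30,110,0)),0,1), (((7,27,0),(21,77,0),(30,112,0)),0,1),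
    (((6,22,0),(9,34,0),(27,100,0)),0,1), (((0,3,0),(11,43,0),(29,106,0)),0,1),
    (((4,16,0),(15,57,0),(29,108,0)),0,1), (((6,21,0),(9,32,0),(32,116,0)),0,1),
    (((15,54,0),(18,64,0),(36,129,0)),0,1), (((4,15,0),(25,91,0),(36,130,0)),0,1),
    (((7,26,0),(22,82,0),(36,131,0)),0,1)]

theorem tIII2 (k : ℕ) (hr : k % 6 = 2) (hk : 18 ≤ k) :
    ∃ x y z b : ℤ, Sys (6 * k + 11) (tri x y z ++ [b, 6 * k + 12 - b]) k :=
  fmIII 2 3 (7,25) (8,29) (14,52) (5,18) dIII2 (by decide +kernel) k hr hk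

def dIII4 : List Fam := [
    (((0,3,3),(9,30,2),(32,95,1)),1,0), (((0,4,3),(25,75,1),(30,91,2)),1,1),
    (((3,10,1),(21,57,-2),(28,80,-1)),1,0), (((9,29,2),(14,43,1),(27,77,-1)),1,0),
    (((6,19,1),(19,54,-1),(34,103,2)),1,0), (((0,5,3),(21,63,1),(34,102,2)),1,0),
    (((8,27,0),(11,30,0),(26,77,0)),0,1), (((11,35,0),(15,48,0),(36,107,0)),0,1),
    (((3,6,0),(18,49,0),(33,95,0)),0,1), (((11,29,0),(19,55,0),(34,99,0)),0,1),
    (((4,14,0),(7,21,0),(30,90,0)),0,1), (((6,18,0),(11,33,0),(34,101,0)),0,1),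
    (((0,2,0),(13,38,0),(34,100,0)),0,1), (((0,1,0),(23,67,0),(27,79,0)),0,1),
    (((4,10,0),(18,52,0),(36,103,0)),0,1), (((7,22,0),(15,45,0),(28,82,0)),0,1),
    (((7,20,0),(28,81,0),(36,106,0)),0,1), (((4,11,0),(22,65,0),(29,84,0)),0,1),
    (((6,17,0),(25,74,0),(36,105,0)),0,1), (((3,9,0),(14,41,0),(32,94,0)),0,1),
    (((3,8,0),(22,64,0),(36,104,0)),0,1)]

theorem tIII4 (k : ℕ) (hr : k % 6 = 4) (hk : 12 ≤ k) :
    ∃ x y z b : ℤ, Sys (6 * k + 11) (tri x y z ++ [b, 6 * k + 12 - b]) k :=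
  fmIII 4 2 (9,28) (11,34) (19,58) (3,5) dIII4 (by decide +kernel) k hr hk

theorem uI0 : Sys (6 * (0 : ℕ)) [] (0 : ℕ) :=
  smI 0  [
   ]
    (by decide +kernel) rfl

theorem uI1 : Sys (6 * (1 : ℕ)) [] (1 : ℕ) :=
  smI 1  [
    (1,4,6)]
    (by decide +kernel) rfl

theorem uI4 : Sys (6 * (4 : ℕ)) [] (4 : ℕ) :=
  smI 4  [
    (6,14,24), (1,20,23), (2,13,17), (5,12,21)]
    (by decide +kernel) rfl

theorem uI5 : Sys (6 * (5 : ℕ)) [] (5 : ℕ) :=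
  smI 5  [
    (2,13,30), (4,24,29), (1,15,23), (7,10,26), (6,18,27)]
    (by decide +kernel) rfl

theorem uI6 : Sys (6 * (6 : ℕ)) [] (6 : ℕ) :=
  smI 6  [
    (7,28,36), (9,19,34), (1,31,33), (4,20,26), (3,14,27), (12,17,35)]
    (by decide +kernel) rfl

theorem uI7 : Sys (6 * (7 : ℕ)) [] (7 : ℕ) :=
  smI 7  [
    (3,8,42), (7,25,38), (10,21,40), (2,29,35), (4,20,32), (15,24,41), (1,23,37)]
    (by decide +kernel) rfl

theorem uI8 : Sys (6 * (8 : ℕ)) [] (8 : ℕ) :=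
  smI 8  [
    (6,35,48), (5,37,46), (8,22,47), (2,26,36), (7,18,38), (12,15,45), (17,21,40), (1,28,44)]
    (by decide +kernel) rfl

theorem uI9 : Sys (6 * (9 : ℕ)) [] (9 : ℕ) :=
  smI 9  [
    (2,15,54), (10,21,53), (3,23,51), (5,30,47), (6,24,50), (14,33,49), (7,29,41), (4,31,40),
    (1,38,46)]
    (by decide +kernel) rfl

theorem uI10 : Sys (6 * (10 : ℕ)) [] (10 : ℕ) :=
  smI 10  [
    (11,25,60), (10,41,58), (7,44,57), (12,27,59), (1,23,53), (21,29,55), (4,24,43), (5,33,51),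
    (2,40,56), (3,9,45)]
    (by decide +kernel) rfl

theorem uI11 : Sys (6 * (11 : ℕ)) [] (11 : ℕ) :=
  smI 11  [
    (8,56,66), (15,42,65), (2,49,62), (3,36,64), (1,35,53), (22,29,54), (4,45,59), (9,30,46),
    (6,17,57), (5,31,43), (19,39,63)]
    (by decide +kernel) rfl

theorem uI12 : Sys (6 * (12 : ℕ)) [] (12 : ℕ) :=
  smI 12  [
    (6,21,72), (9,47,70), (28,41,71), (4,52,69), (8,42,67), (1,33,55), (2,37,64), (5,49,63),
    (12,31,57), (20,36,60), (3,10,56), (18,29,68)]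
    (by decide +kernel) rfl

theorem uI13 : Sys (6 * (13 : ℕ)) [] (13 : ℕ) :=
  smI 13  [
    (14,37,78), (31,34,76), (16,27,77), (18,24,70), (9,35,71), (5,59,74), (17,47,66),
    (7,55,65), (2,22,75), (4,29,67), (8,40,68), (21,33,72), (1,44,57)]
    (by decide +kernel) rfl

theorem uI14 : Sys (6 * (14 : ℕ)) [] (14 : ℕ) :=
  smI 14  [
    (10,58,84), (11,19,83), (15,38,81), (16,56,78), (30,47,79), (25,27,82), (9,46,70),
    (5,50,68), (3,42,54), (1,36,77), (4,69,75), (13,44,73), (21,28,80), (14,34,67)]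
    (by decide +kernel) rfl

theorem uI18 : Sys (6 * (18 : ℕ)) [] (18 : ℕ) :=
  smI 18  [
    (19,48,108), (21,72,106), (2,64,107), (1,33,103), (10,86,100), (23,61,98), (6,83,101),
    (12,79,92), (5,9,87), (35,52,94), (44,47,97), (26,46,91), (24,39,93), (7,56,81),
    (28,68,99), (8,63,104), (11,27,84), (22,58,88)]
    (by decide +kernel) rfl

theorem uI19 : Sys (6 * (19 : ℕ)) [] (19 : ℕ) :=
  smI 19  [
    (2,76,114), (1,87,111), (28,75,107), (22,41,105), (42,51,113), (23,48,108), (3,96,103),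
    (4,20,101), (18,31,109), (12,68,102), (11,66,95), (10,63,80), (8,44,77), (15,65,104),
    (6,58,88), (26,61,98), (21,67,94), (14,57,106), (40,45,99)]
    (by decide +kernel) rfl

theorem sysI (k : ℕ) (h2 : k ≠ 2) (h3 : k ≠ 3) :
    Sys (6 * k) [] k := by
  by_cases c0 : k % 6 = 0 ∧ 24 ≤ k
  · exact tI0 k c0.1 c0.2
  by_cases c1 : k % 6 = 1 ∧ 24 ≤ k
  · exact tI1 k c1.1 c1.2
  by_cases c2 : k % 6 = 2 ∧ 18 ≤ k
  · exact tI2 k c2.1 c2.2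
  by_cases c3 : k % 6 = 3 ∧ 12 ≤ k
  · exact tI3 k c3.1 c3.2
  by_cases c4 : k % 6 = 4 ∧ 12 ≤ k
  · exact tI4 k c4.1 c4.2
  by_cases c5 : k % 6 = 5 ∧ 12 ≤ k
  · exact tI5 k c5.1 c5.2
  have hk : k = 0 ∨ k = 1 ∨ k = 4 ∨ k = 5 ∨ k = 6 ∨ k = 7 ∨ k = 8 ∨ k = 9 ∨ k = 10 ∨ k = 11 ∨ k = 12 ∨ k = 13 ∨ k = 14 ∨ k = 18 ∨ k = 19 := by omega
  rcases hk with rfl | rfl | rfl | rfl | rfl | rfl | rfl | rfl | rfl | rfl | rfl | rfl | rfl | rfl | rfl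
  · exact uI0
  · exact uI1
  · exact uI4
  · exact uI5
  · exact uI6
  · exact uI7
  · exact uI8
  · exact uI9
  · exact uI10
  · exact uI11
  · exact uI12
  · exact uI13
  · exact uI14
  · exact uI18
  · exact uI19

theorem uII0 : ∃ b : ℤ, Sys (6 * (0 : ℕ) + 2) [b, 6 * (0 : ℕ) + 3 - b] (0 : ℕ) :=
  smII 0 1 [
   ]
    (by norm_num) (by decide +kernel) rfl

theorem uII2 : ∃ b : ℤ, Sys (6 * (2 : ℕ) + 2) [b, 6 * (2 : ℕ) + 3 - b] (2 : ℕ) :=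
  smII 2 4 [
    (1,6,14), (2,9,12)]
    (by norm_num) (by decide +kernel) rfl

theorem uII3 : ∃ b : ℤ, Sys (6 * (3 : ℕ) + 2) [b, 6 * (3 : ℕ) + 3 - b] (3 : ℕ) :=
  smII 3 6 [
    (4,13,20), (1,11,19), (3,5,17)]
    (by norm_num) (by decide +kernel) rfl

theorem uII4 : ∃ b : ℤ, Sys (6 * (4 : ℕ) + 2) [b, 6 * (4 : ℕ) + 3 - b] (4 : ℕ) :=
  smII 4 5 [
    (3,17,26), (6,8,24), (1,13,20), (4,15,25)]
    (by norm_num) (by decide +kernel) rfl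

theorem uII5 : ∃ b : ℤ, Sys (6 * (5 : ℕ) + 2) [b, 6 * (5 : ℕ) + 3 - b] (5 : ℕ) :=
  smII 5 6 [
    (8,22,32), (2,15,31), (3,23,28), (4,21,30), (1,12,19)]
    (by norm_num) (by decide +kernel) rfl

theorem uII6 : ∃ b : ℤ, Sys (6 * (6 : ℕ) + 2) [b, 6 * (6 : ℕ) + 3 - b] (6 : ℕ) :=
  smII 6 17 [
    (11,20,38), (4,25,37), (1,29,36), (6,16,30), (2,15,34), (5,8,31)]
    (by norm_num) (by decide +kernel) rfl

theorem uII7 : ∃ b : ℤ, Sys (6 * (7 : ℕ) + 2) [b, 6 * (7 : ℕ) + 3 - b] (7 : ℕ) :=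
  smII 7 15 [
    (11,23,44), (16,17,43), (5,8,40), (2,20,39), (6,28,42), (7,31,41), (9,13,38)]
    (by norm_num) (by decide +kernel) rfl

theorem uII8 : ∃ b : ℤ, Sys (6 * (8 : ℕ) + 2) [b, 6 * (8 : ℕ) + 3 - b] (8 : ℕ) :=
  smII 8 6 [
    (8,20,50), (1,22,49), (3,32,46), (11,28,47), (2,26,39), (4,35,44), (5,15,38), (7,25,41)]
    (by norm_num) (by decide +kernel) rfl

theorem uII9 : ∃ b : ℤ, Sys (6 * (9 : ℕ) + 2) [b, 6 * (9 : ℕ) + 3 - b] (9 : ℕ) :=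
  smII 9 13 [
    (19,29,56), (14,25,55), (6,32,53), (4,24,52), (5,22,40), (1,34,50), (2,38,45), (9,12,51),
    (8,23,54)]
    (by norm_num) (by decide +kernel) rfl

theorem uII10 : ∃ b : ℤ, Sys (6 * (10 : ℕ) + 2) [b, 6 * (10 : ℕ) + 3 - b] (10 : ℕ) :=
  smII 10 26 [
    (19,29,62), (1,58,60), (7,41,61), (18,24,46), (5,40,49), (4,36,51), (14,31,52), (13,25,55),
    (11,27,50), (3,48,56)]
    (by norm_num) (by decide +kernel) rfl

theorem uII11 : ∃ b : ℤ, Sys (6 * (11 : ℕ) + 2) [b, 6 * (11 : ℕ) + 3 - b] (11 : ℕ) :=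
  smII 11 24 [
    (16,19,68), (9,13,66), (21,35,67), (5,34,65), (8,47,59), (2,27,44), (7,50,61), (6,36,62),
    (10,38,58), (18,33,55), (1,41,64)]
    (by norm_num) (by decide +kernel) rfl

theorem uII12 : ∃ b : ℤ, Sys (6 * (12 : ℕ) + 2) [b, 6 * (12 : ℕ) + 3 - b] (12 : ℕ) :=
  smII 12 9 [
    (15,23,74), (1,44,73), (16,30,70), (11,50,71), (3,55,67), (6,32,63), (7,49,68), (2,38,48),
    (13,47,69), (17,35,62), (24,28,65), (5,25,58)]
    (by norm_num) (by decide +kernel) rfl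

theorem uII13 : ∃ b : ℤ, Sys (6 * (13 : ℕ) + 2) [b, 6 * (13 : ℕ) + 3 - b] (13 : ℕ) :=
  smII 13 11 [
    (24,41,80), (22,45,79), (2,32,76), (16,26,77), (18,58,78), (9,52,73), (13,19,72),
    (5,42,54), (8,35,63), (29,36,67), (4,50,75), (1,66,69), (14,47,62)]
    (by norm_num) (by decide +kernel) rfl

theorem uII15 : ∃ b : ℤ, Sys (6 * (15 : ℕ) + 2) [b, 6 * (15 : ℕ) + 3 - b] (15 : ℕ) :=
  smII 15 9 [
    (19,23,92), (10,59,90), (6,53,91), (26,34,88), (24,61,89), (18,57,86), (2,32,74),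
    (16,66,87), (3,43,79), (1,15,82), (7,48,70), (5,56,83), (11,55,75), (17,52,77), (12,45,58)]
    (by norm_num) (by decide +kernel) rfl

theorem sysII (k : ℕ) (h1 : k ≠ 1) :
    ∃ b : ℤ, Sys (6 * k + 2) [b, 6 * k + 3 - b] k := by
  by_cases c0 : k % 6 = 0 ∧ 18 ≤ k
  · exact tII0 k c0.1 c0.2
  by_cases c1 : k % 6 = 1 ∧ 18 ≤ k
  · exact tII1 k c1.1 c1.2
  by_cases c2 : k % 6 = 2 ∧ 12 ≤ k
  · exact tII2 k c2.1 c2.2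
  by_cases c3 : k % 6 = 3 ∧ 18 ≤ k
  · exact tII3 k c3.1 c3.2
  by_cases c4 : k % 6 = 4 ∧ 12 ≤ k
  · exact tII4 k c4.1 c4.2
  by_cases c5 : k % 6 = 5 ∧ 12 ≤ k
  · exact tII5 k c5.1 c5.2
  have hk : k = 0 ∨ k = 2 ∨ k = 3 ∨ k = 4 ∨ k = 5 ∨ k = 6 ∨ k = 7 ∨ k = 8 ∨ k = 9 ∨ k = 10 ∨ k = 11 ∨ k = 12 ∨ k = 13 ∨ k = 15 := by omega
  rcases hk with rfl | rfl | rfl | rfl | rfl | rfl | rfl | rfl | rfl | rfl | rfl | rfl | rfl | rfl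
  · exact uII0
  · exact uII2
  · exact uII3
  · exact uII4
  · exact uII5
  · exact uII6
  · exact uII7
  · exact uII8
  · exact uII9
  · exact uII10
  · exact uII11
  · exact uII12
  · exact uII13
  · exact uII15

theorem uIII4 : ∃ x y z b : ℤ, Sys (6 * (4 : ℕ) + 11) (tri x y z ++ [b, 6 * (4 : ℕ) + 12 - b]) (4 : ℕ) :=
  smIII 4 13 10 11 7 [
    (3,29,33), (5,24,32), (12,14,34), (6,15,31)]
    (by norm_num) (by norm_num) (by decide +kernel) rfl

theorem uIII6 : ∃ x y z b : ℤ, Sys (6 * (6 : ℕ) + 11) (tri x y z ++ [b, 6 * (6 : ℕ) + 12 - b]) (6 : ℕ) :=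
  smIII 6 6 13 23 1 [
    (5,26,45), (11,27,44), (2,32,41), (7,15,35), (3,34,46), (18,22,47)]
    (by norm_num) (by norm_num) (by decide +kernel) rfl

theorem uIII8 : ∃ x y z b : ℤ, Sys (6 * (8 : ℕ) + 11) (tri x y z ++ [b, 6 * (8 : ℕ) + 12 - b]) (8 : ℕ) :=
  smIII 8 8 3 18 10 [
    (12,36,58), (7,40,54), (11,37,56), (4,42,59), (1,35,51), (6,29,49), (5,44,53), (25,27,57)]
    (by norm_num) (by norm_num) (by decide +kernel) rfl

theorem uIII10 : ∃ x y z b : ℤ, Sys (6 * (10 : ℕ) + 11) (tri x y z ++ [b, 6 * (10 : ℕ) + 12 - b]) (10 : ℕ) :=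
  smIII 10 1 9 44 7 [
    (23,37,68), (21,41,70), (2,63,66), (4,19,59), (17,43,65), (10,38,56), (8,50,62),
    (11,24,58), (30,36,69), (5,32,57)]
    (by norm_num) (by norm_num) (by decide +kernel) rfl

theorem uIII12 : ∃ x y z b : ℤ, Sys (6 * (12 : ℕ) + 11) (tri x y z ++ [b, 6 * (12 : ℕ) + 12 - b]) (12 : ℕ) :=
  smIII 12 26 4 56 7 [
    (22,35,83), (39,42,82), (5,34,81), (9,55,75), (23,41,73), (12,49,77), (1,72,80),
    (16,54,78), (10,25,69), (19,33,64), (2,53,70), (21,27,57)]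
    (by norm_num) (by norm_num) (by decide +kernel) rfl

theorem uIII14 : ∃ x y z b : ℤ, Sys (6 * (14 : ℕ) + 11) (tri x y z ++ [b, 6 * (14 : ℕ) + 12 - b]) (14 : ℕ) :=
  smIII 14 13 37 42 3 [
    (27,56,94), (11,66,92), (2,75,91), (4,76,90), (1,70,88), (17,51,95), (8,36,57), (24,59,84),
    (32,47,80), (30,50,93), (10,41,64), (7,46,68), (6,58,77), (9,62,74)]
    (by norm_num) (by norm_num) (by decide +kernel) rfl

theorem sysIII (k : ℕ) (h0 : k ≠ 0) (h2 : k ≠ 2) (h : k % 2 = 0) :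
    ∃ x y z b : ℤ, Sys (6 * k + 11) (tri x y z ++ [b, 6 * k + 12 - b]) k := by
  by_cases c0 : k % 6 = 0 ∧ 18 ≤ k
  · exact tIII0 k c0.1 c0.2
  by_cases c2 : k % 6 = 2 ∧ 18 ≤ k
  · exact tIII2 k c2.1 c2.2
  by_cases c4 : k % 6 = 4 ∧ 12 ≤ k
  · exact tIII4 k c4.1 c4.2
  have hk : k = 4 ∨ k = 6 ∨ k = 8 ∨ k = 10 ∨ k = 12 ∨ k = 14 := by omega
  rcases hk with rfl | rfl | rfl | rfl | rfl | rfl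
  · exact uIII4
  · exact uIII6
  · exact uIII8
  · exact uIII10
  · exact uIII12
  · exact uIII14

theorem resAll (n : ℕ) [NeZero n]
    (hn : n % 12 = 1 ∨ n % 12 = 2 ∨ n % 12 = 3 ∨ n % 12 = 6 ∨ n % 24 = 0) : Res n := by
  by_cases c1 : n % 12 = 1 ∨ n % 12 = 2 ∨ n % 12 = 3
  · by_cases c2 : n / 12 = 2
    · have : n = 25 ∨ n = 26 ∨ n = 27 := by omega
      rcases this with rfl | rfl | rfl
      · exact e25
      · exact e26
      · exact e27
    by_cases c3 : n / 12 = 3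
    · have : n = 37 ∨ n = 38 ∨ n = 39 := by omega
      rcases this with rfl | rfl | rfl
      · exact e37
      · exact e38
      · exact e39
    exact resI (sysI (n / 12) c2 c3) n (by omega)
  by_cases c2 : n % 12 = 6
  · by_cases c3 : n / 12 = 1
    · have : n = 18 := by omega
      subst this
      exact e18
    obtain ⟨b, hb⟩ := sysII (n / 12) c3
    exact resII b hb n (by omega)
  have c3 : n % 24 = 0 := by omega
  have h0 : n ≠ 0 := NeZero.ne n
  by_cases c4 : n = 24
  · subst c4
    exact e24
  by_cases c5 : n = 48
  · subst c5
    exact e48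
  obtain ⟨x, y, z, b, hb⟩ := sysIII (n / 12 - 2) (by omega) (by omega) (by omega)
  exact resIII x y z b hb n (by omega)

end CC

/-- For every positive `n ≡ 1,2,3,6 (mod 12)` or `n ≡ 0 (mod 24)`, there exists
a cyclic `(n,6,4)_3` code with exactly `C(n)` codewords; in particular it is
optimal. -/
theorem stmt_17 (n : ℕ) [NeZero n]
    (hn : n % 12 = 1 ∨ n % 12 = 2 ∨ n % 12 = 3 ∨ n % 12 = 6 ∨ n % 24 = 0) :
    ∃ 𝓒 : Set (ZMod n → Fin 3), IsCyclicCode643 n 𝓒 ∧ 𝓒.ncard = codeBound n ∧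
      ∀ 𝓓 : Set (ZMod n → Fin 3), IsCyclicCode643 n 𝓓 → 𝓓.ncard ≤ 𝓒.ncard := by
  exact CC.final (CC.resAll n hn) hn
end

section
/- For every positive integer v with v ≡ 1, 2, 3, 4 or 6 (mod 12) or v ≡ 0 (mod 24), a J-optimal (v,4,1)-OOC (i.e., one with exactly ⌊(v−1)/12⌋ codewords) exists if and only if v ≠ 25. -/
/-- The multiset of differences `x - y` (with `x ≠ y`) from a finset `B`. -/
def blockDiffs {G : Type*} [AddGroup G] [DecidableEq G] (F : Finset G) : Multiset G :=
  ((F ×ˢ F).filter fun p => p.1 ≠ p.2).val.map fun p => p.1 - p.2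

/-- A `(v,4,1)`-OOC (optical orthogonal code), set-theoretically: a set of
4-element subsets of `Z_v` (codewords) whose multiset of differences contains
no element of `Z_v` more than once. -/
def IsOOC (v : ℕ) (𝓒 : Finset (Finset (ZMod v))) : Prop :=
  (∀ B ∈ 𝓒, B.card = 4) ∧
  ∀ x : ZMod v, (𝓒.val.bind blockDiffs).count x ≤ 1


/-- six positive differences of the block `0,a,b,c` -/
def six {G : Type*} [AddGroup G] (b : G × G × G) : List G :=
  [b.1, b.2.1, b.2.2, b.2.1 - b.1, b.2.2 - b.1, b.2.2 - b.2.1]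

def six2 {G : Type*} [AddGroup G] (b : G × G × G) : List G :=
  six b ++ (six b).map (fun x => -x)

theorem blockDiffs_eq {G : Type*} [AddCommGroup G] [DecidableEq G] (p q a b : G)
    (ha : p ≠ q) (h1 : p ≠ a) (h2 : p ≠ b) (h3 : q ≠ a) (h4 : q ≠ b) (h5 : a ≠ b) :
    blockDiffs ({p, q, a, b} : Finset G) = ((six2 (q - p, a - p, b - p) : List G) : Multiset G) := by
  have hF : ({p, q, a, b} : Finset G) = ⟨([p, q, a, b] : List G), by simp [*]⟩ := by
    ext x; simp
  rw [hF]
  unfold blockDiffs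
  simp only [Finset.filter_val, Finset.product_val, Multiset.coe_product]
  have e1 : ∀ x y z : G, (x - z) - (y - z) = x - y := fun x y z => by abel
  simp only [SProd.sprod, List.product, List.flatMap_cons, List.flatMap_nil, List.map_cons, List.map_nil,
    List.cons_append, List.nil_append, Multiset.filter_coe, List.append_nil,
    Multiset.map_coe, six2, six, neg_sub, e1]
  simp only [ne_eq, List.filter_cons, not_true_eq_false, decide_false, ha, h1, h2, h3, h4, h5,
    ha.symm, h1.symm, h2.symm, h3.symm, h4.symm, h5.symm, not_false_eq_true, decide_true, if_true,
    List.filter_nil, List.map_cons, List.map_nil, Bool.false_eq_true, if_false]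
  rw [Multiset.coe_eq_coe]
  rw [List.perm_iff_count]
  intro x
  simp only [List.count_cons, List.count_nil]
  ring

theorem ooc_of_list (v : ℕ) (bs : List (ZMod v × ZMod v × ZMod v))
    (h : (bs.flatMap six2).Nodup) :
    ∃ 𝓒 : Finset (Finset (ZMod v)), IsOOC v 𝓒 ∧ 𝓒.card = bs.length := by
  classical
  let φ : ZMod v × ZMod v × ZMod v → Finset (ZMod v) := fun b => {0, b.1, b.2.1, b.2.2}
  rw [List.nodup_flatMap] at h
  obtain ⟨h1, h2⟩ := h
  have hz : ∀ b ∈ bs, ∀ x ∈ six b, x ≠ 0 := by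
    intro b hb x hx h0
    have := h1 b hb
    unfold six2 at this
    rw [List.nodup_append] at this
    subst h0
    exact this.2.2 0 hx 0 (by simpa using hx) rfl
  have hd : ∀ b ∈ bs, b.1 ≠ 0 ∧ b.2.1 ≠ 0 ∧ b.2.2 ≠ 0 ∧ b.1 ≠ b.2.1 ∧ b.1 ≠ b.2.2 ∧ b.2.1 ≠ b.2.2 := by
    intro b hb
    have := hz b hb
    simp only [six, List.mem_cons, List.not_mem_nil, or_false, forall_eq_or_imp, forall_eq, sub_ne_zero] at this
    obtain ⟨a1, a2, a3, a4, a5, a6⟩ := this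
    exact ⟨a1, a2, a3, a4.symm, a5.symm, a6.symm⟩
  have hbd : ∀ b ∈ bs, blockDiffs (φ b) = ((six2 b : List (ZMod v)) : Multiset (ZMod v)) := by
    intro b hb
    obtain ⟨a1, a2, a3, a4, a5, a6⟩ := hd b hb
    have := blockDiffs_eq 0 b.1 b.2.1 b.2.2 a1.symm a2.symm a3.symm a4 a5 a6
    simpa using this
  have hnd : (bs.map φ).Nodup := by
    unfold List.Nodup
    rw [List.pairwise_map]
    refine List.Pairwise.imp_of_mem ?_ h2
    intro a b ha hb hdis heq
    have e : List.Perm (six2 a) (six2 b) := by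
      rw [← Multiset.coe_eq_coe, ← hbd a ha, ← hbd b hb, heq]
    have m : a.1 ∈ six2 a := by simp [six2, six]
    exact hdis m (e.mem_iff.1 m)
  refine ⟨⟨((bs.map φ : List (Finset (ZMod v))) : Multiset (Finset (ZMod v))), Multiset.coe_nodup.2 hnd⟩, ⟨?_, ?_⟩, by simp [Finset.card]⟩
  · intro B hB
    rw [Finset.mem_mk, Multiset.mem_coe, List.mem_map] at hB
    obtain ⟨b, hb, rfl⟩ := hB
    obtain ⟨a1, a2, a3, a4, a5, a6⟩ := hd b hb
    have : φ b = ⟨([0, b.1, b.2.1, b.2.2] : List (ZMod v)), by simp [*, Ne.symm]⟩ := by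
      ext x; simp [φ]
    rw [this]; simp
  · rw [← Multiset.nodup_iff_count_le_one]
    have : (((bs.map φ : List (Finset (ZMod v))) : Multiset (Finset (ZMod v))).bind blockDiffs) = ((bs.flatMap six2 : List (ZMod v)) : Multiset (ZMod v)) := by
      rw [← Multiset.coe_bind, ← Multiset.map_coe, Multiset.bind_map]
      exact Multiset.bind_congr (fun b hb => hbd b (by simpa using hb))
    show (((bs.map φ : List (Finset (ZMod v))) : Multiset (Finset (ZMod v))).bind blockDiffs).Nodup
    rw [this, Multiset.coe_nodup, List.nodup_flatMap]
    exact ⟨h1, h2⟩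

/-- perfect difference family of size `t` -/
def IsPDF (t : ℕ) (bs : List (ℤ × ℤ × ℤ)) : Prop :=
  bs.length = t ∧ ∀ d : ℤ, 1 ≤ d → d ≤ 6 * t → ∃ b ∈ bs, d ∈ six b

theorem ooc_of_pdf (t : ℕ) (bs : List (ℤ × ℤ × ℤ)) (h : IsPDF t bs) (v : ℕ) (hv : 12 * t + 1 ≤ v) :
    ∃ 𝓒 : Finset (Finset (ZMod v)), IsOOC v 𝓒 ∧ 𝓒.card = t := by
  obtain ⟨hl, hc⟩ := h
  let R : List ℤ := (List.range (6 * t)).map (fun i : ℕ => (i : ℤ) + 1)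
  have hRn : R.Nodup := by
    refine List.Nodup.map ?_ List.nodup_range
    intro a b hab; simpa using hab
  have hsub : R ⊆ bs.flatMap six := by
    intro d hd
    simp only [R, List.mem_map, List.mem_range] at hd
    obtain ⟨i, hi, rfl⟩ := hd
    obtain ⟨b, hb, hb2⟩ := hc (i + 1) (by omega) (by omega)
    exact List.mem_flatMap.2 ⟨b, hb, hb2⟩
  have hlen : (bs.flatMap six).length = 6 * t := by
    rw [List.length_flatMap]
    have : bs.map (fun a => (six a).length) = bs.map (fun _ => 6) := by simp [six]
    rw [this, List.map_const', List.sum_replicate, hl]; simp [mul_comm]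
  have hperm : List.Perm R (bs.flatMap six) :=
    (hRn.subperm hsub).perm_of_length_le (by rw [hlen]; simp [R])
  let ψ : ℤ × ℤ × ℤ → ZMod v × ZMod v × ZMod v := fun b => (b.1, b.2.1, b.2.2)
  have hψ : ∀ b, six (ψ b) = (six b).map (fun x : ℤ => (x : ZMod v)) := by
    intro b; simp [six, ψ]
  have := ooc_of_list v (bs.map ψ) ?_
  · simpa [hl] using this
  have e1 : List.Perm ((bs.map ψ).flatMap six2)
      ((R ++ R.map (fun x => -x)).map (fun x : ℤ => (x : ZMod v))) := by
    have e2 : (bs.map ψ).flatMap six2 = (bs.flatMap (fun b => six b ++ (six b).map (fun x => -x))).map (fun x : ℤ => (x : ZMod v)) := by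
      rw [List.flatMap_map, List.map_flatMap]
      congr 1; funext b
      simp [six2, hψ]
    rw [e2]
    refine List.Perm.map _ ?_
    refine (List.flatMap_append_perm bs six (fun b => (six b).map (fun x => -x))).symm.trans ?_
    refine List.Perm.append hperm.symm ?_
    rw [← List.map_flatMap]
    exact hperm.symm.map _
  rw [e1.nodup_iff]
  refine List.Nodup.map_on ?_ ?_
  · intro x hx y hy hxy
    have bd : ∀ x ∈ R ++ R.map (fun x => -x), -(6 * t : ℤ) ≤ x ∧ x ≤ 6 * t := by
      intro x hx
      simp only [R, List.mem_append, List.mem_map, List.mem_range] at hx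
      rcases hx with ⟨i, hi, rfl⟩ | ⟨_, ⟨i, hi, rfl⟩, rfl⟩ <;> omega
    have b1 := bd x hx
    have b2 := bd y hy
    rw [ZMod.intCast_eq_intCast_iff_dvd_sub] at hxy
    obtain ⟨k, hk⟩ := hxy
    have : k = 0 := by
      by_contra hk0
      rcases lt_or_gt_of_ne hk0 with h | h
      · nlinarith
      · nlinarith
    subst this
    simp at hk
    omega
  · rw [List.nodup_append]
    refine ⟨hRn, hRn.map neg_injective, ?_⟩
    intro a ha b hb hab
    simp only [R, List.mem_map, List.mem_range] at ha hb
    obtain ⟨i, hi, rfl⟩ := ha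
    obtain ⟨_, ⟨j, hj, rfl⟩, rfl⟩ := hb
    omega

abbrev Pt := ℤ × ℤ × ℤ
abbrev Fam := (Pt × Pt × Pt) × ℕ × ℕ
abbrev Seg := (ℤ × ℤ) × ℕ × ℕ

def ev (w i : ℤ) (p : Pt) : ℤ := p.1 * w + p.2.1 + p.2.2 * i

def blk (w i : ℤ) (f : Fam) : ℤ × ℤ × ℤ := (ev w i f.1.1, ev w i f.1.2.1, ev w i f.1.2.2)

def flen (w : ℕ) (f : Fam) : ℕ := f.2.1 * w + f.2.2

def fblocks (fs : List Fam) (w : ℕ) : List (ℤ × ℤ × ℤ) :=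
  fs.flatMap fun f => (List.range (flen w f)).map fun i : ℕ => blk w i f

theorem six_blk (w i : ℤ) (f : Fam) : six (blk w i f) = (six f.1).map (ev w i) := by
  simp [six, blk, ev]
  refine ⟨?_, ?_, ?_⟩ <;> ring

def segB (l : ℕ) (p : Pt) : ℤ := if p.2.2 < 0 then p.2.1 + p.2.2 * ((l : ℤ) - 1) else p.2.1

def segA (μ : ℕ) (p : Pt) : ℤ := if p.2.2 < 0 then p.1 + p.2.2 * (μ : ℤ) else p.1

def seg1 (ρ μ l s m : ℕ) (a b : ℤ) : List Seg :=
  (List.range m).map fun j : ℕ => ((6 * a, a * ρ + b + s * j), (s * μ, (μ * ρ + l + (m - 1 - j)) / m))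

def segs (ρ : ℕ) (f : Fam) : List Seg :=
  (six f.1).flatMap fun p =>
    match p.2.2.natAbs with
    | 1 => seg1 ρ f.2.1 f.2.2 1 6 (segA f.2.1 p) (segB f.2.2 p)
    | 2 => seg1 ρ f.2.1 f.2.2 2 3 (segA f.2.1 p) (segB f.2.2 p)
    | 3 => seg1 ρ f.2.1 f.2.2 3 2 (segA f.2.1 p) (segB f.2.2 p)
    | _ => []

/-- `d` is a difference of the family -/
def Cov (fs : List Fam) (w : ℕ) (d : ℤ) : Prop := ∃ b ∈ fblocks fs w, d ∈ six b

theorem cov_of {fs : List Fam} {w : ℕ} {f : Fam} (hf : f ∈ fs) {p : Pt} (hp : p ∈ six f.1)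
    {i : ℕ} (hi : i < flen w f) : Cov fs w (ev w i p) := by
  refine ⟨blk w i f, ?_, ?_⟩
  · exact List.mem_flatMap.2 ⟨f, hf, List.mem_map.2 ⟨i, List.mem_range.2 hi, rfl⟩⟩
  · rw [six_blk]; exact List.mem_map.2 ⟨p, hp, rfl⟩

theorem cov_low {fs : List Fam} {w : ℕ} {f : Fam} (hf : f ∈ fs) {p : Pt} (hp : p ∈ six f.1)
    {i : ℕ} (hi : i < flen w f) :
    Cov fs w (segA f.2.1 p * w + segB f.2.2 p + (p.2.2.natAbs : ℤ) * i) := by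
  by_cases hn : p.2.2 < 0
  · have h1 : flen w f - 1 - i < flen w f := by omega
    have := cov_of hf hp h1
    convert this using 1
    have e : ((flen w f - 1 - i : ℕ) : ℤ) = (f.2.1 : ℤ) * w + f.2.2 - 1 - i := by
      have : (flen w f : ℤ) = (f.2.1 : ℤ) * w + f.2.2 := by simp [flen]
      omega
    have e2 : (p.2.2.natAbs : ℤ) = - p.2.2 := by omega
    rw [ev, e, e2]
    simp only [segA, segB, if_pos hn]
    ring
  · have := cov_of hf hp hi
    convert this using 1
    have e2 : (p.2.2.natAbs : ℤ) = p.2.2 := by omega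
    simp only [segA, segB, if_neg hn, e2, ev]

theorem seg_cov {fs : List Fam} {q ρ : ℕ} {f : Fam} (hf : f ∈ fs) {s : Seg} (hs : s ∈ segs ρ f)
    {k : ℕ} (hk : k < s.2.1 * q + s.2.2) :
    Cov fs (6 * q + ρ) (s.1.1 * q + s.1.2 + 6 * k) := by
  unfold segs at hs
  rw [List.mem_flatMap] at hs
  obtain ⟨p, hp, hs⟩ := hs
  have key : ∀ n m : ℕ, n * m = 6 → p.2.2.natAbs = n →
      s ∈ seg1 ρ f.2.1 f.2.2 n m (segA f.2.1 p) (segB f.2.2 p) →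
      Cov fs (6 * q + ρ) (s.1.1 * q + s.1.2 + 6 * k) := by
    intro n m hnm hn hs
    unfold seg1 at hs
    rw [List.mem_map] at hs
    obtain ⟨j, hj, rfl⟩ := hs
    rw [List.mem_range] at hj
    simp only at hk ⊢
    have hlt : j + m * k < flen (6 * q + ρ) f := by
      unfold flen
      have hm : 0 < m := by omega
      have h2 := Nat.div_mul_le_self (f.2.1 * ρ + f.2.2 + (m - 1 - j)) m
      generalize (f.2.1 * ρ + f.2.2 + (m - 1 - j)) / m = c at *
      have h3 : m * (k + 1) ≤ m * (n * f.2.1 * q + c) := Nat.mul_le_mul_left m hk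
      have h4 : m * (n * f.2.1 * q + c) = 6 * (f.2.1 * q) + c * m := by
        rw [← hnm]; ring
      have h5 : f.2.1 * (6 * q + ρ) = 6 * (f.2.1 * q) + f.2.1 * ρ := by ring
      rw [h5]
      rw [h4, mul_add] at h3
      omega
    have := cov_low hf hp hlt
    convert this using 1
    rw [hn]
    have : (n : ℤ) * m = 6 := by exact_mod_cast hnm
    push_cast
    rw [← this]; ring_nf
  split at hs
  · exact key 1 6 rfl (by assumption) hs
  · exact key 2 3 rfl (by assumption) hs
  · exact key 3 2 rfl (by assumption) hs
  · simp at hs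

abbrev NSeg := (ℕ × ℕ) × ℕ × ℕ

def toN (s : Seg) : List NSeg :=
  match s.1.1, s.1.2, s.2.1 + s.2.2 with
  | Int.ofNat a, Int.ofNat b, Nat.succ _ => [((a, b), s.2)]
  | _, _, _ => []

theorem mem_toN {s : Seg} {n : NSeg} (h : n ∈ toN s) :
    s.1.1 = (n.1.1 : ℤ) ∧ s.1.2 = (n.1.2 : ℤ) ∧ s.2 = n.2 := by
  unfold toN at h
  split at h
  · rename_i a b _ h1 h2 _
    rw [List.mem_singleton] at h
    subst h
    exact ⟨h1, h2, rfl⟩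
  · simp at h

def look (a b : ℕ) : List NSeg → Option (ℕ × ℕ)
  | [] => none
  | s :: l => bif Nat.beq s.1.2 b then (bif Nat.beq s.1.1 a then some s.2 else look a b l) else look a b l

theorem look_sound (a b : ℕ) (l : List NSeg) (r : ℕ × ℕ) (h : look a b l = some r) :
    ((a, b), r) ∈ l := by
  induction l with
  | nil => simp [look] at h
  | cons s l ih =>
    unfold look at h
    cases h1 : Nat.beq s.1.2 b with
    | false =>
      rw [h1, cond_false] at h
      exact List.mem_cons_of_mem _ (ih h)
    | true =>
      rw [h1, cond_true] at h
      cases h2 : Nat.beq s.1.1 a with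
      | false =>
        rw [h2, cond_false] at h
        exact List.mem_cons_of_mem _ (ih h)
      | true =>
        rw [h2, cond_true] at h
        have e1 := Nat.eq_of_beq_eq_true h1
        have e2 := Nat.eq_of_beq_eq_true h2
        have e3 := Option.some.inj h
        subst e1; subst e2; subst e3
        exact List.mem_cons_self

def walk (sg : List NSeg) (A B : ℕ) : ℕ → ℕ → ℕ → Bool
  | 0, a, b => Nat.beq b B && Nat.beq a A
  | n + 1, a, b =>
    (Nat.beq b B && Nat.beq a A) ||
    match look a b sg with
    | none => false
    | some s => walk sg A B n (a + 6 * s.1) (b + 6 * s.2)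

theorem walk_sound (P : ℤ → Prop) (q : ℕ) (sg : List NSeg)
    (hP : ∀ s ∈ sg, ∀ k : ℕ, k < s.2.1 * q + s.2.2 → P ((s.1.1 * q + s.1.2 + 6 * k : ℕ) : ℤ)) (A B : ℕ) :
    ∀ (n a b : ℕ), walk sg A B n a b = true →
      ∀ k : ℕ, a * q + b + 6 * k < A * q + B → P ((a * q + b + 6 * k : ℕ) : ℤ) := by
  intro n
  induction n with
  | zero =>
    intro a b h k hk
    simp only [walk, Bool.and_eq_true, Nat.beq_eq] at h
    rw [h.1, h.2] at hk; omega
  | succ n ih =>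
    intro a b h k hk
    simp only [walk, Bool.and_eq_true, Nat.beq_eq, Bool.or_eq_true] at h
    rcases h with h | h
    · rw [h.1, h.2] at hk; omega
    · split at h
      · simp at h
      · rename_i s hs
        have hm := look_sound _ _ _ _ hs
        by_cases hlt : k < s.1 * q + s.2
        · exact hP _ hm k hlt
        · have e1 : a * q + b + 6 * k =
            (a + 6 * s.1) * q + (b + 6 * s.2) + 6 * (k - (s.1 * q + s.2)) := by
            have e2 : (a + 6 * s.1) * q = a * q + 6 * (s.1 * q) := by ring
            omega
          rw [e1] at hk ⊢
          exact ih _ _ h _ hk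

def nsegs (fs : List Fam) (ρ : ℕ) : List NSeg := fs.flatMap fun f => (segs ρ f).flatMap toN

def rsegs (r : ℕ) : List NSeg → List NSeg
  | [] => []
  | s :: l => bif Nat.beq (s.1.2 % 6) r then s :: rsegs r l else rsegs r l

theorem rsegs_sub (r : ℕ) (l : List NSeg) (s : NSeg) (h : s ∈ rsegs r l) : s ∈ l := by
  induction l with
  | nil => simp [rsegs] at h
  | cons a l ih =>
    unfold rsegs at h
    cases h1 : Nat.beq (a.1.2 % 6) r with
    | false => rw [h1, cond_false] at h; exact List.mem_cons_of_mem _ (ih h)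
    | true =>
      rw [h1, cond_true] at h
      rcases List.mem_cons.1 h with h | h
      · rw [h]; exact List.mem_cons_self
      · exact List.mem_cons_of_mem _ (ih h)

def chk1 (fs : List Fam) (τ ρ : ℕ) : Bool :=
  (List.range 6).all fun r =>
    walk (rsegs ((r + 1) % 6) (nsegs fs ρ)) 216 (36 * ρ + 6 * τ + 1 + r) 100 0 (1 + r)

def chk (fs : List Fam) (τ : ℕ) : Bool :=
  (fs.map fun f => f.2.1).sum == 6 && (fs.map fun f => f.2.2).sum == τ &&
    (List.range 6).all (chk1 fs τ)

theorem fblocks_length (fs : List Fam) (w : ℕ) : (fblocks fs w).length =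
    (fs.map fun f => f.2.1).sum * w + (fs.map fun f => f.2.2).sum := by
  induction fs with
  | nil => simp [fblocks]
  | cons f fs ih =>
    have : fblocks (f :: fs) w = (List.range (flen w f)).map (fun i : ℕ => blk w i f) ++ fblocks fs w := by
      simp [fblocks]
    rw [this, List.length_append, ih]
    simp [flen]; ring

theorem pdf_of_chk (fs : List Fam) (τ : ℕ) (h : chk fs τ = true) (w : ℕ) :
    ∃ bs, IsPDF (6 * w + τ) bs := by
  simp only [chk, Bool.and_eq_true, beq_iff_eq, List.all_eq_true, List.mem_range] at h
  obtain ⟨⟨h1, h2⟩, h3⟩ := h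
  refine ⟨fblocks fs w, ?_, ?_⟩
  · rw [fblocks_length, h1, h2]
  · intro d hd1 hd2
    have hρ := h3 (w % 6) (Nat.mod_lt _ (by norm_num))
    simp only [chk1, List.all_eq_true, List.mem_range] at hρ
    have hr := hρ ((d - 1) % 6).toNat (by omega)
    set r := ((d - 1) % 6).toNat with hrdef
    have hw : w = 6 * (w / 6) + w % 6 := by omega
    have := walk_sound (fun d => Cov fs w d) (w / 6) _ ?_ _ _ _ _ _ hr ((d - 1) / 6).toNat ?_
    · have e : ((0 * (w / 6) + (1 + r) + 6 * ((d - 1) / 6).toNat : ℕ) : ℤ) = d := by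
        omega
      rwa [e] at this
    · intro s hs k hk
      obtain ⟨f, hf, hsf⟩ := List.mem_flatMap.1 (rsegs_sub _ _ _ hs)
      obtain ⟨s', hs', hss⟩ := List.mem_flatMap.1 hsf
      obtain ⟨e1, e2, e3⟩ := mem_toN hss
      have := seg_cov (k := k) (q := w / 6) hf hs' (by rw [e3]; exact hk)
      rw [← hw, e1, e2] at this
      exact_mod_cast this
    · omega

/-! ### Nonexistence for `v = 25` -/

theorem blockDiffs_rep {G : Type*} [AddCommGroup G] [DecidableEq G] (F : Finset G) (hF : F.card = 4)
    (d : G) (hd : d ∈ blockDiffs F) : ∃ x y : G, blockDiffs F = ((six2 (d, x, y) : List G) : Multiset G) := by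
  unfold blockDiffs at hd
  rw [Multiset.mem_map] at hd
  obtain ⟨⟨q, p⟩, h, rfl⟩ := hd
  have h' : (q, p) ∈ (F ×ˢ F).filter fun p => p.1 ≠ p.2 := h
  rw [Finset.mem_filter, Finset.mem_product] at h'
  obtain ⟨⟨hq, hp⟩, hne⟩ := h'
  simp only at hq hp hne ⊢
  have hc : ((F.erase p).erase q).card = 2 := by
    rw [Finset.card_erase_of_mem (Finset.mem_erase.2 ⟨hne, hq⟩), Finset.card_erase_of_mem hp, hF]
  obtain ⟨a, b, hab, he⟩ := Finset.card_eq_two.1 hc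
  have ha : a ∈ (F.erase p).erase q := by rw [he]; simp
  have hb : b ∈ (F.erase p).erase q := by rw [he]; simp
  simp only [Finset.mem_erase] at ha hb
  have hFe : F = {p, q, a, b} := by
    rw [← he, Finset.insert_erase (Finset.mem_erase.2 ⟨hne, hq⟩), Finset.insert_erase hp]
  refine ⟨a - p, b - p, ?_⟩
  rw [hFe]
  exact blockDiffs_eq p q a b hne.symm ha.2.1.symm hb.2.1.symm ha.1.symm hb.1.symm hab

theorem zero_not_mem_blockDiffs {G : Type*} [AddCommGroup G] [DecidableEq G] (F : Finset G) :
    (0 : G) ∉ blockDiffs F := by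
  intro h
  unfold blockDiffs at h
  rw [Multiset.mem_map] at h
  obtain ⟨⟨q, p⟩, h, h0⟩ := h
  have h' : (q, p) ∈ (F ×ˢ F).filter fun p => p.1 ≠ p.2 := h
  rw [Finset.mem_filter] at h'
  exact h'.2 (sub_eq_zero.1 h0)

def sb (a b : ℕ) : ℕ := (a + (25 - b)) % 25

def sixN (a b c : ℕ) : List ℕ := [a, b, c, sb b a, sb c a, sb c b]

def six2N (a b c : ℕ) : List ℕ := sixN a b c ++ (sixN a b c).map (fun x => sb 0 x)

theorem val_sb (a b : ZMod 25) : (a - b).val = sb a.val b.val := by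
  have hb := ZMod.val_lt b
  have : a - b = ((a.val + (25 - b.val) : ℕ) : ZMod 25) := by
    rw [Nat.cast_add, Nat.cast_sub hb.le, ZMod.natCast_zmod_val, ZMod.natCast_zmod_val]
    have : ((25 : ℕ) : ZMod 25) = 0 := by decide
    rw [this]; ring
  rw [this, ZMod.val_natCast, sb]

theorem val_six2 (a b c : ZMod 25) : (six2 (a, b, c)).map ZMod.val = six2N a.val b.val c.val := by
  have h0 : ∀ x : ZMod 25, (-x).val = sb 0 x.val := by
    intro x
    rw [← zero_sub, val_sb, ZMod.val_zero]
  simp only [six2, six, six2N, sixN, List.map_append, List.map_cons, List.map_nil, h0, val_sb]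

def ndp : List ℕ → Bool
  | [] => true
  | a :: l => !l.elem a && ndp l

theorem ndp_iff (l : List ℕ) : ndp l = true ↔ l.Nodup := by
  induction l with
  | nil => simp [ndp]
  | cons a l ih => simp [ndp, ih]

def rest25 (l : List ℕ) : List ℕ :=
  (List.range 25).filter fun z => !(z == 0) && !l.elem z

def chk25 (x y : ℕ) : Bool :=
  let l := six2N 1 x y
  !ndp l ||
    (let r := rest25 l
     match r with
     | [] => false
     | d :: _ => r.all fun x' => !r.elem (sb x' d) || r.all fun y' =>
        !r.elem (sb y' d) || !r.elem (sb y' x') || !ndp (six2N d x' y'))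

set_option maxRecDepth 100000 in
theorem chk25_all : ((List.range 25).all fun x => (List.range 25).all fun y => chk25 x y) = true := by
  decide +kernel

theorem no25_aux (B₁ B₂ : Finset (ZMod 25)) (h1 : B₁.card = 4) (h2 : B₂.card = 4)
    (hn : (blockDiffs B₁ + blockDiffs B₂).Nodup) (h : (1 : ZMod 25) ∈ blockDiffs B₁)
    (hc : ∀ x : ZMod 25, x ≠ 0 → x ∈ blockDiffs B₁ ∨ x ∈ blockDiffs B₂) : False := by
  obtain ⟨x, y, he⟩ := blockDiffs_rep B₁ h1 1 h
  have hk := List.all_eq_true.1 (List.all_eq_true.1 chk25_all x.val (List.mem_range.2 (ZMod.val_lt x)))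
    y.val (List.mem_range.2 (ZMod.val_lt y))
  rw [Multiset.nodup_add] at hn
  obtain ⟨n1, n2, hdis⟩ := hn
  have z2 := zero_not_mem_blockDiffs B₂
  rw [he] at n1 hdis hc
  rw [Multiset.coe_nodup] at n1
  have nd : ∀ a b c : ZMod 25, (six2 (a, b, c)).Nodup → ndp (six2N a.val b.val c.val) = true := by
    intro a b c h
    rw [ndp_iff, ← val_six2]
    exact h.map (ZMod.val_injective 25)
  have hone : (1 : ZMod 25).val = 1 := rfl
  have n1' := nd 1 x y n1
  rw [hone] at n1'
  unfold chk25 at hk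
  simp only [n1', Bool.not_true, Bool.false_or] at hk
  have hr : ∀ z : ZMod 25, z.val ∈ rest25 (six2N 1 x.val y.val) ↔ z ≠ 0 ∧ z ∉ six2 (1, x, y) := by
    intro z
    unfold rest25
    rw [List.mem_filter, List.mem_range]
    have e1 : z.val ∈ six2N 1 x.val y.val ↔ z ∈ six2 (1, x, y) := by
      rw [← hone, ← val_six2]
      exact List.mem_map_of_injective (ZMod.val_injective 25)
    have e2 : z.val = 0 ↔ z = 0 := ZMod.val_eq_zero z
    have e3 := ZMod.val_lt z
    simp [e1, e2, e3]
  have hr2 : ∀ z : ZMod 25, z ∈ blockDiffs B₂ → z.val ∈ rest25 (six2N 1 x.val y.val) := by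
    intro z hz
    rw [hr]
    refine ⟨fun h0 => z2 (h0 ▸ hz), fun hz2 => ?_⟩
    exact Multiset.disjoint_left.1 hdis (Multiset.mem_coe.2 hz2) hz
  split at hk
  · exact absurd hk (by simp)
  · rename_i d' tl hd
    have hdm : d' ∈ rest25 (six2N 1 x.val y.val) := by rw [hd]; simp
    obtain ⟨d, rfl⟩ : ∃ d : ZMod 25, d.val = d' := by
      have : d' < 25 := List.mem_range.1 (List.mem_filter.1 hdm).1
      exact ⟨(d' : ZMod 25), ZMod.val_cast_of_lt this⟩
    have hd2 := (hr d).1 hdm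
    have hdB : d ∈ blockDiffs B₂ := by
      rcases hc d hd2.1 with h | h
      · exact absurd (Multiset.mem_coe.1 h) hd2.2
      · exact h
    obtain ⟨x', y', he2⟩ := blockDiffs_rep B₂ h2 d hdB
    rw [he2] at n2 hr2
    rw [Multiset.coe_nodup] at n2
    have n2' := nd d x' y' n2
    have m1 := hr2 x' (by simp [six2, six])
    have m2 := hr2 y' (by simp [six2, six])
    have m3 := hr2 (x' - d) (by simp [six2, six])
    have m4 := hr2 (y' - d) (by simp [six2, six])
    have m5 := hr2 (y' - x') (by simp [six2, six])
    rw [val_sb] at m3 m4 m5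
    have q1 := List.all_eq_true.1 hk _ m1
    simp only [List.elem_eq_true_of_mem m3, Bool.not_true, Bool.false_or] at q1
    have q2 := List.all_eq_true.1 q1 _ m2
    simp only [List.elem_eq_true_of_mem m4, List.elem_eq_true_of_mem m5, n2', Bool.not_true, Bool.or_self] at q2
    exact absurd q2 (by simp)

theorem no25 : ¬ ∃ 𝓒 : Finset (Finset (ZMod 25)), IsOOC 25 𝓒 ∧ 𝓒.card = 2 := by
  rintro ⟨𝓒, ⟨h4, hd⟩, hc⟩
  obtain ⟨B₁, B₂, hne, rfl⟩ := Finset.card_eq_two.1 hc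
  rw [← Multiset.nodup_iff_count_le_one] at hd
  have hv : ({B₁, B₂} : Finset (Finset (ZMod 25))).val = B₁ ::ₘ B₂ ::ₘ 0 := by
    rw [Finset.insert_val_of_notMem (by simpa using hne)]; rfl
  rw [hv] at hd
  simp only [Multiset.cons_bind, Multiset.zero_bind, add_zero] at hd
  have c1 := h4 B₁ (by simp)
  have c2 := h4 B₂ (by simp)
  have card12 : ∀ B : Finset (ZMod 25), B.card = 4 → (blockDiffs B).card = 12 := by
    intro B hB
    obtain ⟨p, hp, q, hq, hpq⟩ := Finset.one_lt_card.1 (by omega : 1 < B.card)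
    obtain ⟨x, y, he⟩ := blockDiffs_rep B hB (p - q) (by
      unfold blockDiffs
      rw [Multiset.mem_map]
      exact ⟨(p, q), (Finset.mem_filter.2 ⟨Finset.mem_product.2 ⟨hp, hq⟩, hpq⟩ : (p, q) ∈ (B ×ˢ B).filter fun p => p.1 ≠ p.2), rfl⟩)
    rw [he]; rfl
  have hcov : ∀ x : ZMod 25, x ≠ 0 → x ∈ blockDiffs B₁ ∨ x ∈ blockDiffs B₂ := by
    let D : Finset (ZMod 25) := ⟨blockDiffs B₁ + blockDiffs B₂, hd⟩
    have hD : D.card = 24 := by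
      simp only [D, Finset.card_mk, Multiset.card_add, card12 _ c1, card12 _ c2]
    have hsub : D ⊆ Finset.univ.erase 0 := by
      intro z hz
      rw [Finset.mem_erase]
      refine ⟨?_, Finset.mem_univ _⟩
      rintro rfl
      rcases Multiset.mem_add.1 (Finset.mem_mk.1 hz) with h | h
      · exact zero_not_mem_blockDiffs _ h
      · exact zero_not_mem_blockDiffs _ h
    have heq : D = Finset.univ.erase 0 := by
      refine Finset.eq_of_subset_of_card_le hsub ?_
      rw [hD, Finset.card_erase_of_mem (Finset.mem_univ _), Finset.card_univ, ZMod.card]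
    intro x hx
    have : x ∈ D := by rw [heq]; simp [hx]
    exact Multiset.mem_add.1 (Finset.mem_mk.1 this)
  rcases hcov 1 (by decide) with h | h
  · exact no25_aux B₁ B₂ c1 c2 hd h hcov
  · exact no25_aux B₂ B₁ c2 c1 (by rwa [add_comm]) h (fun x hx => (hcov x hx).symm)

/-! ### Small perfect difference families -/

def pchk (bs : List (ℤ × ℤ × ℤ)) : Bool :=
  let l := bs.flatMap six
  (List.range (6 * bs.length)).all fun i : ℕ => l.elem ((i : ℤ) + 1)

theorem pdf_of_pchk (bs : List (ℤ × ℤ × ℤ)) (h : pchk bs = true) : IsPDF bs.length bs := by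
  refine ⟨rfl, ?_⟩
  intro d h1 h2
  simp only [pchk, List.all_eq_true, List.mem_range] at h
  have := List.mem_of_elem_eq_true (h (d - 1).toNat (by omega))
  have e : (((d - 1).toNat : ℕ) : ℤ) + 1 = d := by omega
  rw [e] at this
  exact List.mem_flatMap.1 this

set_option maxRecDepth 100000 in
theorem pdf_small (t : ℕ) (h : t ≤ 17) (h0 : t ≠ 0) (h2 : t ≠ 2) (h3 : t ≠ 3) : ∃ bs, IsPDF t bs := by
  have aux : ∀ bs : List (ℤ × ℤ × ℤ), pchk bs = true → bs.length = t → ∃ bs, IsPDF t bs := by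
    intro bs hb e
    subst e
    exact ⟨bs, pdf_of_pchk bs hb⟩
  interval_cases t
  · omega
  · exact aux [(1, 4, 6)]
      (by decide +kernel) rfl
  · omega
  · omega
  · exact aux [(1, 17, 23), (2, 14, 21), (3, 8, 18), (4, 13, 24)]
      (by decide +kernel) rfl
  · exact aux [(1, 19, 30), (3, 23, 28), (4, 16, 26), (6, 14, 27), (7, 9, 24)]
      (by decide +kernel) rfl
  · exact aux [(2, 18, 32), (3, 28, 34), (4, 5, 26), (7, 17, 36), (8, 23, 35), (9, 20, 33)]
      (by decide +kernel) rfl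
  · exact aux [(1, 22, 27), (3, 31, 40), (4, 36, 42), (7, 30, 41), (8, 20, 33), (10, 24, 39), (16, 18, 35)]
      (by decide +kernel) rfl
  · exact aux [(1, 4, 41), (2, 18, 46), (5, 30, 36), (7, 24, 45), (8, 35, 47), (9, 29, 43), (10, 23, 42), (15, 26, 48)]
      (by decide +kernel) rfl
  · exact aux [(1, 35, 47), (2, 26, 53), (3, 25, 42), (4, 14, 45), (5, 18, 37), (6, 21, 54), (7, 30, 50), (8, 36, 52), (9, 38, 49)]
      (by decide +kernel) rfl
  · exact aux [(2, 33, 60), (6, 24, 59), (1, 51, 56), (13, 38, 52), (7, 43, 54), (8, 30, 40), (15, 34, 57), (3, 44, 48), (12, 28, 49), (17, 26, 46)]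
      (by decide +kernel) rfl
  · exact aux [(31, 32, 66), (8, 28, 64), (7, 50, 61), (10, 39, 58), (3, 27, 52), (6, 53, 65), (5, 18, 62), (4, 30, 45), (17, 33, 55), (21, 23, 63), (9, 46, 60)]
      (by decide +kernel) rfl
  · exact aux [(2, 45, 72), (9, 25, 71), (6, 13, 66), (19, 37, 63), (12, 32, 67), (10, 34, 49), (1, 52, 57), (11, 42, 59), (3, 41, 64), (14, 47, 68), (4, 40, 69), (8, 30, 58)]
      (by decide +kernel) rfl
  · exact aux [(15, 33, 78), (1, 11, 76), (12, 50, 72), (26, 49, 77), (13, 17, 74), (3, 44, 58), (31, 36, 70), (7, 54, 73), (16, 48, 68), (9, 46, 71), (6, 30, 59), (2, 42, 69), (8, 43, 64)]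
      (by decide +kernel) rfl
  · exact aux [(12, 36, 84), (16, 57, 83), (1, 18, 80), (29, 35, 82), (7, 50, 81), (9, 32, 77), (3, 64, 78), (11, 49, 70), (13, 28, 65), (10, 40, 73), (8, 27, 66), (4, 55, 60), (2, 46, 71), (22, 42, 76)]
      (by decide +kernel) rfl
  · exact aux [(11, 52, 90), (15, 58, 88), (14, 42, 89), (10, 56, 87), (16, 18, 81), (20, 59, 82), (1, 61, 85), (6, 55, 74), (22, 57, 86), (3, 51, 72), (5, 76, 83), (13, 17, 67), (27, 36, 80), (26, 34, 66), (25, 37, 70)]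
      (by decide +kernel) rfl
  · exact aux [(28, 61, 96), (3, 56, 95), (1, 20, 90), (23, 37, 94), (4, 69, 86), (13, 72, 87), (22, 46, 80), (9, 54, 64), (7, 51, 83), (5, 36, 84), (16, 18, 78), (6, 49, 91), (8, 29, 81), (12, 50, 75), (11, 41, 88), (26, 66, 93)]
      (by decide +kernel) rfl
  · exact aux [(38, 43, 102), (7, 30, 100), (14, 39, 101), (21, 36, 99), (8, 74, 96), (29, 56, 90), (9, 86, 98), (2, 35, 82), (11, 52, 94), (46, 49, 97), (13, 44, 84), (6, 60, 79), (20, 24, 92), (28, 45, 95), (1, 58, 76), (16, 53, 85), (10, 65, 91)]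
      (by decide +kernel) rfl

/-! ### Infinite families -/

def fam0 : List Fam := [
  (((0, 4, 3), (11, 36, 2), (29, 87, 1)), 1, 0),
  (((7, 19, -1), (14, 46, 2), (34, 103, 1)), 1, 0),
  (((0, 3, 3), (14, 45, 2), (33, 99, 1)), 1, 2),
  (((4, 10, -1), (11, 33, 2), (35, 105, 1)), 1, 1),
  (((0, 2, 3), (21, 65, 2), (26, 80, 1)), 1, 0),
  (((7, 25, 3), (24, 75, 2), (30, 91, 1)), 1, 0),
  (((3, 2, 1), (23, 65, 2), (27, 80, 3)), 0, 1),
  (((10, 26, 1), (20, 58, 2), (34, 102, 3)), 0, 1),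
  (((5, 16, 1), (21, 66, 2), (31, 91, 3)), 0, 1),
  (((4, 11, 1), (17, 51, 2), (35, 103, 3)), 0, 1),
  (((3, 4, 1), (3, 5, 2), (30, 87, 3)), 0, 1),
  (((6, 18, 1), (29, 85, 2), (35, 104, 3)), 0, 1),
  (((3, 7, 1), (7, 21, 2), (27, 81, 3)), 0, 1),
  (((3, 8, 1), (13, 37, 2), (34, 101, 3)), 0, 1),
  (((3, 9, 1), (13, 36, 2), (33, 97, 3)), 0, 1),
  (((7, 22, 1), (23, 71, 2), (36, 106, 3)), 0, 1),
  (((6, 17, 1), (19, 56, 2), (30, 90, 3)), 0, 1),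
  (((4, 12, 1), (23, 69, 2), (30, 89, 3)), 0, 1),
  (((10, 30, 1), (14, 43, 2), (33, 98, 3)), 0, 1),
  (((13, 38, 1), (20, 62, 2), (36, 108, 3)), 0, 1),
  (((10, 28, 1), (20, 59, 2), (36, 107, 3)), 0, 1)]

set_option maxRecDepth 100000 in
theorem fam0_ok : chk fam0 18 = true := by decide +kernel

def fam1 : List Fam := [
  (((0, 2, 3), (11, 36, 2), (29, 93, 1)), 1, 1),
  (((7, 20, -1), (14, 47, 2), (34, 110, 1)), 1, 1),
  (((0, 3, 3), (14, 46, 2), (33, 105, 1)), 1, 1),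
  (((4, 12, -1), (11, 37, 2), (35, 113, 1)), 1, 1),
  (((0, 4, 3), (21, 70, 2), (26, 84, 1)), 1, 0),
  (((7, 26, 3), (24, 79, 2), (30, 97, 1)), 1, 0),
  (((5, 18, 1), (21, 71, 2), (31, 97, 3)), 0, 1),
  (((7, 24, 1), (10, 28, 2), (34, 108, 3)), 0, 1),
  (((10, 33, 1), (13, 38, 2), (33, 103, 3)), 0, 1),
  (((3, 7, 1), (23, 73, 2), (30, 96, 3)), 0, 1),
  (((3, 6, 1), (16, 48, 2), (34, 106, 3)), 0, 1),
  (((4, 14, 1), (27, 88, 2), (34, 109, 3)), 0, 1),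
  (((3, 8, 1), (23, 72, 2), (26, 83, 3)), 0, 1),
  (((5, 15, 1), (26, 82, 2), (36, 114, 3)), 0, 1),
  (((6, 19, 1), (16, 49, 2), (35, 111, 3)), 0, 1),
  (((4, 13, 1), (21, 68, 2), (34, 107, 3)), 0, 1),
  (((3, 9, 1), (10, 31, 2), (27, 87, 3)), 0, 1),
  (((5, 17, 1), (21, 69, 2), (31, 98, 3)), 0, 1),
  (((14, 44, 1), (17, 54, 2), (33, 104, 3)), 0, 1),
  (((0, 1, 1), (13, 41, 2), (27, 86, 3)), 0, 1),
  (((11, 35, 1), (16, 51, 2), (35, 112, 3)), 0, 1)]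

set_option maxRecDepth 100000 in
theorem fam1_ok : chk fam1 19 = true := by decide +kernel

def fam2 : List Fam := [
  (((0, 4, 3), (11, 39, 2), (29, 96, 1)), 1, 0),
  (((7, 22, -1), (14, 51, 2), (34, 115, 1)), 1, 0),
  (((0, 2, 3), (14, 48, 2), (33, 110, 1)), 1, 1),
  (((4, 11, -1), (11, 38, 2), (35, 116, 1)), 1, 1),
  (((0, 3, 3), (21, 73, 2), (26, 87, 1)), 1, 0),
  (((7, 25, 3), (24, 81, 2), (30, 99, 1)), 1, 2),
  (((7, 26, 1), (10, 29, 2), (34, 113, 3)), 0, 1),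
  (((3, 4, 1), (13, 39, 2), (30, 96, 3)), 0, 1),
  (((3, 5, 1), (23, 75, 2), (34, 111, 3)), 0, 1),
  (((4, 12, 1), (31, 101, 2), (35, 115, 3)), 0, 1),
  (((10, 34, 1), (20, 65, 2), (34, 114, 3)), 0, 1),
  (((3, 6, 1), (27, 88, 2), (30, 97, 3)), 0, 1),
  (((4, 13, 1), (23, 77, 2), (33, 107, 3)), 0, 1),
  (((3, 8, 1), (24, 79, 2), (30, 98, 3)), 0, 1),
  (((16, 51, 1), (16, 52, 2), (34, 112, 3)), 0, 1),
  (((5, 16, 1), (16, 53, 2), (36, 120, 3)), 0, 1),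
  (((3, 7, 1), (23, 73, 2), (29, 93, 3)), 0, 1),
  (((10, 33, 1), (23, 76, 2), (36, 118, 3)), 0, 1),
  (((5, 15, 1), (18, 59, 2), (36, 117, 3)), 0, 1),
  (((10, 32, 1), (16, 54, 2), (29, 95, 3)), 0, 1),
  (((6, 21, 1), (13, 45, 2), (20, 68, 3)), 0, 1),
  (((3, 10, 1), (16, 50, 2), (36, 119, 3)), 0, 1)]

set_option maxRecDepth 100000 in
theorem fam2_ok : chk fam2 20 = true := by decide +kernel

def fam3 : List Fam := [
  (((0, 2, 3), (25, 89, 1), (30, 107, 2)), 1, 2),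
  (((0, 3, 3), (9, 33, 2), (32, 113, 1)), 1, 1),
  (((4, 12, -1), (19, 70, 2), (27, 96, 1)), 1, 0),
  (((11, 41, 2), (15, 57, 3), (26, 93, 1)), 1, 1),
  (((15, 56, 3), (28, 100, 1), (34, 122, 2)), 1, 1),
  (((0, 4, 3), (21, 75, 1), (34, 121, 2)), 1, 1),
  (((18, 58, 1), (18, 59, 2), (36, 123, 3)), 0, 1),
  (((11, 42, 1), (14, 48, 2), (29, 103, 3)), 0, 1),
  (((3, 8, 1), (22, 77, 2), (33, 116, 3)), 0, 1),
  (((3, 7, 1), (18, 60, 2), (25, 86, 3)), 0, 1),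
  (((9, 34, 1), (23, 83, 2), (34, 118, 3)), 0, 1),
  (((8, 27, 1), (21, 70, 2), (36, 124, 3)), 0, 1),
  (((7, 24, 1), (28, 96, 2), (36, 125, 3)), 0, 1),
  (((3, 12, 1), (30, 106, 2), (36, 126, 3)), 0, 1),
  (((5, 17, 1), (19, 68, 2), (33, 115, 3)), 0, 1),
  (((3, 10, 1), (14, 50, 2), (32, 112, 3)), 0, 1),
  (((7, 23, 1), (11, 38, 2), (32, 111, 3)), 0, 1),
  (((8, 28, 1), (11, 37, 2), (34, 119, 3)), 0, 1),
  (((4, 13, 1), (13, 45, 2), (22, 76, 3)), 0, 1),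
  (((6, 21, 1), (27, 95, 2), (34, 120, 3)), 0, 1),
  (((3, 11, 1), (22, 78, 2), (26, 92, 3)), 0, 1)]

set_option maxRecDepth 100000 in
theorem fam3_ok : chk fam3 21 = true := by decide +kernel

def fam4 : List Fam := [
  (((0, 2, 3), (25, 92, 1), (30, 110, 2)), 1, 2),
  (((0, 3, 3), (9, 34, 2), (32, 116, 1)), 1, 1),
  (((4, 13, -1), (19, 74, 2), (27, 100, 1)), 1, 0),
  (((11, 43, 2), (15, 59, 3), (26, 96, 1)), 1, 1),
  (((15, 57, 3), (28, 103, 1), (34, 126, 2)), 1, 1),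
  (((0, 4, 3), (21, 77, 1), (34, 125, 2)), 1, 1),
  (((7, 24, 1), (18, 60, 2), (36, 128, 3)), 0, 1),
  (((11, 44, 1), (14, 50, 2), (36, 131, 3)), 0, 1),
  (((3, 8, 1), (18, 66, 2), (36, 127, 3)), 0, 1),
  (((3, 7, 1), (14, 49, 2), (22, 79, 3)), 0, 1),
  (((9, 35, 1), (23, 86, 2), (34, 124, 3)), 0, 1),
  (((13, 45, 1), (22, 78, 2), (36, 130, 3)), 0, 1),
  (((0, 1, 1), (18, 63, 2), (33, 118, 3)), 0, 1),
  (((3, 13, 1), (11, 40, 2), (30, 111, 3)), 0, 1),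
  (((3, 10, 1), (21, 74, 2), (32, 115, 3)), 0, 1),
  (((6, 21, 1), (25, 91, 2), (33, 120, 3)), 0, 1),
  (((6, 20, 1), (28, 100, 2), (34, 122, 3)), 0, 1),
  (((4, 15, 1), (9, 32, 2), (36, 129, 3)), 0, 1),
  (((3, 11, 1), (26, 94, 2), (29, 106, 3)), 0, 1),
  (((7, 26, 1), (15, 54, 2), (28, 101, 3)), 0, 1),
  (((15, 56, 1), (18, 65, 2), (36, 132, 3)), 0, 1),
  (((4, 14, 1), (11, 39, 2), (34, 123, 3)), 0, 1)]

set_option maxRecDepth 100000 in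
theorem fam4_ok : chk fam4 22 = true := by decide +kernel

def fam5 : List Fam := [
  (((0, 4, 3), (11, 45, 2), (29, 112, 1)), 1, 1),
  (((7, 24, -1), (14, 58, 2), (34, 133, 1)), 1, 1),
  (((0, 3, 3), (14, 55, 2), (33, 126, 1)), 1, 2),
  (((4, 14, -1), (11, 46, 2), (35, 136, 1)), 1, 1),
  (((0, 2, 3), (21, 82, 2), (26, 100, 1)), 1, 1),
  (((7, 30, 3), (24, 95, 2), (30, 117, 1)), 1, 1),
  (((3, 5, 1), (10, 36, 2), (23, 84, 3)), 0, 1),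
  (((3, 8, 1), (10, 33, 2), (26, 97, 3)), 0, 1),
  (((3, 9, 1), (24, 94, 2), (34, 129, 3)), 0, 1),
  (((3, 7, 1), (13, 47, 2), (27, 103, 3)), 0, 1),
  (((0, 1, 1), (7, 29, 2), (27, 107, 3)), 0, 1),
  (((3, 10, 1), (27, 101, 2), (33, 124, 3)), 0, 1),
  (((5, 21, 1), (21, 83, 2), (34, 132, 3)), 0, 1),
  (((10, 38, 1), (20, 77, 2), (36, 137, 3)), 0, 1),
  (((4, 15, 1), (23, 88, 2), (33, 125, 3)), 0, 1),
  (((5, 19, 1), (19, 72, 2), (36, 138, 3)), 0, 1),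
  (((4, 17, 1), (11, 44, 2), (34, 130, 3)), 0, 1),
  (((7, 26, 1), (18, 69, 2), (34, 128, 3)), 0, 1),
  (((4, 16, 1), (24, 92, 2), (35, 134, 3)), 0, 1),
  (((3, 11, 1), (27, 104, 2), (30, 116, 3)), 0, 1),
  (((13, 50, 1), (16, 63, 2), (34, 131, 3)), 0, 1),
  (((5, 20, 1), (19, 74, 2), (35, 135, 3)), 0, 1)]

set_option maxRecDepth 100000 in
theorem fam5_ok : chk fam5 23 = true := by decide +kernel

theorem pdf_large (t : ℕ) (h : 18 ≤ t) : ∃ bs, IsPDF t bs := by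
  have hw : t = 6 * ((t - 18) / 6) + (18 + (t - 18) % 6) := by omega
  have hr : (t - 18) % 6 < 6 := Nat.mod_lt _ (by norm_num)
  rw [hw]
  generalize (t - 18) / 6 = w
  interval_cases (t - 18) % 6
  · exact pdf_of_chk fam0 18 fam0_ok w
  · exact pdf_of_chk fam1 19 fam1_ok w
  · exact pdf_of_chk fam2 20 fam2_ok w
  · exact pdf_of_chk fam3 21 fam3_ok w
  · exact pdf_of_chk fam4 22 fam4_ok w
  · exact pdf_of_chk fam5 23 fam5_ok w

/-! ### Codes for `v` between 26 and 48 -/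

def zb (v : ℕ) (bs : List (ℕ × ℕ × ℕ)) : List (ZMod v × ZMod v × ZMod v) :=
  bs.map fun b => ((b.1 : ZMod v), (b.2.1 : ZMod v), (b.2.2 : ZMod v))

theorem ooc_zb (v : ℕ) (bs : List (ℕ × ℕ × ℕ)) (n : ℕ) (hn : bs.length = n)
    (h : ((zb v bs).flatMap six2).Nodup) :
    ∃ 𝓒 : Finset (Finset (ZMod v)), IsOOC v 𝓒 ∧ 𝓒.card = n := by
  have := ooc_of_list v (zb v bs) h
  rwa [zb, List.length_map, hn] at this

set_option maxRecDepth 100000 in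
theorem small_v (v : ℕ) (h1 : 26 ≤ v) (h2 : v ≤ 48)
    (h : v % 12 = 1 ∨ v % 12 = 2 ∨ v % 12 = 3 ∨ v % 12 = 4 ∨ v % 12 = 6 ∨ v % 24 = 0) :
    ∃ 𝓒 : Finset (Finset (ZMod v)), IsOOC v 𝓒 ∧ 𝓒.card = (v - 1) / 12 := by
  have hv : v = 26 ∨ v = 27 ∨ v = 28 ∨ v = 30 ∨ v = 37 ∨ v = 38 ∨ v = 39 ∨ v = 40 ∨ v = 42 ∨ v = 48 := by
    omega
  rcases hv with rfl | rfl | rfl | rfl | rfl | rfl | rfl | rfl | rfl | rfl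
  · exact ooc_zb 26 [(1, 3, 9), (4, 11, 16)] 2 rfl (by decide +kernel)
  · exact ooc_zb 27 [(1, 3, 11), (5, 12, 18)] 2 rfl (by decide +kernel)
  · exact ooc_zb 28 [(1, 3, 10), (4, 12, 17)] 2 rfl (by decide +kernel)
  · exact ooc_zb 30 [(1, 3, 8), (4, 10, 21)] 2 rfl (by decide +kernel)
  · exact ooc_zb 37 [(1, 3, 24), (4, 9, 15), (7, 17, 25)] 3 rfl (by decide +kernel)
  · exact ooc_zb 38 [(1, 3, 9), (4, 17, 24), (5, 15, 27)] 3 rfl (by decide +kernel)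
  · exact ooc_zb 39 [(1, 3, 10), (4, 15, 20), (6, 14, 27)] 3 rfl (by decide +kernel)
  · exact ooc_zb 40 [(1, 3, 9), (4, 11, 25), (5, 17, 27)] 3 rfl (by decide +kernel)
  · exact ooc_zb 42 [(1, 3, 7), (5, 14, 30), (8, 18, 31)] 3 rfl (by decide +kernel)
  · exact ooc_zb 48 [(1, 3, 7), (5, 13, 22), (10, 21, 33)] 3 rfl (by decide +kernel)

/-- For every positive integer `v ≡ 1,2,3,4,6 (mod 12)` or `v ≡ 0 (mod 24)`,
a J-optimal `(v,4,1)`-OOC (one with exactly `⌊(v-1)/12⌋` codewords) exists iff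
`v ≠ 25`. -/
theorem stmt_19 (v : ℕ) (hv : 0 < v)
    (h : v % 12 = 1 ∨ v % 12 = 2 ∨ v % 12 = 3 ∨ v % 12 = 4 ∨ v % 12 = 6 ∨ v % 24 = 0) :
    (∃ 𝓒 : Finset (Finset (ZMod v)), IsOOC v 𝓒 ∧ 𝓒.card = (v - 1) / 12) ↔ v ≠ 25 := by
  constructor
  · rintro hex rfl
    exact no25 hex
  · intro h25
    by_cases hs : 26 ≤ v ∧ v ≤ 48
    · exact small_v v hs.1 hs.2 h
    · by_cases h0 : v ≤ 12
      · refine ⟨∅, ⟨by simp, by simp⟩, ?_⟩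
        rw [Finset.card_empty]; omega
      · have hp : ∃ bs, IsPDF ((v - 1) / 12) bs := by
          by_cases h17 : (v - 1) / 12 ≤ 17
          · exact pdf_small _ h17 (by omega) (by omega) (by omega)
          · exact pdf_large _ (by omega)
        obtain ⟨bs, hbs⟩ := hp
        exact ooc_of_pdf _ bs hbs v (by omega)
end
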